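/- For every integer n ≥ 3, the generalized 4-connectivity of the godan graph EA_n equals n − 1, i.e., κ₄(EA_n) = n − 1. -/

import Mathlib

namespace Godan

/-- The transposition (12), using 0-based indices 0,1 for symbols 1,2. -/
def perm12 (n : ℕ) (hn : 3 ≤ n) : Equiv.Perm (Fin n) :=
  Equiv.swap ⟨0, by omega⟩ ⟨1, by omega⟩

/-- The 3-cycle (123): symbol 1 ↦ 2 ↦ 3 ↦ 1, i.e. index 0 ↦ 1 ↦ 2 ↦ 0. -/
def perm123 (n : ℕ) (hn : 3 ≤ n) : Equiv.Perm (Fin n) :=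
  Equiv.swap ⟨0, by omega⟩ ⟨2, by omega⟩ * Equiv.swap ⟨0, by omega⟩ ⟨1, by omega⟩

/-- The 3-cycle (132): symbol 1 ↦ 3 ↦ 2 ↦ 1, i.e. index 0 ↦ 2 ↦ 1 ↦ 0. -/
def perm132 (n : ℕ) (hn : 3 ≤ n) : Equiv.Perm (Fin n) :=
  Equiv.swap ⟨0, by omega⟩ ⟨1, by omega⟩ * Equiv.swap ⟨0, by omega⟩ ⟨2, by omega⟩

/-- Ω* = {(12), (123), (132)} ∪ {(12)(3i) : 4 ≤ i ≤ n}; symbol i has index i - 1,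
so the transposition (3i) is `Equiv.swap ⟨2,_⟩ k` with 3 ≤ k = i - 1 ≤ n - 1. -/
def OmegaStar (n : ℕ) (hn : 3 ≤ n) : Set (Equiv.Perm (Fin n)) :=
  {perm12 n hn, perm123 n hn, perm132 n hn} ∪
    {s | ∃ k : Fin n, 3 ≤ (k : ℕ) ∧ s = perm12 n hn * Equiv.swap ⟨2, by omega⟩ k}

/-- The godan graph EA_n: vertices are the permutations of {1,…,n}, and u,v are
adjacent iff u = v ∘ s for some s ∈ Ω* (note `(v * s) i = v (s i)` in Mathlib).
Since Ω* is closed under inverses, `fromRel` yields exactly this adjacency. -/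
def godanGraph (n : ℕ) (hn : 3 ≤ n) : SimpleGraph (Equiv.Perm (Fin n)) :=
  SimpleGraph.fromRel (fun u v => ∃ s ∈ OmegaStar n hn, u = v * s)

/-- `T 0, …, T (r-1)` is a family of r pairwise internally edge disjoint S-trees:
each `T i` is a subgraph of `G` which is a tree containing all vertices of `S`,
and for i ≠ j, `V(T i) ∩ V(T j) = S` and `E(T i) ∩ E(T j) = ∅`. -/
def IsIDSTFamily {V : Type*} (G : SimpleGraph V) (S : Set V) {r : ℕ}
    (T : Fin r → G.Subgraph) : Prop :=
  (∀ i, S ⊆ (T i).verts ∧ ((T i).coe).IsTree) ∧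
    ∀ i j, i ≠ j → (T i).verts ∩ (T j).verts = S ∧ (T i).edgeSet ∩ (T j).edgeSet = ∅

/-- The maximum number of pairwise internally edge disjoint S-trees in G. -/
noncomputable def maxIDST {V : Type*} (G : SimpleGraph V) (S : Set V) : ℕ :=
  sSup {r : ℕ | ∃ T : Fin r → G.Subgraph, IsIDSTFamily G S T}

/-- The generalized k-connectivity κ_k(G): the minimum over all k-element vertex
sets S of the maximum number of pairwise internally edge disjoint S-trees. -/
noncomputable def genConn {V : Type*} [Fintype V] (G : SimpleGraph V) (k : ℕ) : ℕ :=
  sInf {m : ℕ | ∃ S : Finset V, S.card = k ∧ maxIDST G (↑S : Set V) = m}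

/-- Three distinguished distinct positions. -/
class Tri (α : Type*) where
  a : α
  b : α
  c : α
  hab : a ≠ b
  hac : a ≠ c
  hbc : b ≠ c

open Equiv Tri

set_option linter.unusedSectionVars false

section General

variable {α : Type*} [Fintype α] [DecidableEq α] [Tri α]

/-- The odd move: exchange the values at the first two distinguished positions. -/
def bar (u : Perm α) : Perm α := u * swap a b

/-- The even generator bringing the value at position `r` to position `c`. -/
def tau (r : α) : Perm α :=
  if r = c then 1 else if r = a then swap a c * swap a b
  else if r = b then swap a b * swap a c else swap a b * swap c r

/-- The element of the closed even neighbourhood of `u` with colour `j`. -/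
def con (u : Perm α) (j : α) : Perm α := u * tau (u.symm j)

/-- A position other than the three distinguished ones. -/
def Ext (p : α) : Prop := p ≠ a ∧ p ≠ b ∧ p ≠ c

omit [Fintype α] in
theorem tau_cc : (tau c : Perm α) = 1 := if_pos rfl

omit [Fintype α] in
theorem tau_a : (tau a : Perm α) = swap a c * swap a b := by
  rw [tau, if_neg hac, if_pos rfl]

omit [Fintype α] in
theorem tau_b : (tau b : Perm α) = swap a b * swap a c := by
  rw [tau, if_neg hbc, if_neg hab.symm, if_pos rfl]

omit [Fintype α] in
theorem tau_ext {r : α} (h : Ext r) : (tau r : Perm α) = swap a b * swap c r := by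
  rw [tau, if_neg h.2.2, if_neg h.1, if_neg h.2.1]

omit [Fintype α] [DecidableEq α] in
theorem pos_cases (r : α) : r = a ∨ r = b ∨ r = c ∨ Ext r := by
  unfold Ext; tauto

omit [Fintype α] in
theorem swap_comm_ext {r : α} (h : Ext r) :
    (swap a b * swap c r : Perm α) = swap c r * swap a b := by
  have := hab (α := α); have := hac (α := α); have := hbc (α := α)
  obtain ⟨h1, h2, h3⟩ := h
  ext q
  simp only [Perm.mul_apply, swap_apply_def]
  grind

omit [Fintype α] in
theorem tau_c (r : α) : (tau r : Perm α) c = r := by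
  have := hab (α := α); have := hac (α := α); have := hbc (α := α)
  rcases pos_cases r with rfl | rfl | rfl | h
  · rw [tau_a, Perm.mul_apply, swap_apply_of_ne_of_ne hac.symm hbc.symm, swap_apply_right]
  · rw [tau_b, Perm.mul_apply, swap_apply_right, swap_apply_left]
  · rw [tau_cc]; rfl
  · rw [tau_ext h, Perm.mul_apply, swap_apply_left, swap_apply_of_ne_of_ne h.1 h.2.1]

omit [Fintype α] in
theorem tau_of_ne {r q : α} (hq : Ext q) (h : q ≠ r) : (tau r : Perm α) q = q := by
  obtain ⟨h1, h2, h3⟩ := hq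
  rcases pos_cases r with rfl | rfl | rfl | hr
  · rw [tau_a, Perm.mul_apply, swap_apply_of_ne_of_ne h1 h2, swap_apply_of_ne_of_ne h1 h3]
  · rw [tau_b, Perm.mul_apply, swap_apply_of_ne_of_ne h1 h3, swap_apply_of_ne_of_ne h1 h2]
  · rw [tau_cc]; rfl
  · rw [tau_ext hr, Perm.mul_apply, swap_apply_of_ne_of_ne h3 h, swap_apply_of_ne_of_ne h1 h2]

omit [Fintype α] in
theorem tau_self {r : α} (hr : Ext r) : (tau r : Perm α) r = c := by
  rw [tau_ext hr, Perm.mul_apply, swap_apply_right, swap_apply_of_ne_of_ne hac.symm hbc.symm]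

theorem sign_tau (r : α) : Perm.sign (tau r : Perm α) = 1 := by
  rcases pos_cases r with rfl | rfl | rfl | hr
  · rw [tau_a, Perm.sign_mul, Perm.sign_swap hab, Perm.sign_swap hac]; rfl
  · rw [tau_b, Perm.sign_mul, Perm.sign_swap hab, Perm.sign_swap hac]; rfl
  · rw [tau_cc, Perm.sign_one]
  · rw [tau_ext hr, Perm.sign_mul, Perm.sign_swap hab, Perm.sign_swap hr.2.2.symm]; rfl

omit [Fintype α] in
theorem tau_mul_tau (r : α) : (tau r * tau ((tau r).symm c) : Perm α) = 1 := by
  have := hab (α := α); have := hac (α := α); have := hbc (α := α)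
  rcases pos_cases r with rfl | rfl | rfl | hr
  · have : (tau (a : α)).symm c = b := by
      rw [Equiv.symm_apply_eq, tau_a, Perm.mul_apply, swap_apply_right, swap_apply_left]
    rw [this, tau_a, tau_b, mul_assoc, swap_mul_self_mul, swap_mul_self]
  · have : (tau (b : α)).symm c = a := by
      rw [Equiv.symm_apply_eq, tau_b, Perm.mul_apply, swap_apply_left,
        swap_apply_of_ne_of_ne hac.symm hbc.symm]
    rw [this, tau_a, tau_b, mul_assoc, swap_mul_self_mul, swap_mul_self]
  · rw [tau_cc, one_mul]
    exact tau_cc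
  · have : (tau r).symm c = r := by
      rw [Equiv.symm_apply_eq, tau_self hr]
    rw [this, tau_ext hr]
    nth_rw 1 [swap_comm_ext hr]
    rw [mul_assoc, swap_mul_self_mul, swap_mul_self]

omit [Fintype α] in
theorem swap_tau (r : α) : (swap a b * tau (swap a b r) : Perm α) = tau r * swap a b := by
  rcases pos_cases r with rfl | rfl | rfl | hr
  · rw [swap_apply_left, tau_a, tau_b, swap_mul_self_mul, mul_assoc, swap_mul_self, mul_one]
  · rw [swap_apply_right, tau_a, tau_b, mul_assoc]
  · rw [swap_apply_of_ne_of_ne hac.symm hbc.symm, tau_cc, one_mul, mul_one]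
  · rw [swap_apply_of_ne_of_ne hr.1 hr.2.1, tau_ext hr, mul_assoc, swap_comm_ext hr]

omit [Fintype α] in
@[simp] theorem bar_bar (u : Perm α) : bar (bar u) = u := by
  simp [bar, mul_assoc]

omit [Fintype α] in
@[simp] theorem bar_c (u : Perm α) : bar u c = u c := by
  simp [bar, Perm.mul_apply, swap_apply_of_ne_of_ne (hac (α := α)).symm (hbc (α := α)).symm]

omit [Fintype α] in
theorem bar_ext (u : Perm α) {q : α} (hq : Ext q) : bar u q = u q := by
  simp [bar, Perm.mul_apply, swap_apply_of_ne_of_ne hq.1 hq.2.1]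

theorem sign_bar (u : Perm α) : Perm.sign (bar u) = - Perm.sign u := by
  simp [bar, Perm.sign_swap (hab (α := α))]

omit [Tri α] in
theorem sign_ne_iff (u v : Perm α) :
    Perm.sign u ≠ Perm.sign v ↔ Perm.sign u = - Perm.sign v := by
  rcases Int.units_eq_one_or (Perm.sign u) with h | h <;>
  rcases Int.units_eq_one_or (Perm.sign v) with h' | h' <;> rw [h, h'] <;> decide

omit [Fintype α] in
@[simp] theorem con_c (u : Perm α) (j : α) : con u j c = j := by
  simp [con, Perm.mul_apply, tau_c]

omit [Fintype α] in
@[simp] theorem con_self (u : Perm α) : con u (u c) = u := by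
  simp [con, tau]

omit [Fintype α] in
theorem con_eq_self {u : Perm α} {j : α} (h : u c = j) : con u j = u := by
  subst h; simp

omit [Fintype α] in
theorem con_of_ne (u : Perm α) {j q : α} (hq : Ext q) (h : u q ≠ j) : con u j q = u q := by
  rw [con, Perm.mul_apply, tau_of_ne hq]
  rintro rfl; simp at h

omit [Fintype α] in
theorem con_at (u : Perm α) {q : α} (hq : Ext q) : con u (u q) q = u c := by
  simp [con, Perm.mul_apply, tau_self hq]

omit [Fintype α] in
@[simp] theorem con_con_self (u : Perm α) (j : α) : con (con u j) (u c) = u := by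
  have : (con u j).symm (u c) = (tau (u.symm j)).symm c := by
    simp [con, Equiv.symm_apply_eq, Perm.mul_apply]
  rw [con, this, con, mul_assoc, tau_mul_tau, mul_one]

@[simp] theorem sign_con (u : Perm α) (j : α) : Perm.sign (con u j) = Perm.sign u := by
  simp [con, sign_tau]

omit [Fintype α] in
theorem con_bar (u : Perm α) (j : α) : con (bar u) j = bar (con u j) := by
  have : (bar u).symm j = swap a b (u.symm j) := by
    simp [bar, Equiv.symm_apply_eq, Perm.mul_apply]
  rw [con, this, bar, bar, con, mul_assoc, swap_tau, mul_assoc]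

theorem bar_ne_of_sign {u v : Perm α} (h : Perm.sign u = Perm.sign v) : bar u ≠ v := by
  rintro rfl
  rw [sign_bar] at h
  rcases Int.units_eq_one_or (Perm.sign u) with h' | h' <;> rw [h'] at h <;> revert h <;> decide

omit [Fintype α] in
theorem bar_inj {u v : Perm α} (h : bar u = bar v) : u = v := by
  rw [← bar_bar u, h, bar_bar]

theorem eq_of_agree {u v : Perm α} (hs : Perm.sign u = Perm.sign v)
    (h : ∀ q, q ≠ a → q ≠ b → u q = v q) : u = v := by
  by_cases ha : u a = v a
  · ext q
    by_cases hqa : q = a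
    · rw [hqa, ha]
    by_cases hqb : q = b
    · subst hqb
      obtain ⟨r, hr⟩ := u.surjective (v b)
      by_cases hra : r = a
      · subst hra
        exact absurd (v.injective (ha.symm.trans hr)) hab
      · by_cases hrb : r = b
        · rw [← hr, hrb]
        · exact absurd (v.injective ((h r hra hrb).symm.trans hr)) hrb
    · exact h q hqa hqb
  · exfalso
    have hab' : u a = v b := by
      obtain ⟨r, hr⟩ := v.surjective (u a)
      by_cases hra : r = a
      · subst hra; exact absurd hr.symm ha
      by_cases hrb : r = b
      · rw [← hr, hrb]
      · exact absurd (u.injective ((h r hra hrb).trans hr)) hra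
    have hba' : u b = v a := by
      obtain ⟨r, hr⟩ := u.surjective (v a)
      by_cases hra : r = a
      · subst hra; exact absurd hr ha
      by_cases hrb : r = b
      · rw [← hr, hrb]
      · exact absurd (v.injective ((h r hra hrb).symm.trans hr)) hra
    refine bar_ne_of_sign hs.symm (u := v) ?_
    ext q
    by_cases hqa : q = a
    · subst hqa; simp [bar, Perm.mul_apply, hab']
    by_cases hqb : q = b
    · subst hqb; simp [bar, Perm.mul_apply, hba']
    · simp [bar, Perm.mul_apply, swap_apply_of_ne_of_ne hqa hqb, h q hqa hqb]

/-- The permutations that agree with `u` outside the set `B` of free positions. -/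
def K (B : Finset α) (u : Perm α) : Set (Perm α) := {w | ∀ q, q ∉ B → w q = u q}

/-- The elements of `K B u` with the same sign as `u`. -/
def Lay (B : Finset α) (u : Perm α) : Set (Perm α) :=
  {w | w ∈ K B u ∧ Perm.sign w = Perm.sign u}

/-- The values taken on the free positions. -/
def cols (B : Finset α) (u : Perm α) : Finset α := B.image u

/-- The set of free positions contains the three distinguished ones. -/
def Core (B : Finset α) : Prop := a ∈ B ∧ b ∈ B ∧ c ∈ B

/-- The neighbour of `u` along the edge that moves position `p`. -/
abbrev out (p : α) (u : Perm α) : Perm α := con u (u p)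

/-- The godan graph on the permutations of `α`. -/
def EG (α : Type*) [DecidableEq α] [Tri α] : SimpleGraph (Perm α) where
  Adj u v := v = bar u ∨ (u ≠ v ∧ v = con u (v c))
  symm := ⟨by
    rintro u v (h | ⟨h1, h2⟩)
    · left; rw [h, bar_bar]
    · right
      refine ⟨h1.symm, ?_⟩
      conv_rhs => rw [h2]
      rw [con_con_self]⟩
  loopless := ⟨by
    rintro u (h | h)
    · have h2 : u a = bar u a := congrArg (fun w : Perm α => w a) h
      simp [bar, Perm.mul_apply] at h2
      exact hab h2
    · exact h.1 rfl⟩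

omit [Fintype α] in
theorem adj_bar (u : Perm α) : (EG α).Adj u (bar u) := Or.inl rfl

omit [Fintype α] in
theorem adj_con {u : Perm α} {j : α} (h : u c ≠ j) : (EG α).Adj u (con u j) := by
  refine Or.inr ⟨fun h' => h ?_, by simp⟩
  rw [h', con_c]

omit [Fintype α] [DecidableEq α] [Tri α] in
theorem K_refl (B : Finset α) (u : Perm α) : u ∈ K B u := fun _ _ => rfl

omit [Fintype α] [DecidableEq α] [Tri α] in
theorem K_symm {B : Finset α} {u v : Perm α} (h : v ∈ K B u) : u ∈ K B v :=
  fun q hq => (h q hq).symm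

omit [Fintype α] [DecidableEq α] [Tri α] in
theorem K_trans {B : Finset α} {u v w : Perm α} (h : v ∈ K B u) (h' : w ∈ K B v) : w ∈ K B u :=
  fun q hq => (h' q hq).trans (h q hq)

omit [Fintype α] [DecidableEq α] [Tri α] in
theorem K_eq {B : Finset α} {u v : Perm α} (h : v ∈ K B u) : K B v = K B u :=
  Set.ext fun _ => ⟨fun h' => K_trans h h', fun h' => K_trans (K_symm h) h'⟩

omit [Fintype α] [Tri α] in
theorem mem_cols {B : Finset α} {u : Perm α} {j : α} : j ∈ cols B u ↔ u.symm j ∈ B := by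
  simp only [cols, Finset.mem_image]
  constructor
  · rintro ⟨q, hq, rfl⟩; simpa
  · intro h; exact ⟨_, h, by simp⟩

omit [Fintype α] [Tri α] in
theorem val_mem {B : Finset α} {u : Perm α} {q : α} (h : q ∈ B) : u q ∈ cols B u :=
  Finset.mem_image_of_mem _ h

omit [Fintype α] [Tri α] in
theorem cols_eq {B : Finset α} {u v : Perm α} (h : v ∈ K B u) : cols B v = cols B u := by
  ext j
  simp only [mem_cols]
  constructor
  · intro h1; by_contra h2
    have := h _ h2
    rw [Equiv.apply_symm_apply, ← Equiv.eq_symm_apply] at this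
    rw [this] at h2
    exact h2 h1
  · intro h1; by_contra h2
    have := h _ h2
    rw [Equiv.apply_symm_apply, ← Equiv.symm_apply_eq] at this
    rw [← this] at h2
    exact h2 h1

omit [Fintype α] [Tri α] in
theorem val_mem' {B : Finset α} {u v : Perm α} {q : α} (h : q ∈ B) (hv : v ∈ K B u) :
    v q ∈ cols B u := cols_eq hv ▸ val_mem h

omit [Fintype α] [Tri α] in
theorem card_cols (B : Finset α) (u : Perm α) : (cols B u).card = B.card :=
  Finset.card_image_of_injective _ u.injective

omit [Fintype α] [DecidableEq α] in
theorem ext_of_notMem {B : Finset α} (hB : Core B) {q : α} (hq : q ∉ B) : Ext q :=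
  ⟨fun h => hq (h ▸ hB.1), fun h => hq (h ▸ hB.2.1), fun h => hq (h ▸ hB.2.2)⟩

omit [Fintype α] in
theorem bar_mem {B : Finset α} (hB : Core B) {u v : Perm α} (hv : v ∈ K B u) : bar v ∈ K B u :=
  fun q hq => by rw [bar_ext _ (ext_of_notMem hB hq)]; exact hv q hq

omit [Fintype α] in
theorem con_mem {B : Finset α} (hB : Core B) {u v : Perm α} (hv : v ∈ K B u) {j : α}
    (hj : j ∈ cols B u) : con v j ∈ K B u := by
  intro q hq
  rw [← cols_eq hv, mem_cols] at hj
  rw [con_of_ne _ (ext_of_notMem hB hq), hv q hq]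
  rintro rfl
  simp at hj; exact hq hj

theorem con_lay {B : Finset α} (hB : Core B) {u v : Perm α} (hv : v ∈ Lay B u) {j : α}
    (hj : j ∈ cols B u) : con v j ∈ Lay B u :=
  ⟨con_mem hB hv.1 hj, by rw [sign_con, hv.2]⟩

theorem bar_lay {B : Finset α} (hB : Core B) {u v : Perm α} (hv : v ∈ K B u)
    (hs : Perm.sign v ≠ Perm.sign u) : bar v ∈ Lay B u :=
  ⟨bar_mem hB hv, by rw [sign_bar, (sign_ne_iff _ _).1 hs, neg_neg]⟩

omit [Fintype α] [Tri α] in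
theorem mem_erase {B : Finset α} {u w : Perm α} {p : α} :
    w ∈ K (B.erase p) u ↔ w ∈ K B u ∧ w p = u p := by
  constructor
  · intro h
    exact ⟨fun q hq => h q fun h' => hq (Finset.mem_of_mem_erase h'), h p (by simp)⟩
  · rintro ⟨h1, h2⟩ q hq
    by_cases h : q = p
    · rw [h, h2]
    · exact h1 q fun h' => hq (Finset.mem_erase.2 ⟨h, h'⟩)

omit [Fintype α] [Tri α] in
theorem cols_erase {B : Finset α} {u : Perm α} {p : α} :
    cols (B.erase p) u = (cols B u).erase (u p) := by
  rw [cols, cols, Finset.image_erase u.injective]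

omit [Fintype α] in
theorem core_erase {B : Finset α} (hB : Core B) {p : α} (hp : Ext p) : Core (B.erase p) :=
  ⟨Finset.mem_erase.2 ⟨hp.1.symm, hB.1⟩, Finset.mem_erase.2 ⟨hp.2.1.symm, hB.2.1⟩,
    Finset.mem_erase.2 ⟨hp.2.2.symm, hB.2.2⟩⟩

omit [Fintype α] in
theorem out_p {p : α} (hp : Ext p) (u : Perm α) : out p u p = u c := con_at u hp

omit [Fintype α] in
theorem out_out {p : α} (hp : Ext p) (u : Perm α) : out p (out p u) = u := by
  rw [out, out_p hp, con_con_self]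

omit [Fintype α] in
theorem out_bar {p : α} (hp : Ext p) (u : Perm α) : out p (bar u) = bar (out p u) := by
  rw [out, bar_ext _ hp, con_bar]

omit [Fintype α] [DecidableEq α] in
theorem c_ne_p {p : α} (hp : Ext p) (u : Perm α) : u c ≠ u p := fun h => hp.2.2 (u.injective h).symm

omit [Fintype α] in
/-- Every element of a layer without further free positions is determined by its colour. -/
theorem exists_ext_or {B : Finset α} (hB : Core B) :
    (∃ p ∈ B, Ext p) ∨ B = {a, b, c} := by
  by_cases h : ∃ p ∈ B, Ext p
  · exact Or.inl h
  · right
    push Not at h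
    ext q
    obtain ⟨h1, h2, h3⟩ := hB
    simp only [Finset.mem_insert, Finset.mem_singleton]
    constructor
    · intro hq
      have := h q hq
      unfold Ext at this; tauto
    · rintro (rfl | rfl | rfl) <;> assumption

omit [Fintype α] in
theorem card_core : ({a, b, c} : Finset α).card = 3 := by
  rw [Finset.card_insert_of_notMem, Finset.card_insert_of_notMem, Finset.card_singleton]
  · simpa using hbc
  · simpa using ⟨hab, hac⟩

omit [Fintype α] in
theorem exists_ext {B : Finset α} (hB : Core B) (h : 4 ≤ B.card) : ∃ p ∈ B, Ext p := by
  rcases exists_ext_or hB with h' | h'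
  · exact h'
  · rw [h', card_core] at h; omega

/-- `H` contains all edges of the godan graph inside `X`. -/
def Ful (H : SimpleGraph (Perm α)) (X : Set (Perm α)) : Prop :=
  ∀ u ∈ X, ∀ v ∈ X, (EG α).Adj u v → H.Adj u v

omit [Fintype α] in
theorem Ful.mono {H : SimpleGraph (Perm α)} {X Y : Set (Perm α)} (h : Ful H X) (hY : Y ⊆ X) :
    Ful H Y := fun u hu v hv => h u (hY hu) v (hY hv)

omit [Fintype α] in
theorem Ful.con {H : SimpleGraph (Perm α)} {X : Set (Perm α)} (h : Ful H X) {u : Perm α} {j : α}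
    (hu : u ∈ X) (hv : con u j ∈ X) : H.Reachable u (con u j) := by
  by_cases hj : u c = j
  · rw [con_eq_self hj]
  · exact (h _ hu _ hv (adj_con hj)).reachable

omit [Fintype α] in
theorem Ful.bar {H : SimpleGraph (Perm α)} {X : Set (Perm α)} (h : Ful H X) {u : Perm α}
    (hu : u ∈ X) (hv : bar u ∈ X) : H.Reachable u (bar u) :=
  (h _ hu _ hv (adj_bar u)).reachable

theorem eq_con_of_core {B : Finset α} (hB : B = {a, b, c}) {u w : Perm α} (h : w ∈ Lay B u) :
    w = con u (w c) := by
  refine eq_of_agree (by rw [sign_con, h.2]) fun q hqa hqb => ?_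
  by_cases hqc : q = c
  · subst hqc; rw [con_c]
  · have hq : q ∉ B := by simp [hB, hqa, hqb, hqc]
    have hcore : Core B := by simp [hB, Core]
    rw [con_mem hcore (K_refl B u) (val_mem' hcore.2.2 h.1) q hq, h.1 q hq]

theorem lay_linked_aux (m : ℕ) : ∀ (B : Finset α), B.card ≤ m → Core B → ∀ (u : Perm α)
    (H : SimpleGraph (Perm α)), Ful H (Lay B u) → ∀ w ∈ Lay B u, H.Reachable u w := by
  induction m with
  | zero =>
    intro B h hB
    rw [Nat.le_zero, Finset.card_eq_zero] at h
    exact absurd hB.1 (by simp [h])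
  | succ m ih =>
    intro B h hB u H hH w hw
    have hu : u ∈ Lay B u := ⟨K_refl B u, rfl⟩
    rcases exists_ext_or hB with ⟨p, hpB, hp⟩ | h3
    · have key : ∀ v ∈ Lay B u, ∀ w ∈ Lay B u, v p = w p → H.Reachable v w := by
        intro v hv w hw hvw
        refine ih (B.erase p) (by rw [Finset.card_erase_of_mem hpB]; omega) (core_erase hB hp) v H
          (hH.mono ?_) w ⟨mem_erase.2 ⟨K_trans (K_symm hv.1) hw.1, hvw.symm⟩, ?_⟩
        · intro x hx
          exact ⟨K_trans hv.1 (mem_erase.1 hx.1).1, hx.2.trans hv.2⟩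
        · rw [hw.2, hv.2]
      by_cases hpw : u p = w p
      · exact key u hu w hw hpw
      · have hwp : w p ∈ cols B u := val_mem' hpB hw.1
        have h1 : con u (w p) ∈ Lay B u := con_lay hB hu hwp
        have h1p : con u (w p) p = u p := con_of_ne u hp hpw
        have h2 : con (con u (w p)) (u p) ∈ Lay B u := con_lay hB h1 (val_mem hpB)
        refine ((hH.con hu h1).trans (hH.con h1 h2)).trans (key _ h2 _ hw ?_)
        have := con_at (con u (w p)) hp
        rw [h1p, con_c] at this
        exact this
    · rw [eq_con_of_core h3 hw]
      exact hH.con hu (by rw [← eq_con_of_core h3 hw]; exact hw)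

/-- Layers are connected. -/
theorem lay_linked {B : Finset α} (hB : Core B) {u : Perm α} {H : SimpleGraph (Perm α)}
    (hH : Ful H (Lay B u)) {v w : Perm α} (hv : v ∈ Lay B u) (hw : w ∈ Lay B u) :
    H.Reachable v w :=
  (lay_linked_aux _ B le_rfl hB u H hH v hv).symm.trans (lay_linked_aux _ B le_rfl hB u H hH w hw)

theorem lay_linked_at {B : Finset α} (hB : Core B) {p : α} (hp : Ext p)
    {u : Perm α} {d : α} {H : SimpleGraph (Perm α)} {X : Set (Perm α)} (hH : Ful H X)
    (hX : ∀ w ∈ Lay B u, w p = d → w ∈ X) {v w : Perm α}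
    (hv : v ∈ Lay B u) (hw : w ∈ Lay B u) (hvd : v p = d) (hwd : w p = d) : H.Reachable v w := by
  refine lay_linked (core_erase hB hp) (u := v) (hH.mono ?_) ⟨K_refl _ _, rfl⟩
    ⟨mem_erase.2 ⟨K_trans (K_symm hv.1) hw.1, hwd.trans hvd.symm⟩, hw.2.trans hv.2.symm⟩
  intro x hx
  have := mem_erase.1 hx.1
  exact hX x ⟨K_trans hv.1 this.1, hx.2.trans hv.2⟩ (this.2.trans hvd)

/-- The union of the subcopies of a layer indexed by `D` is connected. -/
theorem hub_linked {B : Finset α} (hB : Core B) {p : α} (hpB : p ∈ B) (hp : Ext p)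
    {u : Perm α} {D : Set α} {H : SimpleGraph (Perm α)} {X : Set (Perm α)} (hH : Ful H X)
    (hX : ∀ w ∈ Lay B u, w p ∈ D → w ∈ X) {v w : Perm α}
    (hv : v ∈ Lay B u) (hw : w ∈ Lay B u) (hvD : v p ∈ D) (hwD : w p ∈ D) : H.Reachable v w := by
  by_cases h : v p = w p
  · exact lay_linked_at hB hp (d := w p) hH (fun x hx h' => hX x hx (h' ▸ hwD)) hv hw h rfl
  · have h1 : con v (w p) ∈ Lay B u := con_lay hB hv (val_mem' hpB hw.1)
    have h1p : con v (w p) p = v p := con_of_ne v hp h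
    have h2 : out p (con v (w p)) ∈ Lay B u := con_lay hB h1 (val_mem' hpB h1.1)
    have h2p : out p (con v (w p)) p = w p := by rw [out_p hp, con_c]
    have e1 := lay_linked_at hB hp (d := v p) hH (fun x hx h' => hX x hx (h' ▸ hvD)) hv h1 rfl h1p
    have e2 := lay_linked_at hB hp (d := w p) hH (fun x hx h' => hX x hx (h' ▸ hwD)) h2 hw h2p rfl
    exact (e1.trans (hH.con (hX _ h1 (by rw [h1p]; exact hvD))
      (hX _ h2 (by rw [h2p]; exact hwD)))).trans e2

omit [Fintype α] [Tri α] in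
theorem exists_col {B : Finset α} {u : Perm α} (F : Finset α) (h : F.card < B.card) :
    ∃ d ∈ cols B u, d ∉ F := by
  by_contra hcon
  push Not at hcon
  have : cols B u ⊆ F := hcon
  have := Finset.card_le_card this
  rw [card_cols] at this
  omega

/-- Removing two vertices from a layer of the alternating group network leaves it connected. -/
theorem lay_minus_two {B : Finset α} (hB : Core B) (h4 : 4 ≤ B.card) {u t t' : Perm α}
    {H : SimpleGraph (Perm α)} (hH : Ful H (Lay B u \ {t, t'})) {v w : Perm α}
    (hv : v ∈ Lay B u \ {t, t'}) (hw : w ∈ Lay B u \ {t, t'}) : H.Reachable v w := by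
  obtain ⟨p, hpB, hp⟩ := exists_ext hB h4
  set D : Set α := {d | d ≠ t p ∧ d ≠ t' p} with hD
  have hX : ∀ w ∈ Lay B u, w p ∈ D → w ∈ Lay B u \ {t, t'} := by
    intro w hw hwD
    refine ⟨hw, ?_⟩
    rintro (rfl | rfl)
    · exact hwD.1 rfl
    · exact hwD.2 rfl
  have key : ∀ v ∈ Lay B u \ {t, t'}, ∃ v', v' ∈ Lay B u ∧ v' p ∈ D ∧ H.Reachable v v' := by
    intro v hv
    by_cases hvD : v p ∈ D
    · exact ⟨v, hv.1, hvD, SimpleGraph.Reachable.refl _⟩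
    · obtain ⟨d, hd, hdF⟩ := exists_col (B := B) (u := u)
        {t p, if t p = t' p then t' c else t' p, if v p = t p then t c else t' c}
        (lt_of_le_of_lt Finset.card_le_three h4)
      simp only [Finset.mem_insert, Finset.mem_singleton, not_or] at hdF
      simp only [hD, Set.mem_ofPred_eq] at hvD
      have hdD : d ∈ D := by
        simp only [hD, Set.mem_ofPred_eq]
        refine ⟨hdF.1, fun h => ?_⟩
        have := hdF.2.1
        split_ifs at this with h'
        · exact hdF.1 (h.trans h'.symm)
        · exact this h
      have hdv : v p ≠ d := by
        rintro rfl; exact hvD hdD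
      have h1 : con v d ∈ Lay B u := con_lay hB hv.1 hd
      have h1p : con v d p = v p := con_of_ne v hp hdv
      have h2 : out p (con v d) ∈ Lay B u := con_lay hB h1 (val_mem' hpB h1.1)
      have h2p : out p (con v d) p = d := by rw [out_p hp, con_c]
      have h2D : out p (con v d) p ∈ D := by rw [h2p]; exact hdD
      have hct : con v d ≠ t := by
        intro h
        have hvt : v p = t p := by rw [← h, h1p]
        rw [if_pos hvt, ← h, con_c] at hdF
        exact hdF.2.2 rfl
      have hct' : con v d ≠ t' := by
        intro h
        have hvt : v p = t' p := by rw [← h, h1p]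
        have h3 : d = t' c := by rw [← h, con_c]
        by_cases h4 : v p = t p
        · rw [if_pos (h4.symm.trans hvt)] at hdF
          exact hdF.2.1 h3
        · rw [if_neg h4] at hdF
          exact hdF.2.2 h3
      have h1X : con v d ∈ Lay B u \ {t, t'} := ⟨h1, by simp [hct, hct']⟩
      exact ⟨_, h2, h2D, (hH.con hv h1X).trans (hH.con h1X (hX _ h2 h2D))⟩
  obtain ⟨v', hv', hv'D, e1⟩ := key v hv
  obtain ⟨w', hw', hw'D, e2⟩ := key w hw
  exact (e1.trans (hub_linked hB hpB hp hH hX hv' hw' hv'D hw'D)).trans e2.symm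

/-- Removing a closed even neighbourhood from a layer leaves it connected. -/
theorem lay_minus_nbhd {B : Finset α} (hB : Core B) (h4 : 4 ≤ B.card) {x : Perm α}
    {H : SimpleGraph (Perm α)} {X : Set (Perm α)} (hH : Ful H X)
    (hX : ∀ w ∈ Lay B x, w ≠ con x (w c) → w ∈ X) {v w : Perm α}
    (hv : v ∈ Lay B x) (hvx : v ≠ con x (v c)) (hw : w ∈ Lay B x) (hwx : w ≠ con x (w c)) :
    H.Reachable v w := by
  obtain ⟨p, hpB, hp⟩ := exists_ext hB h4
  have hnb : ∀ w : Perm α, w = con x (w c) → w p = x p ∨ (w p = x c ∧ w c = x p) := by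
    intro w hw
    by_cases h : x p = w c
    · right
      refine ⟨?_, h.symm⟩
      rw [hw, ← h, con_at x hp]
    · left
      rw [hw, con_of_ne x hp h]
  set D : Set α := {d | d ≠ x p ∧ d ≠ x c} with hD
  have hXD : ∀ w ∈ Lay B x, w p ∈ D → w ∈ X := by
    intro w hw hwD
    refine hX w hw fun h => ?_
    rcases hnb w h with h | h
    · exact hwD.1 h
    · exact hwD.2 h.1
  have key2 : ∀ v ∈ Lay B x, v ≠ con x (v c) → v p = x c →
      ∃ v', v' ∈ Lay B x ∧ v' p ∈ D ∧ H.Reachable v v' := by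
    intro v hv hvx hvp
    obtain ⟨d, hd, hdF⟩ := exists_col (B := B) (u := x) {x p, x c}
      (lt_of_le_of_lt Finset.card_le_two (by omega))
    simp only [Finset.mem_insert, Finset.mem_singleton, not_or] at hdF
    have hdv : v p ≠ d := by rw [hvp]; exact fun h => hdF.2 h.symm
    have h1 : con v d ∈ Lay B x := con_lay hB hv hd
    have h1p : con v d p = v p := con_of_ne v hp hdv
    have h2 : out p (con v d) ∈ Lay B x := con_lay hB h1 (val_mem' hpB h1.1)
    have h2p : out p (con v d) p = d := by rw [out_p hp, con_c]
    have h2D : out p (con v d) p ∈ D := by rw [h2p]; exact hdF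
    have h1X : con v d ∈ X := by
      refine hX _ h1 fun h => ?_
      rcases hnb _ h with h | h
      · rw [h1p, hvp] at h; exact c_ne_p hp x h
      · rw [con_c] at h; exact hdF.1 h.2
    exact ⟨_, h2, h2D, (hH.con (hX v hv hvx) h1X).trans (hH.con h1X (hXD _ h2 h2D))⟩
  have key : ∀ v ∈ Lay B x, v ≠ con x (v c) →
      ∃ v', v' ∈ Lay B x ∧ v' p ∈ D ∧ H.Reachable v v' := by
    intro v hv hvx
    by_cases hvD : v p ∈ D
    · exact ⟨v, hv, hvD, SimpleGraph.Reachable.refl _⟩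
    by_cases hvc : v p = x c
    · exact key2 v hv hvx hvc
    have hvp : v p = x p := by
      by_contra h; exact hvD ⟨h, hvc⟩
    have h1 : out p v ∈ Lay B x := con_lay hB hv (val_mem' hpB hv.1)
    have h1p : out p v p = v c := out_p hp v
    have h1x : out p v ≠ con x (out p v c) := by
      rw [con_c, hvp]
      intro h
      apply hvx
      have hpx : v = x := by
        have e := out_out hp v
        have e' := out_out hp x
        have : out p v = out p x := by
          show con v (v p) = con x (x p)
          exact h
        rw [← e, this, e']
      rw [hpx, con_self]
    have e1 : H.Reachable v (out p v) := hH.con (hX v hv hvx) (hX _ h1 h1x)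
    by_cases h1D : out p v p ∈ D
    · exact ⟨_, h1, h1D, e1⟩
    · have : out p v p = x c := by
        by_contra h
        refine h1D ⟨?_, h⟩
        rw [h1p, ← hvp]; exact c_ne_p hp v
      obtain ⟨v', a1, a2, a3⟩ := key2 _ h1 h1x this
      exact ⟨v', a1, a2, e1.trans a3⟩
  obtain ⟨v', hv', hv'D, e1⟩ := key v hv hvx
  obtain ⟨w', hw', hw'D, e2⟩ := key w hw hwx
  exact (e1.trans (hub_linked hB hpB hp hH hXD hv' hw' hv'D hw'D)).trans e2.symm

omit [Fintype α] in
/-- A proper neighbour of `x` has a neighbour outside the closed even neighbourhood of `x`. -/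
theorem exists_second {B : Finset α} (hB : Core B) (h4 : 4 ≤ B.card) {x : Perm α} {j : α}
    (hjx : j ≠ x c) :
    ∃ k ∈ cols B x, con (con x j) k ≠ con x k ∧ k ≠ j := by
  obtain ⟨p, hpB, hp⟩ := exists_ext hB h4
  by_cases hje : Ext (x.symm j)
  · have hjq : x (x.symm j) = j := by simp
    set q := x.symm j with hq
    refine ⟨x b, val_mem hB.2.1, fun h => ?_, ?_⟩
    · have h1 : con x j q = x c := by rw [← hjq, con_at x hje]
      have h2 : con (con x j) (x b) q = x c := by
        rw [con_of_ne _ hje, h1]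
        rw [h1]; exact fun h => hbc (x.injective h).symm
      have h3 : con x (x b) q = x q := con_of_ne x hje fun h => hje.2.1 (x.injective h)
      rw [h, h3] at h2
      exact hje.2.2 (x.injective h2)
    · rw [← hjq]; exact fun h => hje.2.1 (x.injective h).symm
  · have hjp : x p ≠ j := by
      intro h; apply hje; rw [← h]; simpa
    refine ⟨x p, val_mem hpB, fun h => ?_, hjp⟩
    have h1 : con x j p = x p := con_of_ne x hp hjp
    have h2 : con (con x j) (x p) p = j := by
      conv_lhs => rw [← h1]
      rw [con_at _ hp, con_c]
    rw [h, con_at x hp] at h2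
    exact hjx h2.symm

/-- There is a layer vertex with prescribed distinct value at `p` and colour. -/
theorem exists_val_col {B : Finset α} (hB : Core B) {p : α} (hpB : p ∈ B) (hp : Ext p)
    {x : Perm α} {d e : α} (hd : d ∈ cols B x) (he : e ∈ cols B x) (hde : d ≠ e) :
    ∃ w ∈ Lay B x, w p = d ∧ w c = e := by
  have hx : x ∈ Lay B x := ⟨K_refl _ _, rfl⟩
  by_cases h : x p = d
  · exact ⟨con x e, con_lay hB hx he, by rw [con_of_ne x hp (h ▸ hde), h], con_c _ _⟩
  · have h1 : con x d ∈ Lay B x := con_lay hB hx hd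
    have h2 : out p (con x d) ∈ Lay B x := con_lay hB h1 (val_mem' hpB h1.1)
    have h2p : out p (con x d) p = d := by rw [out_p hp, con_c]
    refine ⟨con (out p (con x d)) e, con_lay hB h2 he, ?_, con_c _ _⟩
    rw [con_of_ne _ hp (by rw [h2p]; exact hde), h2p]

/-- Some layer vertex avoids the closed even neighbourhoods of two given vertices. -/
theorem exists_avoid_two {B : Finset α} (hB : Core B) (h4 : 4 ≤ B.card) (x z : Perm α) :
    ∃ w ∈ Lay B x, w ≠ con x (w c) ∧ w ≠ con z (w c) := by
  obtain ⟨p, hpB, hp⟩ := exists_ext hB h4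
  obtain ⟨d, hd, hdF⟩ := exists_col (B := B) (u := x) {x p, x c, z p}
    (lt_of_le_of_lt Finset.card_le_three h4)
  simp only [Finset.mem_insert, Finset.mem_singleton, not_or] at hdF
  obtain ⟨e, he, heF⟩ := exists_col (B := B) (u := x) {d, z p}
    (lt_of_le_of_lt Finset.card_le_two (by omega))
  simp only [Finset.mem_insert, Finset.mem_singleton, not_or] at heF
  obtain ⟨w, hw, hwp, hwc⟩ := exists_val_col hB hpB hp hd he (Ne.symm heF.1)
  refine ⟨w, hw, fun h => ?_, fun h => ?_⟩
  · by_cases h' : x p = w c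
    · rw [h, ← h', con_at x hp] at hwp; exact hdF.2.1 hwp.symm
    · rw [h, con_of_ne x hp h'] at hwp; exact hdF.1 hwp.symm
  · rw [hwc] at h
    rw [h, con_of_ne z hp (Ne.symm heF.2)] at hwp; exact hdF.2.2 hwp.symm

/-- Availability of a vertex for the label `j`: terminals are always available, other vertices
only if they carry the label `j`. -/
def Av (D : Set (Perm α)) (S : Finset (Perm α)) (ℓ : Perm α → α) (j : α) (w : Perm α) : Prop :=
  w ∈ D ∧ (w ∉ S → ℓ w = j)

/-- The part of the godan graph on `D` belonging to the label `j`: non-terminals are labelled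
by `ℓ` and edges between terminals by `μ`. -/
def TG (D : Set (Perm α)) (S : Finset (Perm α)) (ℓ : Perm α → α) (μ : Perm α → Perm α → α)
    (j : α) : SimpleGraph (Perm α) where
  Adj u v := (EG α).Adj u v ∧ Av D S ℓ j u ∧ Av D S ℓ j v ∧
    (u ∈ S → v ∈ S → μ u v = j ∧ μ v u = j)
  symm := ⟨fun _ _ ⟨h1, h2, h3, h4⟩ => ⟨h1.symm, h3, h2, fun hv hu => (h4 hu hv).symm⟩⟩
  loopless := ⟨fun _ h => (EG α).irrefl h.1⟩

section Labelled

variable {D : Set (Perm α)} {S : Finset (Perm α)} {ℓ : Perm α → α} {μ : Perm α → Perm α → α}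
  {j : α}

theorem TG.con {u : Perm α} {k : α} (hu : Av D S ℓ j u) (hv : Av D S ℓ j (con u k))
    (h : u ∈ S → Godan.con u k ∈ S → u c ≠ k → μ u (Godan.con u k) = j ∧ μ (Godan.con u k) u = j) :
    (TG D S ℓ μ j).Reachable u (Godan.con u k) := by
  by_cases hj : u c = k
  · rw [con_eq_self hj]
  · exact SimpleGraph.Adj.reachable ⟨adj_con hj, hu, hv, fun h1 h2 => h h1 h2 hj⟩

theorem TG.bar {u : Perm α} (hu : Av D S ℓ j u) (hv : Av D S ℓ j (bar u))
    (h : u ∈ S → Godan.bar u ∈ S → μ u (Godan.bar u) = j ∧ μ (Godan.bar u) u = j) :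
    (TG D S ℓ μ j).Reachable u (Godan.bar u) :=
  SimpleGraph.Adj.reachable ⟨adj_bar u, hu, hv, h⟩

/-- Outside the terminals the available vertices carry all edges. -/
theorem TG.ful {X : Set (Perm α)} (h : ∀ w ∈ X, w ∈ D ∧ w ∉ S ∧ ℓ w = j) :
    Ful (TG D S ℓ μ j) X := fun u hu v hv huv =>
  ⟨huv, ⟨(h u hu).1, fun _ => (h u hu).2.2⟩, ⟨(h v hv).1, fun _ => (h v hv).2.2⟩,
    fun h' => ((h u hu).2.1 h').elim⟩

theorem Av.of_mem {s : Perm α} (h : s ∈ D) (hs : s ∈ S) : Av D S ℓ j s :=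
  ⟨h, fun h' => (h' hs).elim⟩

theorem Av.of_label {s : Perm α} (h : s ∈ D) (hs : ℓ s = j) : Av D S ℓ j s := ⟨h, fun _ => hs⟩

theorem TG.av {u v : Perm α} (h : (TG D S ℓ μ j).Reachable u v) (hu : Av D S ℓ j u) :
    Av D S ℓ j v := by
  obtain ⟨w⟩ := h
  induction w with
  | nil => exact hu
  | cons h _ ih => exact ih h.2.2.1

theorem TG.transport {D' : Set (Perm α)} {S' : Finset (Perm α)} {ℓ' : Perm α → α}
    {μ' : Perm α → Perm α → α} (hD : D ⊆ D') (hS : ∀ w ∈ D, w ∈ S → w ∈ S')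
    (hS' : ∀ w ∈ D, w ∈ S' → w ∈ S)
    (hl : ∀ w ∈ D, w ∉ S → ℓ' w = ℓ w)
    (hm : ∀ v ∈ D, ∀ w ∈ D, v ∈ S → w ∈ S → μ' v w = μ v w) {u v : Perm α}
    (h : (TG D S ℓ μ j).Reachable u v) : (TG D' S' ℓ' μ' j).Reachable u v := by
  refine h.mono fun x y hxy => ?_
  obtain ⟨h1, h2, h3, h4⟩ := hxy
  refine ⟨h1, ⟨hD h2.1, fun h => ?_⟩, ⟨hD h3.1, fun h => ?_⟩, fun hx hy => ?_⟩
  · rw [hl _ h2.1 fun h' => h (hS _ h2.1 h')]; exact h2.2 fun h' => h (hS _ h2.1 h')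
  · rw [hl _ h3.1 fun h' => h (hS _ h3.1 h')]; exact h3.2 fun h' => h (hS _ h3.1 h')
  · have hx' := hS' _ h2.1 hx
    have hy' := hS' _ h3.1 hy
    rw [hm _ h2.1 _ h3.1 hx' hy', hm _ h3.1 _ h2.1 hy' hx']
    exact h4 hx' hy'

/-- All terminals are joined for every label except one. -/
def Packed (B : Finset α) (u : Perm α) (S : Finset (Perm α)) : Prop :=
  ∃ c0 ∈ cols B u, ∃ ℓ μ, ∀ j ∈ cols B u, j ≠ c0 → ∀ s ∈ S, ∀ t ∈ S,
    (TG (K B u) S ℓ μ j).Reachable s t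

/-- For every label `j` every terminal reaches a vertex of colour `j`, together with its
odd neighbour if `W j` holds. -/
def Fan (B : Finset α) (u : Perm α) (W : α → Prop) (S : Finset (Perm α)) : Prop :=
  ∃ ℓ μ, ∀ j ∈ cols B u, ∀ s ∈ S, ∃ h ∈ K B u, h c = j ∧ (TG (K B u) S ℓ μ j).Reachable s h ∧
    (W j → (TG (K B u) S ℓ μ j).Reachable s (bar h))

/-- The vertices with a value different from `d` at position `p`. -/
def Off (B : Finset α) (u : Perm α) (p d : α) : Set (Perm α) := {w | w ∈ K B u ∧ w p ≠ d}

/-- For every label `j ≠ d` the terminals are joined outside the copy `d`, and every vertex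
of copy `j` with a neighbour in copy `d` can be reached. -/
def Joined (B : Finset α) (u : Perm α) (p d : α) (W : α → Prop) (S : Finset (Perm α)) : Prop :=
  ∃ ℓ μ, ∀ j ∈ cols B u, j ≠ d →
    (∀ s ∈ S, ∀ t ∈ S, (TG (Off B u p d) S ℓ μ j).Reachable s t) ∧
    ∀ h ∈ Off B u p d, h p = j → h c = d → ∃ s ∈ S, (TG (Off B u p d) S ℓ μ j).Reachable s h ∨
      (W j ∧ (TG (Off B u p d) S ℓ μ j).Reachable s (bar h))

theorem packed_of_joined {B : Finset α} (hB : Core B) {p : α} (hpB : p ∈ B) (hp : Ext p)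
    {u x : Perm α} {d : α} {W : α → Prop} {S S₀ S₁ : Finset (Perm α)} (hx : x ∈ K B u)
    (hxd : x p = d) (hS : ∀ s, s ∈ S ↔ s ∈ S₀ ∨ s ∈ S₁) (h0 : ∀ s ∈ S₀, s ∈ K (B.erase p) x)
    (h1 : ∀ s ∈ S₁, s ∈ Off B u p d) (hne : S₁.Nonempty)
    (H0 : Fan (B.erase p) x W S₀) (H1 : Joined B u p d W S₁) : Packed B u S := by
  classical
  obtain ⟨ℓ₀, μ₀, H0⟩ := H0
  obtain ⟨ℓ₁, μ₁, H1⟩ := H1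
  have hK : K (B.erase p) x ⊆ K B u := fun w hw => K_trans hx (mem_erase.1 hw).1
  have hKp : ∀ w ∈ K (B.erase p) x, w p = d := fun w hw => (mem_erase.1 hw).2.trans hxd
  have hO : Off B u p d ⊆ K B u := fun w hw => hw.1
  let ℓ : Perm α → α := fun w => if w p = d then ℓ₀ w else ℓ₁ w
  let μ : Perm α → Perm α → α := fun s t =>
    if s p = d then (if t p = d then μ₀ s t else t p) else if t p = d then s p else μ₁ s t
  refine ⟨d, hxd ▸ val_mem' hpB hx, ℓ, μ, fun j hj hjd => ?_⟩
  obtain ⟨H1, H1'⟩ := H1 j hj hjd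
  have T0 : ∀ {v w}, (TG (K (B.erase p) x) S₀ ℓ₀ μ₀ j).Reachable v w →
      (TG (K B u) S ℓ μ j).Reachable v w := by
    intro v w h
    refine TG.transport hK ?_ ?_ ?_ ?_ h
    · exact fun w _ hw => (hS w).2 (Or.inl hw)
    · exact fun w hw hwS => ((hS w).1 hwS).resolve_right fun h => (h1 w h).2 (hKp w hw)
    · intro w hw _
      simp only [ℓ, if_pos (hKp w hw)]
    · intro v hv w hw _ _
      simp only [μ, if_pos (hKp w hw), if_pos (hKp v hv)]
  have T1 : ∀ {v w}, (TG (Off B u p d) S₁ ℓ₁ μ₁ j).Reachable v w →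
      (TG (K B u) S ℓ μ j).Reachable v w := by
    intro v w h
    refine TG.transport hO ?_ ?_ ?_ ?_ h
    · exact fun w _ hw => (hS w).2 (Or.inr hw)
    · exact fun w hw hwS => ((hS w).1 hwS).resolve_left fun h => hw.2 (hKp w (h0 w h))
    · intro w hw _
      simp only [ℓ, if_neg hw.2]
    · intro v hv w hw _ _
      simp only [μ, if_neg hv.2, if_neg hw.2]
  have cross : ∀ v w, v p = d → v c = j → Av (K (B.erase p) x) S₀ ℓ₀ j v →
      Av (Off B u p d) S₁ ℓ₁ j w → w = out p v → (TG (K B u) S ℓ μ j).Reachable v w := by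
    intro v w hvp hvc hv hw hwv
    have hwp : w p = j := by rw [hwv, out_p hp, hvc]
    have hwK : w ∈ K B u := hw.1.1
    have hwd : w p ≠ d := hw.1.2
    have hμ : μ v w = j ∧ μ w v = j := by
      simp only [μ, if_pos hvp, if_neg hwd]
      exact ⟨hwp, hwp⟩
    have hav : Av (K B u) S ℓ j w := ⟨hwK, fun h => by
      simp only [ℓ, if_neg hwd]
      exact hw.2 fun h' => h ((hS _).2 (Or.inr h'))⟩
    subst hwv
    refine TG.con ⟨hK hv.1, fun h => ?_⟩ hav fun _ _ _ => hμ
    simp only [ℓ, if_pos hvp]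
    exact hv.2 fun h' => h ((hS _).2 (Or.inl h'))
  have key : ∀ s ∈ S₀, ∃ t ∈ S₁, (TG (K B u) S ℓ μ j).Reachable s t := by
    intro s hs
    have hjc : j ∈ cols (B.erase p) x := by
      rw [cols_erase, cols_eq hx, hxd]
      exact Finset.mem_erase.2 ⟨hjd, hj⟩
    obtain ⟨h, hhK, hhc, hsh, hsh'⟩ := H0 j hjc s hs
    have hd : d ∈ cols B u := hxd ▸ val_mem' hpB hx
    have hav := TG.av hsh (Av.of_mem (h0 s hs) hs)
    have hhd := hKp h hhK
    have hop : out p h p = j := by rw [out_p hp, hhc]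
    have hoO : out p h ∈ Off B u p d :=
      ⟨con_mem hB (hK hhK) (by rw [hhd]; exact hd), by rw [hop]; exact hjd⟩
    obtain ⟨t, ht, h' | ⟨hW, h'⟩⟩ := H1' (out p h) hoO hop (by rw [con_c, hhd])
    · have hav' := TG.av h' (Av.of_mem (h1 t ht) ht)
      exact ⟨t, ht, (T0 hsh).trans ((cross _ _ hhd hhc hav hav' rfl).trans (T1 h').symm)⟩
    · have hav' := TG.av h' (Av.of_mem (h1 t ht) ht)
      have hav2 := TG.av (hsh' hW) (Av.of_mem (h0 s hs) hs)
      exact ⟨t, ht, (T0 (hsh' hW)).trans ((cross _ _ (by rw [bar_ext _ hp, hhd])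
        (by rw [bar_c, hhc]) hav2 hav' (out_bar hp h).symm).trans (T1 h').symm)⟩
  obtain ⟨z, hz⟩ := hne
  have key2 : ∀ s ∈ S, (TG (K B u) S ℓ μ j).Reachable s z := by
    intro s hs
    rcases (hS s).1 hs with h | h
    · obtain ⟨t, ht, h⟩ := key s h
      exact h.trans (T1 (H1 t ht z hz))
    · exact T1 (H1 s h z hz)
  exact fun s hs t ht => (key2 s hs).trans (key2 t ht).symm

end Labelled

theorem off_linked {B : Finset α} (hB : Core B) {p : α} (hpB : p ∈ B) (hp : Ext p)
    {u : Perm α} {d : α} {H : SimpleGraph (Perm α)} (hH : Ful H (Off B u p d)) {v w : Perm α}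
    (hv : v ∈ Off B u p d) (hw : w ∈ Off B u p d) : H.Reachable v w := by
  have hbar : ∀ v ∈ Off B u p d, bar v ∈ Off B u p d := fun v hv =>
    ⟨bar_mem hB hv.1, by rw [bar_ext _ hp]; exact hv.2⟩
  have key : ∀ v ∈ Off B u p d, ∃ v' ∈ Lay B u, v' p ≠ d ∧ H.Reachable v v' := by
    intro v hv
    by_cases h : Perm.sign v = Perm.sign u
    · exact ⟨v, ⟨hv.1, h⟩, hv.2, SimpleGraph.Reachable.refl _⟩
    · exact ⟨bar v, bar_lay hB hv.1 h, (hbar v hv).2, hH.bar hv (hbar v hv)⟩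
  obtain ⟨v', h1, h2, h3⟩ := key v hv
  obtain ⟨w', h4, h5, h6⟩ := key w hw
  exact h3.trans ((hub_linked hB hpB hp (D := {e | e ≠ d}) hH (fun w hw hd => ⟨hw.1, hd⟩)
    h1 h4 h2 h5).trans h6.symm)

theorem packed_const {B : Finset α} (hB : Core B) {p : α} (hpB : p ∈ B) (hp : Ext p)
    {u x : Perm α} {S : Finset (Perm α)} (hx : x ∈ K B u)
    (hS : ∀ s ∈ S, s ∈ K (B.erase p) x) (h : Packed (B.erase p) x S) : Packed B u S := by
  classical
  obtain ⟨c0, hc0, ℓ, μ, h⟩ := h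
  have hK : K (B.erase p) x ⊆ K B u := fun w hw => K_trans hx (mem_erase.1 hw).1
  have hSp : ∀ s ∈ S, s p = x p := fun s hs => (mem_erase.1 (hS s hs)).2
  have hout : ∀ s ∈ S, out p s ∈ Off B u p (x p) := fun s hs =>
    ⟨con_mem hB (hK (hS s hs)) (val_mem' hpB (hK (hS s hs))), by
      rw [out_p hp, ← hSp s hs]; exact c_ne_p hp s⟩
  refine ⟨c0, ?_, fun w => if w p = x p then ℓ w else x p, μ, fun j hj hjc s hs t ht => ?_⟩
  · rw [cols_erase] at hc0; rw [← cols_eq hx]; exact Finset.mem_of_mem_erase hc0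
  by_cases hjx : j = x p
  · subst hjx
    have hX : ∀ w ∈ Off B u p (x p), w ∈ K B u ∧ w ∉ S ∧
        (if w p = x p then ℓ w else x p) = x p := fun w hw =>
      ⟨hw.1, fun h => hw.2 (hSp w h), if_neg hw.2⟩
    have e : ∀ s ∈ S, (TG (K B u) S (fun w => if w p = x p then ℓ w else x p) μ (x p)).Reachable
        s (out p s) := fun s hs =>
      TG.con (Av.of_mem (hK (hS s hs)) hs) (Av.of_label (hout s hs).1 (if_neg (hout s hs).2))
        fun _ h => ((hout s hs).2 (hSp _ h)).elim
    exact (e s hs).trans ((off_linked hB hpB hp (TG.ful hX) (hout s hs) (hout t ht)).trans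
      (e t ht).symm)
  · refine TG.transport hK (fun _ _ h => h) (fun _ _ h => h) ?_ (fun _ _ _ _ _ _ => rfl)
      (h j ?_ hjc s hs t ht)
    · intro w hw _
      exact if_pos (mem_erase.1 hw).2
    · rw [cols_erase, cols_eq hx]; exact Finset.mem_erase.2 ⟨hjx, hj⟩

theorem fan_const {B : Finset α} (hB : Core B) {p : α} (hpB : p ∈ B) (hp : Ext p)
    {u x : Perm α} {S : Finset (Perm α)} (hx : x ∈ K B u)
    (hS : ∀ s ∈ S, s ∈ K (B.erase p) x) (h : Fan (B.erase p) x (fun _ => False) S) :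
    Fan B u (fun _ => False) S := by
  classical
  obtain ⟨ℓ, μ, h⟩ := h
  have hK : K (B.erase p) x ⊆ K B u := fun w hw => K_trans hx (mem_erase.1 hw).1
  have hSp : ∀ s ∈ S, s p = x p := fun s hs => (mem_erase.1 (hS s hs)).2
  have hout : ∀ s ∈ S, out p s ∈ Off B u p (x p) := fun s hs =>
    ⟨con_mem hB (hK (hS s hs)) (val_mem' hpB (hK (hS s hs))), by
      rw [out_p hp, ← hSp s hs]; exact c_ne_p hp s⟩
  refine ⟨fun w => if w p = x p then ℓ w else w c, μ, fun j hj s hs => ?_⟩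
  by_cases hjx : j = x p
  · subst hjx
    refine ⟨out p s, (hout s hs).1, by rw [con_c, hSp s hs], ?_, False.elim⟩
    refine TG.con (Av.of_mem (hK (hS s hs)) hs) (Av.of_label (hout s hs).1 ?_)
        fun _ h => ((hout s hs).2 (hSp _ h)).elim
    show (if _ then _ else _) = _
    rw [if_neg (hout s hs).2, con_c, hSp s hs]
  · obtain ⟨h, h1, h2, h3, _⟩ := h j (by
      rw [cols_erase, cols_eq hx]; exact Finset.mem_erase.2 ⟨hjx, hj⟩) s hs
    exact ⟨h, hK h1, h2, TG.transport hK (fun _ _ h => h) (fun _ _ h => h)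
      (fun w hw _ => if_pos (mem_erase.1 hw).2) (fun _ _ _ _ _ _ => rfl) h3, False.elim⟩

theorem Fan.mono {B : Finset α} {u : Perm α} {W W' : α → Prop} {S : Finset (Perm α)}
    (h : Fan B u W S) (hW : ∀ j, W' j → W j) : Fan B u W' S := by
  obtain ⟨ℓ, μ, h⟩ := h
  refine ⟨ℓ, μ, fun j hj s hs => ?_⟩
  obtain ⟨h, h1, h2, h3, h4⟩ := h j hj s hs
  exact ⟨h, h1, h2, h3, fun hj => h4 (hW j hj)⟩

theorem fan_pair_adj {B : Finset α} (hB : Core B) {u x y : Perm α} {q : α} (hx : x ∈ K B u)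
    (hy : y ∈ K B u) (hadj : y = con x (y c)) (hne : x ≠ y) (hq : q ≠ y c) :
    Fan B u (fun j => j = q) {x, y} := by
  have hsg : Perm.sign y = Perm.sign x := by rw [hadj, sign_con]
  have hcc : x c ≠ y c := fun h => hne (by rw [hadj, con_eq_self h])
  have hxy : x = con y (x c) := by
    conv_lhs => rw [← con_con_self x (y c), ← hadj]
  have mem : ∀ w, w ∈ ({x, y} : Finset (Perm α)) ↔ w = x ∨ w = y := fun w => by simp
  have hbxy : bar x ≠ bar y := fun h => hne (bar_inj h)
  have bx : ∀ w, Perm.sign w = Perm.sign x → bar w ∉ ({x, y} : Finset (Perm α)) := by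
    intro w hw h
    rcases (mem _).1 h with h | h
    · exact bar_ne_of_sign hw h
    · exact bar_ne_of_sign (hw.trans hsg.symm) h
  let ℓ : Perm α → α := fun w => if w = bar y then x c else w c
  have l1 : ∀ w, w ≠ bar y → ℓ w = w c := fun w hw => if_neg hw
  have l2 : ∀ w, Perm.sign w = Perm.sign x → ℓ w = w c := fun w hw =>
    if_neg fun h => bar_ne_of_sign (hsg.trans hw.symm) h.symm
  have avx : ∀ j, Av (K B u) {x, y} ℓ j x := fun j => Av.of_mem hx ((mem _).2 (Or.inl rfl))
  have avy : ∀ j, Av (K B u) {x, y} ℓ j y := fun j => Av.of_mem hy ((mem _).2 (Or.inr rfl))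
  have con1 : ∀ s ∈ ({x, y} : Finset (Perm α)), ∀ k ∈ cols B u, k ≠ x c → k ≠ y c →
      (TG (K B u) {x, y} ℓ (fun _ _ => y c) k).Reachable s (con s k) ∧
      (TG (K B u) {x, y} ℓ (fun _ _ => y c) k).Reachable s (bar (con s k)) := by
    intro s hs k hk hkx hky
    have hsK : s ∈ K B u := by rcases (mem _).1 hs with rfl | rfl <;> assumption
    have hss : Perm.sign s = Perm.sign x := by
      rcases (mem _).1 hs with rfl | rfl <;> first | rfl | assumption
    have hn : con s k ∉ ({x, y} : Finset (Perm α)) := by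
      intro h
      rcases (mem _).1 h with h | h
      · exact hkx (by rw [← h, con_c])
      · exact hky (by rw [← h, con_c])
    have h1 : Av (K B u) {x, y} ℓ k (con s k) :=
      Av.of_label (con_mem hB hsK hk) (by rw [l2 _ (by rw [sign_con, hss]), con_c])
    have h2 : Av (K B u) {x, y} ℓ k (bar (con s k)) :=
      Av.of_label (bar_mem hB h1.1) (by
        rw [l1 _ fun h => hky (by rw [← bar_inj h, con_c]), bar_c, con_c])
    have h3 := TG.con (μ := fun _ _ => y c) (Av.of_mem hsK hs) h1 fun _ h => (hn h).elim
    exact ⟨h3, h3.trans (TG.bar h1 h2 fun h => (hn h).elim)⟩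
  have hxbx : (TG (K B u) {x, y} ℓ (fun _ _ => y c) (x c)).Reachable x (bar x) :=
    TG.bar (avx _) (Av.of_label (bar_mem hB hx) (by rw [l1 _ hbxy, bar_c]))
      fun _ h => (bx x rfl h).elim
  refine ⟨ℓ, fun _ _ => y c, fun k hk s hs => ?_⟩
  by_cases hkx : k = x c
  · subst hkx
    rcases (mem _).1 hs with rfl | rfl
    · exact ⟨s, hx, rfl, SimpleGraph.Reachable.refl _, fun _ => hxbx⟩
    · have h1 : Av (K B u) {x, s} ℓ (x c) (bar s) := Av.of_label (bar_mem hB hy) (if_pos rfl)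
      have hbx : con (bar s) (x c) = bar x := by rw [con_bar, ← hxy]
      have h2 : (TG (K B u) {x, s} ℓ (fun _ _ => s c) (x c)).Reachable s (bar x) := by
        refine (TG.bar (avy _) h1 fun _ h => (bx s hsg h).elim).trans ?_
        rw [← hbx]
        refine TG.con h1 ?_ fun h => (bx s hsg h).elim
        rw [hbx]
        exact Av.of_label (bar_mem hB hx) (by rw [l1 _ hbxy, bar_c])
      exact ⟨bar x, bar_mem hB hx, bar_c x, h2, fun _ => by
        rw [bar_bar]; exact h2.trans hxbx.symm⟩
  by_cases hky : k = y c
  · subst hky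
    refine ⟨y, hy, rfl, ?_, fun h => (hq h.symm).elim⟩
    rcases (mem _).1 hs with rfl | rfl
    · have := TG.con (k := y c) (μ := fun _ _ => y c) (avx (y c)) (by rw [← hadj]; exact avy _)
        fun _ _ _ => ⟨rfl, rfl⟩
      rwa [← hadj] at this
    · exact SimpleGraph.Reachable.refl _
  have hsK : s ∈ K B u := by rcases (mem _).1 hs with rfl | rfl <;> assumption
  obtain ⟨h1, h2⟩ := con1 s hs k hk hkx hky
  exact ⟨con s k, con_mem hB hsK hk, con_c _ _, h1, fun _ => h2⟩

theorem fan_pair {B : Finset α} (hB : Core B) {u x y : Perm α} (q : α) (hx : x ∈ K B u)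
    (hy : y ∈ K B u) (hne : x ≠ y) : Fan B u (fun j => j = q) {x, y} := by
  by_cases hadj : y = con x (y c)
  · by_cases hq : q = y c
    · have hxy : x = con y (x c) := by
        conv_lhs => rw [← con_con_self x (y c), ← hadj]
      rw [Finset.pair_comm]
      refine fan_pair_adj hB hy hx hxy hne.symm ?_
      rw [hq]
      intro h
      exact hne (by rw [hadj, con_eq_self h.symm])
    · exact fan_pair_adj hB hx hy hadj hne hq
  have mem : ∀ w, w ∈ ({x, y} : Finset (Perm α)) ↔ w = x ∨ w = y := fun w => by simp
  have hadj' : x ≠ con y (x c) := fun h => hadj (by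
    conv_lhs => rw [← con_con_self y (x c), ← h])
  refine ⟨fun w => w c, fun _ _ => q, fun k hk s hs => ?_⟩
  have hsK : s ∈ K B u := by rcases (mem _).1 hs with rfl | rfl <;> assumption
  have h1 : Av (K B u) {x, y} (fun w => w c) k (con s k) :=
    Av.of_label (con_mem hB hsK hk) (con_c _ _)
  have h2 : Av (K B u) {x, y} (fun w => w c) k (bar (con s k)) :=
    Av.of_label (bar_mem hB h1.1) (by rw [bar_c, con_c])
  have h3 : (TG (K B u) {x, y} (fun w => w c) (fun _ _ => q) k).Reachable s (con s k) := by
    refine TG.con (Av.of_mem hsK hs) h1 fun _ h hsk => ?_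
    have : con s k = con s (con s k c) := by rw [con_c]
    have hne' : s ≠ con s k := fun h => hsk (by rw [h, con_c])
    rcases (mem _).1 hs with rfl | rfl <;> rcases (mem _).1 h with h | h <;> rw [h] at this hne'
    all_goals first | exact (hne' rfl).elim | exact (hadj this).elim | exact (hadj' this).elim
  exact ⟨con s k, h1.1, con_c _ _, h3, fun hkq => h3.trans
    (TG.bar h1 h2 fun _ _ => ⟨hkq.symm, hkq.symm⟩)⟩

theorem fan_center {B : Finset α} (hB : Core B) {u x : Perm α} {S : Finset (Perm α)}
    (hS : ∀ s ∈ S, s ∈ K B u) (hx : x ∈ S)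
    (h1 : ∀ s ∈ S, ∀ t ∈ S, s ≠ t → t = con s (t c) → s = x ∨ t = x)
    (h2 : ∀ y ∈ S, y ≠ x → y = con x (y c) → ∀ w ∈ S, w = bar y ∨ con w (y c) ≠ bar y) :
    Fan B u (fun _ => False) S := by
  classical
  let ℓ : Perm α → α := fun w =>
    if bar w ∈ S ∧ bar w ≠ x ∧ bar w = con x (bar w c) then x c else w c
  let μ : Perm α → Perm α → α := fun s t =>
    if s = x ∧ t ≠ x ∧ t = con x (t c) then t c
    else if t = x ∧ s ≠ x ∧ s = con x (s c) then s c else x c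
  refine ⟨ℓ, μ, fun j hj s hs => ?_⟩
  have hxK := hS x hx
  have hsK := hS s hs
  have hsj := con_mem hB hsK hj
  by_cases hsx : s = x
  · subst hsx
    refine ⟨con s j, hsj, con_c _ _, TG.con (Av.of_mem hsK hs) ⟨hsj, fun _ => ?_⟩ ?_, False.elim⟩
    · show (if _ then _ else _) = j
      rw [if_neg, con_c]
      rintro ⟨-, -, h⟩
      have := congrArg Perm.sign h
      rw [sign_con, sign_bar, sign_con] at this
      exact bar_ne_of_sign (u := s) (v := bar s) (by rw [sign_bar, this]) rfl
    · intro _ _ hne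
      have e : con s j ≠ s := fun h => hne (by
        have := con_c s j
        rwa [h] at this)
      have e' : s ≠ con s j := e.symm
      constructor
      · show (if _ then _ else _) = j
        rw [if_pos ⟨rfl, e, by rw [con_c]⟩, con_c]
      · show (if _ then _ else _) = j
        rw [if_neg fun h => e h.1, if_pos ⟨rfl, e, by rw [con_c]⟩, con_c]
  by_cases hsx' : con s j = x
  · have hjx : j = x c := by rw [← hsx', con_c]
    have hsadj : s = con x (s c) := by rw [← hsx', con_con_self]
    have hsg : Perm.sign s = Perm.sign x := by rw [hsadj, sign_con]
    have hbs : Av (K B u) S ℓ j (bar s) := by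
      refine Av.of_label (bar_mem hB hsK) ?_
      show (if _ then _ else _) = j
      rw [bar_bar, if_pos ⟨hs, hsx, hsadj⟩, hjx]
    have hbx : con (bar s) j = bar x := by rw [con_bar, hsx']
    have hbxA : Av (K B u) S ℓ j (con (bar s) j) := by
      rw [hbx]
      refine Av.of_label (bar_mem hB hxK) ?_
      show (if _ then _ else _) = j
      rw [bar_bar, if_neg fun h => h.2.1 rfl, bar_c, hjx]
    have hb : bar s ≠ x := bar_ne_of_sign hsg
    have hb' : bar x ≠ x := bar_ne_of_sign rfl
    refine ⟨con (bar s) j, hbxA.1, con_c _ _, ?_, False.elim⟩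
    refine (TG.bar (Av.of_mem hsK hs) hbs fun _ _ => ?_).trans (TG.con hbs hbxA fun _ _ _ => ?_)
    · constructor
      · show (if _ then _ else if _ then _ else _) = j
        rw [if_neg fun h => hsx h.1, if_neg fun h => hb h.1, hjx]
      · show (if _ then _ else if _ then _ else _) = j
        rw [if_neg fun h => hb h.1, if_neg fun h => hsx h.1, hjx]
    · rw [hbx]
      constructor
      · show (if _ then _ else if _ then _ else _) = j
        rw [if_neg fun h => hb h.1, if_neg fun h => hb' h.1, hjx]
      · show (if _ then _ else if _ then _ else _) = j
        rw [if_neg fun h => hb' h.1, if_neg fun h => hb h.1, hjx]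
  refine ⟨con s j, hsj, con_c _ _, ?_, False.elim⟩
  by_cases hsj' : con s j = s
  · rw [hsj']
  refine TG.con (Av.of_mem hsK hs) ⟨hsj, fun hn => ?_⟩ fun _ h' _ => ?_
  · show (if _ then _ else _) = j
    rw [if_neg, con_c]
    rintro ⟨h3, h4, h5⟩
    rcases h2 _ h3 h4 h5 s hs with h | h
    · rw [bar_bar] at h; exact hsj' h.symm
    · rw [bar_bar, bar_c, con_c] at h; exact h rfl
  · rcases h1 s hs _ h' (Ne.symm hsj') (by rw [con_c]) with h | h
    · exact (hsx h).elim
    · exact (hsx' h).elim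

theorem con_ne_of_far {w t : Perm α} {p q : α} (hp : Ext p) (hq : Ext q) (hpq : p ≠ q)
    (h1 : w p ≠ t p) (h2 : w q ≠ t q) (k : α) : con w k ≠ t ∧ con w k ≠ bar t := by
  by_cases h : w p = k
  · have h' : w q ≠ k := fun h'' => hpq (w.injective (h.trans h''.symm))
    have e := con_of_ne w hq h'
    exact ⟨fun he => h2 (by rw [← e, he]), fun he => h2 (by rw [← e, he, bar_ext _ hq])⟩
  · have e := con_of_ne w hp h
    exact ⟨fun he => h1 (by rw [← e, he]), fun he => h1 (by rw [← e, he, bar_ext _ hp])⟩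

theorem fan_of_far {B : Finset α} (hB : Core B) {u x y z : Perm α} 
    (hS : ∀ s ∈ ({x, y, z} : Finset (Perm α)), s ∈ K B u) {p q : α} (hp : Ext p) (hq : Ext q)
    (hpq : p ≠ q) (h1 : y p ≠ z p) (h2 : y q ≠ z q) :
    Fan B u (fun _ => False) {x, y, z} := by
  have f1 := con_ne_of_far hp hq hpq h1 h2
  have f2 := con_ne_of_far hp hq hpq h1.symm h2.symm
  refine fan_center hB (x := x) hS (by simp) ?_ ?_
  · intro s hs t ht hst hadj
    simp only [Finset.mem_insert, Finset.mem_singleton] at hs ht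
    rcases hs with rfl | rfl | rfl
    · exact Or.inl rfl
    · rcases ht with rfl | rfl | rfl
      · exact Or.inr rfl
      · exact (hst rfl).elim
      · exact ((f1 _).1 hadj.symm).elim
    · rcases ht with rfl | rfl | rfl
      · exact Or.inr rfl
      · exact ((f2 _).1 hadj.symm).elim
      · exact (hst rfl).elim
  · intro y' hy' hne hadj w hw
    right
    simp only [Finset.mem_insert, Finset.mem_singleton] at hy' hw
    have hb : bar y' ≠ y' := bar_ne_of_sign rfl
    rcases hw with rfl | rfl | rfl
    · rw [← hadj]; exact hb.symm
    · rcases hy' with rfl | rfl | rfl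
      · exact (hne rfl).elim
      · rw [con_self]; exact hb.symm
      · exact (f1 _).2
    · rcases hy' with rfl | rfl | rfl
      · exact (hne rfl).elim
      · exact (f2 _).2
      · rw [con_self]; exact hb.symm

theorem fan_of_adj {B : Finset α} (hB : Core B) {u x y z : Perm α}
    (hS : ∀ s ∈ ({x, y, z} : Finset (Perm α)), s ∈ K B u) {p q : α} (hp : Ext p) (hq : Ext q)
    (hpq : p ≠ q) (hnp : ¬ (x p = y p ∧ z p = x p)) (hnq : ¬ (x q = y q ∧ z q = x q))
    (hadj : y = con x (y c)) :
    Fan B u (fun _ => False) {x, y, z} := by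
  have S1 : ({x, y, z} : Finset (Perm α)) = {y, x, z} := by ext; simp; tauto
  have hpq' : x p ≠ y c → x p = y p := fun h => by
    conv_rhs => rw [hadj]
    exact (con_of_ne x hp h).symm
  have hqq' : x q ≠ y c → x q = y q := fun h => by
    conv_rhs => rw [hadj]
    exact (con_of_ne x hq h).symm
  have hor : x p = y p ∨ x q = y q := by
    by_cases h : x p = y c
    · exact Or.inr (hqq' fun h' => hpq (x.injective (h.trans h'.symm)))
    · exact Or.inl (hpq' h)
  by_cases hz : y p ≠ z p ∧ y q ≠ z q
  · exact fan_of_far hB hS hp hq hpq hz.1 hz.2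
  · rw [S1]
    rw [S1] at hS
    refine fan_of_far hB hS hp hq hpq ?_ ?_
    · grind
    · grind

theorem fan_three (hbase : ∀ (B : Finset α), Core B → B.card = 4 → ∀ u (S : Finset (Perm α)),
      S.card = 3 → (∀ s ∈ S, s ∈ K B u) → Fan B u (fun _ => False) S) (m : ℕ) :
    ∀ (B : Finset α), B.card = m + 4 → Core B → ∀ u (S : Finset (Perm α)),
      S.card = 3 → (∀ s ∈ S, s ∈ K B u) → Fan B u (fun _ => False) S := by
  induction m with
  | zero => exact fun B h hB => hbase B hB h
  | succ m ih =>
    intro B hcard hB u S hS3 hS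
    obtain ⟨x, y, z, hxy, hxz, hyz, rfl⟩ := Finset.card_eq_three.1 hS3
    by_cases hconst : ∃ p ∈ B, Ext p ∧ x p = y p ∧ z p = x p
    · obtain ⟨p, hpB, hp, h1, h2⟩ := hconst
      have hx := hS x (by simp)
      have hS' : ∀ s ∈ ({x, y, z} : Finset (Perm α)), s ∈ K (B.erase p) x := by
        intro s hs
        refine mem_erase.2 ⟨K_trans (K_symm hx) (hS s hs), ?_⟩
        simp only [Finset.mem_insert, Finset.mem_singleton] at hs
        rcases hs with rfl | rfl | rfl
        · rfl
        · exact h1.symm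
        · exact h2
      exact fan_const hB hpB hp hx hS' (ih _ (by rw [Finset.card_erase_of_mem hpB, hcard]; omega)
        (core_erase hB hp) x _ hS3 hS')
    · obtain ⟨p, hpB, hp⟩ := exists_ext hB (by omega)
      obtain ⟨q, hqB, hq⟩ := exists_ext (core_erase hB hp)
        (by rw [Finset.card_erase_of_mem hpB, hcard]; omega)
      have hpq : p ≠ q := (Finset.mem_erase.1 hqB).1.symm
      replace hqB := (Finset.mem_erase.1 hqB).2
      have n1 : ∀ r, (r = p ∨ r = q) → ¬ (x r = y r ∧ z r = x r) := by
        rintro r (rfl | rfl) h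
        · exact hconst ⟨_, hpB, hp, h⟩
        · exact hconst ⟨_, hqB, hq, h⟩
      have n2 := n1 p (Or.inl rfl)
      have n3 := n1 q (Or.inr rfl)
      have symm : ∀ {s t : Perm α}, t = con s (t c) → s = con t (s c) := fun {s t} h => by
        conv_lhs => rw [← con_con_self s (t c), ← h]
      by_cases a1 : y = con x (y c)
      · exact fan_of_adj hB hS hp hq hpq n2 n3 a1
      by_cases a2 : z = con x (z c)
      · have e : ({x, y, z} : Finset (Perm α)) = {x, z, y} := by
          rw [Finset.pair_comm y z]
        rw [e] at hS ⊢
        exact fan_of_adj hB hS hp hq hpq (fun h => n2 ⟨h.2.symm, h.1.symm⟩)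
          (fun h => n3 ⟨h.2.symm, h.1.symm⟩) a2
      by_cases a3 : z = con y (z c)
      · have e : ({x, y, z} : Finset (Perm α)) = {y, z, x} := by
          rw [Finset.insert_comm x y, Finset.pair_comm x z]
        rw [e] at hS ⊢
        exact fan_of_adj hB hS hp hq hpq (fun h => n2 ⟨h.2, h.1.symm.trans h.2.symm⟩)
          (fun h => n3 ⟨h.2, h.1.symm.trans h.2.symm⟩) a3
      have na : ∀ s ∈ ({x, y, z} : Finset (Perm α)), ∀ t ∈ ({x, y, z} : Finset (Perm α)),
          s ≠ t → t ≠ con s (t c) := by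
        intro s hs t ht hst hadj
        simp only [Finset.mem_insert, Finset.mem_singleton] at hs ht
        rcases hs with rfl | rfl | rfl <;> rcases ht with rfl | rfl | rfl <;>
        first
        | exact hst rfl
        | exact a1 hadj
        | exact a2 hadj
        | exact a3 hadj
        | exact a1 (symm hadj)
        | exact a2 (symm hadj)
        | exact a3 (symm hadj)
      exact fan_center hB (x := x) hS (by simp)
        (fun s hs t ht hst hadj => (na s hs t ht hst hadj).elim)
        (fun t ht hne hadj => (na x (by simp) t ht hne.symm hadj).elim)

/-- The vertices whose value at `p` lies in `Z`. -/
def Sec (B : Finset α) (u : Perm α) (p : α) (Z : Set α) : Set (Perm α) :=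
  {w | w ∈ K B u ∧ w p ∈ Z}

/-- One terminal `X i` in each copy `i ∈ O`. -/
structure Spread (B : Finset α) (p : α) (u : Perm α) (Z : Set α) (O : Finset α) (X : α → Perm α)
    (S : Finset (Perm α)) : Prop where
  core : Core B
  mem : p ∈ B
  ext : Ext p
  sub : ∀ i ∈ O, i ∈ Z
  inK : ∀ i ∈ O, X i ∈ K B u
  val : ∀ i ∈ O, X i p = i
  iff : ∀ w, w ∈ S ↔ w p ∈ O ∧ w = X (w p)

/-- The labelling giving `t i k` to the neighbour of `X i` of colour `k` and `h i` to the rest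
of copy `i`; the other copies are labelled by their own value. -/
def slab (p : α) (O : Finset α) (X : α → Perm α) (h : α → α) (t : α → α → α) (w : Perm α) : α :=
  if w p ∈ O then (if w = con (X (w p)) (w c) then t (w p) (w c) else h (w p)) else w p

/-- The labels of edges between terminals in different copies. -/
def smu (p : α) (t : α → α → α) (v w : Perm α) : α := t (v p) (w p)

namespace Spread

variable {B : Finset α} {p : α} {u : Perm α} {Z : Set α} {O : Finset α} {X : α → Perm α}
  {S : Finset (Perm α)} {h : α → α} {t : α → α → α} {i k : α} {w : Perm α}

theorem cmem (H : Spread B p u Z O X S) (hi : i ∈ O) : i ∈ cols B u := by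
  have := val_mem' H.mem (H.inK i hi)
  rwa [H.val i hi] at this

theorem xS (H : Spread B p u Z O X S) (hi : i ∈ O) : X i ∈ S :=
  (H.iff _).2 ⟨by rwa [H.val i hi], by rw [H.val i hi]⟩

theorem xav (H : Spread B p u Z O X S) (hi : i ∈ O) {ℓ : Perm α → α} {τ : α} :
    Av (Sec B u p Z) S ℓ τ (X i) :=
  Av.of_mem ⟨H.inK i hi, by rw [H.val i hi]; exact H.sub i hi⟩ (H.xS hi)

theorem con_p (H : Spread B p u Z O X S) (hi : i ∈ O) (hik : i ≠ k) : con (X i) k p = i := by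
  rw [con_of_ne _ H.ext (by rw [H.val i hi]; exact hik), H.val i hi]

theorem xcav (H : Spread B p u Z O X S) (hi : i ∈ O) (hik : i ≠ k) (hk : k ∈ cols B u) :
    Av (Sec B u p Z) S (slab p O X h t) (t i k) (con (X i) k) := by
  have hp := H.con_p hi hik
  refine Av.of_label ⟨con_mem H.core (H.inK i hi) hk, by rw [hp]; exact H.sub i hi⟩ ?_
  rw [slab, hp, if_pos hi, con_c, if_pos rfl]

theorem con_eq_x (H : Spread B p u Z O X S) (hi : i ∈ O) (hik : i ≠ k)
    (hS : con (X i) k ∈ S) : con (X i) k = X i := by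
  have := ((H.iff _).1 hS).2
  rwa [H.con_p hi hik] at this

/-- A terminal is joined to its neighbours. -/
theorem step (H : Spread B p u Z O X S) (hi : i ∈ O) (hik : i ≠ k) (hk : k ∈ cols B u) :
    (TG (Sec B u p Z) S (slab p O X h t) (smu p t) (t i k)).Reachable (X i) (con (X i) k) :=
  TG.con (H.xav hi) (H.xcav hi hik hk) fun _ h' hne => (hne (by
    rw [← H.con_eq_x hi hik h', con_c])).elim

theorem free (H : Spread B p u Z O X S) (hi : i ∈ O) (hw : w ∈ K B u) (hwp : w p = i)
    (hwX : w ≠ con (X i) (w c)) :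
    w ∈ Sec B u p Z ∧ w ∉ S ∧ slab p O X h t w = h i := by
  subst hwp
  refine ⟨⟨hw, H.sub _ hi⟩, fun h' => ?_, ?_⟩
  · have := ((H.iff _).1 h').2
    exact hwX (by rw [← this, con_self])
  · rw [slab, if_pos hi, if_neg hwX]

theorem opp_ne {v w : Perm α} (h : Perm.sign w = - Perm.sign v) (k : α) : w ≠ con v k := by
  intro h'
  have : Perm.sign w = Perm.sign v := by rw [h', sign_con]
  exact (sign_ne_iff w v).2 h this

/-- A terminal is joined to every other vertex of its copy carrying the main label. -/
theorem hub (H : Spread B p u Z O X S) (hi : i ∈ O) (hw : w ∈ K B u) (hwp : w p = i)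
    (hwX : w ≠ con (X i) (w c)) :
    (TG (Sec B u p Z) S (slab p O X h t) (smu p t) (h i)).Reachable (X i) w := by
  have hbc : Core (B.erase p) := core_erase H.core H.ext
  have hbX : bar (X i) ∈ K B u := bar_mem H.core (H.inK i hi)
  have hbp : bar (X i) p = i := by rw [bar_ext _ H.ext, H.val i hi]
  have hXf : ∀ w ∈ Lay (B.erase p) (bar (X i)), w ∈ Sec B u p Z ∧ w ∉ S ∧
      slab p O X h t w = h i := by
    intro w hw
    obtain ⟨hw1, hw2⟩ := hw
    obtain ⟨hw3, hw4⟩ := mem_erase.1 hw1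
    exact H.free hi (K_trans hbX hw3) (hw4.trans hbp)
      (opp_ne (by rw [hw2, sign_bar]) _)
  have e1 : (TG (Sec B u p Z) S (slab p O X h t) (smu p t) (h i)).Reachable (X i)
      (bar (X i)) := by
    obtain ⟨a1, a2, a3⟩ := hXf (bar (X i)) ⟨K_refl _ _, rfl⟩
    exact TG.bar (H.xav hi) (Av.of_label a1 a3) fun _ h' => (a2 h').elim
  have e2 : ∀ w ∈ K B u, w p = i → Perm.sign w = - Perm.sign (X i) →
      (TG (Sec B u p Z) S (slab p O X h t) (smu p t) (h i)).Reachable (X i) w :=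
    fun w hw hwp hs => e1.trans (lay_linked hbc (TG.ful hXf) ⟨K_refl _ _, rfl⟩
      ⟨mem_erase.2 ⟨K_trans (K_symm hbX) hw, hwp.trans hbp.symm⟩, by rw [hs, sign_bar]⟩)
  by_cases hs : Perm.sign w = Perm.sign (X i)
  · have hbs : Perm.sign (Godan.bar w) = - Perm.sign (X i) := by rw [sign_bar, hs]
    have h1 := e2 (Godan.bar w) (bar_mem H.core hw) (by rw [bar_ext _ H.ext, hwp]) hbs
    refine h1.trans ?_
    obtain ⟨a1, a2, a3⟩ := H.free (h := h) (t := t) hi hw hwp hwX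
    obtain ⟨b1, b2, b3⟩ := H.free (h := h) (t := t) hi (bar_mem H.core hw)
      (by rw [bar_ext _ H.ext, hwp]) (opp_ne hbs _)
    exact (TG.bar (Av.of_label a1 a3) (Av.of_label b1 b3) fun h' => (a2 h').elim).symm
  · exact e2 w hw hwp ((sign_ne_iff _ _).1 hs)

/-- The neighbours of `X i` and `X k` pointing to each other's copies are adjacent. -/
def _root_.Godan.Bad (p : α) (X : α → Perm α) (i k : α) : Prop :=
  out p (con (X i) k) = con (X k) i

theorem bad_symm (H : Spread B p u Z O X S) (hb : Bad p X i k) : Bad p X k i := by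
  have := out_out H.ext (con (X i) k)
  rw [hb] at this
  exact this

theorem out_mem (H : Spread B p u Z O X S) (hi : i ∈ O) (hik : i ≠ k) (hk : k ∈ cols B u) :
    out p (con (X i) k) ∈ K B u ∧ out p (con (X i) k) p = k ∧ out p (con (X i) k) c = i := by
  refine ⟨con_mem H.core (con_mem H.core (H.inK i hi) hk) ?_, ?_, ?_⟩
  · rw [H.con_p hi hik]; exact H.cmem hi
  · rw [out_p H.ext, con_c]
  · rw [con_c, H.con_p hi hik]

theorem link (H : Spread B p u Z O X S) (hi : i ∈ O) (hk : k ∈ O) (hik : i ≠ k)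
    (hb : ¬ Bad p X i k) (hh : h k = t i k) :
    (TG (Sec B u p Z) S (slab p O X h t) (smu p t) (t i k)).Reachable (X i) (X k) := by
  obtain ⟨a1, a2, a3⟩ := H.out_mem hi hik (H.cmem hk)
  have hne : out p (con (X i) k) ≠ con (X k) (out p (con (X i) k) c) := by rw [a3]; exact hb
  obtain ⟨b1, b2, b3⟩ := H.free (h := h) (t := t) hk a1 a2 hne
  have e := H.hub (h := h) (t := t) hk a1 a2 hne
  rw [hh] at e b3
  exact (H.step hi hik (H.cmem hk)).trans ((TG.con (H.xcav hi hik (H.cmem hk))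
    (Av.of_label b1 b3) fun _ h' => (b2 h').elim).trans e.symm)

theorem link_bad (H : Spread B p u Z O X S) (hi : i ∈ O) (hk : k ∈ O) (hik : i ≠ k)
    (hb : Bad p X i k) (ht : t i k = t k i) :
    (TG (Sec B u p Z) S (slab p O X h t) (smu p t) (t i k)).Reachable (X i) (X k) := by
  have e1 := H.step (h := h) (t := t) hi hik (H.cmem hk)
  have e2 := H.step (h := h) (t := t) hk hik.symm (H.cmem hi)
  have a1 := H.xcav (h := h) (t := t) hi hik (H.cmem hk)
  have a2 := H.xcav (h := h) (t := t) hk hik.symm (H.cmem hi)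
  rw [← ht] at e2 a2
  refine e1.trans (SimpleGraph.Reachable.trans ?_ e2.symm)
  have hb' : con (con (X i) k) (con (X i) k p) = con (X k) i := hb
  rw [← hb']
  refine TG.con a1 (hb' ▸ a2) fun _ _ _ => ?_
  rw [hb', smu, smu, H.con_p hi hik, H.con_p hk hik.symm]
  exact ⟨rfl, ht.symm⟩

theorem link_hub (H : Spread B p u Z O X S) (hi : i ∈ O) (hk : k ∈ O) (hik : i ≠ k)
    (hb : Bad p X i k) (hh : h i = h k) :
    (TG (Sec B u p Z) S (slab p O X h t) (smu p t) (h i)).Reachable (X i) (X k) := by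
  have m1 : bar (con (X i) k) ∈ K B u :=
    bar_mem H.core (con_mem H.core (H.inK i hi) (H.cmem hk))
  have m2 : bar (con (X k) i) ∈ K B u :=
    bar_mem H.core (con_mem H.core (H.inK k hk) (H.cmem hi))
  have v1 : bar (con (X i) k) p = i := by rw [bar_ext _ H.ext, H.con_p hi hik]
  have v2 : bar (con (X k) i) p = k := by rw [bar_ext _ H.ext, H.con_p hk hik.symm]
  have n1 := opp_ne (v := X i) (w := bar (con (X i) k)) (by rw [sign_bar, sign_con])
    (bar (con (X i) k) c)
  have n2 := opp_ne (v := X k) (w := bar (con (X k) i)) (by rw [sign_bar, sign_con])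
    (bar (con (X k) i) c)
  have e1 := H.hub (h := h) (t := t) hi m1 v1 n1
  have e2 := H.hub (h := h) (t := t) hk m2 v2 n2
  obtain ⟨a1, a2, a3⟩ := H.free (h := h) (t := t) hi m1 v1 n1
  obtain ⟨b1, b2, b3⟩ := H.free (h := h) (t := t) hk m2 v2 n2
  rw [← hh] at e2 b3
  refine e1.trans (SimpleGraph.Reachable.trans ?_ e2.symm)
  have hb' : con (bar (con (X i) k)) (bar (con (X i) k) p) = bar (con (X k) i) := by
    rw [con_bar, bar_ext _ H.ext]
    exact congrArg Godan.bar hb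
  rw [← hb']
  exact TG.con (Av.of_label a1 a3) (hb' ▸ Av.of_label b1 b3) fun h' => (a2 h').elim

theorem copy_linked (H : Spread B p u Z O X S) (hk : k ∉ O) (hkZ : k ∈ Z) {v w : Perm α}
    (hv : v ∈ K B u) (hvp : v p = k) (hw : w ∈ K B u) (hwp : w p = k) :
    (TG (Sec B u p Z) S (slab p O X h t) (smu p t) k).Reachable v w := by
  have hbc : Core (B.erase p) := core_erase H.core H.ext
  have hf : ∀ w ∈ K (B.erase p) v, w ∈ Sec B u p Z ∧ w ∉ S ∧ slab p O X h t w = k := by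
    intro w hw
    obtain ⟨h1, h2⟩ := mem_erase.1 hw
    have h3 : w p = k := h2.trans hvp
    refine ⟨⟨K_trans hv h1, by rw [h3]; exact hkZ⟩, fun h' => ?_, ?_⟩
    · exact hk (h3 ▸ ((H.iff w).1 h').1)
    · rw [slab, h3, if_neg hk]
  have hF : Ful (TG (Sec B u p Z) S (slab p O X h t) (smu p t) k) (K (B.erase p) v) := TG.ful hf
  have hwv : w ∈ K (B.erase p) v := mem_erase.2 ⟨K_trans (K_symm hv) hw, hwp.trans hvp.symm⟩
  by_cases hs : Perm.sign w = Perm.sign v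
  · exact lay_linked hbc (u := v) (hF.mono fun _ h => h.1) ⟨K_refl _ _, rfl⟩ ⟨hwv, hs⟩
  · have hb := bar_lay hbc hwv hs
    exact (lay_linked hbc (u := v) (hF.mono fun _ h => h.1) ⟨K_refl _ _, rfl⟩ hb).trans
      (hF.bar hwv hb.1).symm

theorem link_copy (H : Spread B p u Z O X S) (hi : i ∈ O) (hk : k ∉ O) (hkZ : k ∈ Z)
    (hkc : k ∈ cols B u) (ht : t i k = k) (hw : w ∈ K B u) (hwp : w p = k) :
    (TG (Sec B u p Z) S (slab p O X h t) (smu p t) k).Reachable (X i) w := by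
  have hik : i ≠ k := fun h' => hk (h' ▸ hi)
  have e1 := H.step (h := h) (t := t) hi hik hkc
  have a1 := H.xcav (h := h) (t := t) hi hik hkc
  obtain ⟨m1, m2, -⟩ := H.out_mem hi hik hkc
  rw [ht] at e1 a1
  refine e1.trans (SimpleGraph.Reachable.trans ?_ (H.copy_linked hk hkZ m1 m2 hw hwp))
  have hnS : out p (con (X i) k) ∉ S := fun h' => hk (m2 ▸ ((H.iff _).1 h').1)
  refine TG.con a1 (Av.of_label ⟨m1, by rw [m2]; exact hkZ⟩ ?_) fun _ h' => (hnS h').elim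
  show slab p O X h t (out p (con (X i) k)) = k
  rw [slab, m2, if_neg hk]

/-- A terminal reaches all vertices of its copy with a colour `k` labelled like the hub. -/
theorem reach_col (H : Spread B p u Z O X S) (hi : i ∈ O) (hw : w ∈ K B u) (hwp : w p = i)
    (hik : i ≠ w c) (ht : t i (w c) = h i) :
    (TG (Sec B u p Z) S (slab p O X h t) (smu p t) (h i)).Reachable (X i) w := by
  by_cases hwX : w = con (X i) (w c)
  · have := H.step (h := h) (t := t) hi hik (val_mem' H.core.2.2 hw)
    rw [ht, ← hwX] at this
    exact this
  · exact H.hub hi hw hwp hwX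

end Spread

theorem joined_good {B : Finset α} {p : α} {u : Perm α} {d : α} {O : Finset α} {X : α → Perm α}
    {S : Finset (Perm α)} (H : Spread B p u {e | e ≠ d} O X S) (hO : O.Nonempty)
    (hb : ∀ i ∈ O, ∀ k ∈ O, i ≠ k → ¬ Bad p X i k) (W : α → Prop) : Joined B u p d W S := by
  classical
  let t : α → α → α := fun i k => if k = d then i else k
  have hdO : d ∉ O := fun h => H.sub d h rfl
  have hS : ∀ s ∈ S, ∃ i ∈ O, s = X i := fun s hs => ⟨s p, ((H.iff s).1 hs).1, ((H.iff s).1 hs).2⟩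
  refine ⟨slab p O X id t, smu p t, fun j hj hjd => ?_⟩
  have htj : ∀ i, t i j = j := fun i => if_neg hjd
  by_cases hjO : j ∈ O
  · constructor
    · have key : ∀ s ∈ S, (TG (Off B u p d) S (slab p O X id t) (smu p t) j).Reachable s (X j) := by
        intro s hs
        obtain ⟨i, hi, rfl⟩ := hS s hs
        by_cases hij : i = j
        · rw [hij]
        · have := H.link hi hjO hij (hb i hi j hjO hij) (h := id) (t := t) (htj i).symm
          rwa [htj i] at this
      exact fun s hs t ht => (key s hs).trans (key t ht).symm
    · intro h hh hhp hhc
      refine ⟨X j, H.xS hjO, Or.inl ?_⟩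
      exact H.reach_col (h := id) (t := t) hjO hh.1 hhp (by rw [hhc]; exact hjd)
        (by rw [hhc]; exact if_pos rfl)
  · constructor
    · intro s hs s' hs'
      obtain ⟨i, hi, rfl⟩ := hS s hs
      obtain ⟨i', hi', rfl⟩ := hS s' hs'
      obtain ⟨m1, m2, -⟩ := H.out_mem hi (k := j) (fun h => hjO (h ▸ hi)) hj
      exact (H.link_copy (h := id) (t := t) hi hjO hjd hj (htj i) m1 m2).trans
        (H.link_copy (h := id) (t := t) hi' hjO hjd hj (htj i') m1 m2).symm
    · intro h hh hhp _
      obtain ⟨i, hi⟩ := hO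
      exact ⟨X i, H.xS hi, Or.inl (H.link_copy (h := id) (t := t) hi hjO hjd hj (htj i) hh.1 hhp)⟩

theorem sign_or (v w : Perm α) : Perm.sign w = Perm.sign v ∨ Perm.sign w = - Perm.sign v := by
  by_cases h : Perm.sign w = Perm.sign v
  · exact Or.inl h
  · exact Or.inr ((sign_ne_iff _ _).1 h)

theorem ne_of_opp {v w : Perm α} (h : Perm.sign w = - Perm.sign v) : w ≠ v := fun h' =>
  (sign_ne_iff _ _).2 h (by rw [h'])

theorem TG.con_to {D : Set (Perm α)} {S : Finset (Perm α)} {ℓ : Perm α → α}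
    {μ : Perm α → Perm α → α} {j k : α} {u v : Perm α} (huv : Godan.con u k = v)
    (hu : Av D S ℓ j u) (hv : Av D S ℓ j v)
    (h : u ∈ S → v ∈ S → μ u v = j ∧ μ v u = j) : (TG D S ℓ μ j).Reachable u v := by
  subst huv
  exact TG.con hu hv fun h1 h2 _ => h h1 h2

theorem joined_bad {B : Finset α} (hB : Core B) (h5 : 5 ≤ B.card) {p : α} (hpB : p ∈ B)
    (hp : Ext p) {u x y : Perm α} {d : α} (hx : x ∈ K B u) (hy : y ∈ K B u) (hxd : x p ≠ d)
    (hyd : y p ≠ d) (hxy : x p ≠ y p) (hd : d ∈ cols B u)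
    (hbad : out p (con x (y p)) = con y (x p)) :
    Joined B u p d (fun j => j = x p) {x, y} := by
  classical
  have hbc := core_erase hB hp
  have hcard : 4 ≤ (B.erase p).card := by rw [Finset.card_erase_of_mem hpB]; omega
  have hxc : x p ∈ cols B u := val_mem' hpB hx
  have hyc : y p ∈ cols B u := val_mem' hpB hy
  set o := x p with ho
  set r := y p with hr
  set z := con x r with hz
  have hsg : Perm.sign y = Perm.sign x := by
    have := congrArg Perm.sign hbad
    rw [sign_con, sign_con, sign_con] at this
    exact this.symm
  have hzs : Perm.sign z = Perm.sign x := sign_con _ _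
  have hzp : z p = o := by rw [hz, con_of_ne _ hp hxy]
  have hzK : z ∈ K B u := con_mem hB hx hyc
  have hzc : z c = r := con_c _ _
  set a' := con y o with ha
  have haK : a' ∈ K B u := con_mem hB hy hxc
  have hap : a' p = r := by rw [ha, con_of_ne _ hp hxy.symm]
  have hac' : a' c = o := con_c _ _
  have has : Perm.sign a' = Perm.sign x := (sign_con _ _).trans hsg
  let ℓ : Perm α → α := fun w =>
    if w p = o then
      if w = bar x ∨ w = bar z then r
      else if w = con x (w c) ∧ w c ≠ d ∧ w c ≠ r then w c else o
    else if w p = r then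
      if w = a' then o
      else if w = con y (w c) ∧ w c ≠ d ∧ w c ≠ o then w c else r
    else w p
  have memS : ∀ w, w ∈ ({x, y} : Finset (Perm α)) ↔ w = x ∨ w = y := fun w => by simp
  have nS : ∀ w, w p ≠ o → w p ≠ r → w ∉ ({x, y} : Finset (Perm α)) := by
    intro w h1 h2 h
    rcases (memS w).1 h with rfl | rfl
    · exact h1 rfl
    · exact h2 rfl
  have nSo : ∀ w, Perm.sign w = - Perm.sign x → w ∉ ({x, y} : Finset (Perm α)) := by
    intro w h1 h
    rcases (memS w).1 h with rfl | rfl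
    · exact ne_of_opp h1 rfl
    · exact ne_of_opp (h1.trans (by rw [hsg])) rfl
  have nSx : ∀ w, w p = o → w ≠ x → w ∉ ({x, y} : Finset (Perm α)) := by
    intro w h1 h2 h
    rcases (memS w).1 h with rfl | rfl
    · exact h2 rfl
    · exact hxy h1.symm
  have hsb : ∀ w : Perm α, Perm.sign w = Perm.sign x → Perm.sign (bar w) = - Perm.sign x :=
    fun w h => by rw [sign_bar, h]
  have nb : ∀ w t : Perm α, Perm.sign w = Perm.sign x → Perm.sign t = Perm.sign x → w ≠ bar t :=
    fun w t h1 h2 h => (sign_ne_iff (bar t) x).2 (hsb t h2) (h ▸ h1)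
  have nc : ∀ (w : Perm α) k, Perm.sign w = - Perm.sign x → w ≠ con x k ∧ w ≠ con y k :=
    fun w k h1 => ⟨Spread.opp_ne h1 k, Spread.opp_ne (by rw [h1, hsg]) k⟩
  have avx : ∀ j, Av (Off B u p d) {x, y} ℓ j x := fun j =>
    Av.of_mem ⟨hx, hxd⟩ ((memS x).2 (Or.inl rfl))
  have avy : ∀ j, Av (Off B u p d) {x, y} ℓ j y := fun j =>
    Av.of_mem ⟨hy, hyd⟩ ((memS y).2 (Or.inr rfl))
  refine ⟨ℓ, fun _ _ => o, fun j hj hjd => ?_⟩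
  set T := TG (Off B u p d) {x, y} ℓ (fun _ _ => o) j with hT
  have pw : T.Reachable x y → ∀ s ∈ ({x, y} : Finset (Perm α)), ∀ t ∈ ({x, y} : Finset (Perm α)),
      T.Reachable s t := by
    intro h s hs t ht
    rcases (memS s).1 hs with rfl | rfl <;> rcases (memS t).1 ht with rfl | rfl
    · exact SimpleGraph.Reachable.refl _
    · exact h
    · exact h.symm
    · exact SimpleGraph.Reachable.refl _
  by_cases hjo : j = o
  · subst hjo
    have lo : ∀ w, w p = o → w ≠ bar x → w ≠ bar z → (w = con x (w c) → w c = d ∨ w c = r) →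
        ℓ w = o := by
      intro w h1 h2 h3 h4
      show (if _ then _ else _) = _
      rw [if_pos h1, if_neg (by tauto), if_neg (by tauto)]
    have lz : ℓ z = o := lo z hzp (nb _ _ hzs rfl) (nb _ _ hzs hzs) fun _ => Or.inr hzc
    have la : ℓ a' = o := by
      show (if _ then _ else _) = _
      rw [if_neg (by rw [hap]; exact hxy.symm), if_pos hap, if_pos rfl]
    have avz : Av (Off B u p d) {x, y} ℓ o z := Av.of_label ⟨hzK, by rw [hzp]; exact hjd⟩ lz
    have ava : Av (Off B u p d) {x, y} ℓ o a' := Av.of_label ⟨haK, by rw [hap]; exact hyd⟩ la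
    have exz : T.Reachable x z := TG.con (avx _) avz fun _ _ _ => ⟨rfl, rfl⟩
    have exy : T.Reachable x y := by
      have e1 : T.Reachable z a' := TG.con_to hbad avz ava fun _ _ => ⟨rfl, rfl⟩
      have e2 : T.Reachable y a' := TG.con (avy _) ava fun _ _ _ => ⟨rfl, rfl⟩
      exact exz.trans (e1.trans e2.symm)
    refine ⟨pw exy, fun h hh hhp hhc => ⟨x, (memS x).2 (Or.inl rfl), ?_⟩⟩
    have hbx : bar x ∈ K B u := bar_mem hB hx
    -- the layer opposite to `x` without two vertices
    have hful : Ful T (Lay (B.erase p) (bar x) \ {bar x, bar z}) := by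
      refine TG.ful fun w hw => ?_
      obtain ⟨⟨hw1, hw2⟩, hw3⟩ := hw
      obtain ⟨hw4, hw5⟩ := mem_erase.1 hw1
      rw [bar_ext _ hp, ← ho] at hw5
      rw [sign_bar] at hw2
      refine ⟨⟨K_trans hbx hw4, by rw [hw5]; exact hjd⟩, nSo _ hw2, lo w hw5 ?_ ?_ ?_⟩
      · exact fun h => hw3 (Or.inl h)
      · exact fun h => hw3 (Or.inr h)
      · exact fun h => ((nc w _ hw2).1 h).elim
    have hub : ∀ w, w ∈ K B u → w p = o → Perm.sign w = - Perm.sign x → w ≠ bar x →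
        w ≠ bar z → w ∈ Lay (B.erase p) (bar x) \ {bar x, bar z} := by
      intro w h1 h2 h3 h4 h5
      refine ⟨⟨mem_erase.2 ⟨K_trans (K_symm hbx) h1, by rw [bar_ext _ hp]; exact h2⟩, by
        rw [sign_bar, h3]⟩, ?_⟩
      rintro (h | h)
      · exact h4 h
      · exact h5 h
    have toHub : ∀ w, w ∈ K B u → w p = o → w ≠ x → w ≠ z → Perm.sign w = Perm.sign x → ℓ w = o →
        T.Reachable w (bar w) ∧ bar w ∈ Lay (B.erase p) (bar x) \ {bar x, bar z} := by
      intro w h1 h2 h3 h4 h5 h6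
      have := hub (bar w) (bar_mem hB h1) (by rw [bar_ext _ hp, h2]) (hsb w h5)
        (fun h => h3 (bar_inj h)) (fun h => h4 (bar_inj h))
      refine ⟨TG.bar (Av.of_label ⟨h1, by rw [h2]; exact hjd⟩ h6) ?_ fun h' => ?_, this⟩
      · refine Av.of_label ⟨bar_mem hB h1, by rw [bar_ext _ hp, h2]; exact hjd⟩ ?_
        refine lo _ (by rw [bar_ext _ hp, h2]) (fun h => h3 (bar_inj h))
          (fun h => h4 (bar_inj h)) ?_
        exact fun h => ((nc _ _ (hsb w h5)).1 h).elim
      · exact (nSx w h2 h3 h').elim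
    have hxHub : ∃ w ∈ Lay (B.erase p) (bar x) \ {bar x, bar z}, T.Reachable x w := by
      by_cases hxc' : x c = d
      · have hrx : r ≠ x c := by rw [hxc']; exact hyd
        obtain ⟨k, hk, hk1, hk2⟩ := exists_second hbc hcard hrx
        rw [← hz] at hk1
        rw [cols_erase, ← ho, cols_eq hx] at hk
        obtain ⟨hko, hkc⟩ := Finset.mem_erase.1 hk
        have m1 : con z k ∈ K B u := con_mem hB hzK hkc
        have m2 : con z k p = o := by rw [con_of_ne _ hp (by rw [hzp]; exact hko.symm), hzp]
        have m3 : con z k ≠ x := fun h => hk1 (by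
          rw [h]; exact (con_eq_self (by rw [← h, con_c])).symm)
        have m4 : con z k ≠ z := fun h => hk2 (by rw [← con_c z k, h, hzc])
        have m5 : Perm.sign (con z k) = Perm.sign x := by rw [sign_con, hzs]
        have m6 : ℓ (con z k) = o := lo _ m2 (nb _ _ m5 rfl) (nb _ _ m5 hzs) (by
          rw [con_c]; exact fun h => (hk1 h).elim)
        obtain ⟨e1, e2⟩ := toHub _ m1 m2 m3 m4 m5 m6
        refine ⟨_, e2, exz.trans (SimpleGraph.Reachable.trans ?_ e1)⟩
        exact TG.con avz (Av.of_label ⟨m1, by rw [m2]; exact hjd⟩ m6) fun _ h' =>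
          (nSx _ m2 m3 h').elim
      · have m1 : con x d ∈ K B u := con_mem hB hx hd
        have m2 : con x d p = o := con_of_ne _ hp hxd
        have m3 : con x d ≠ x := fun h => hxc' (by
          have := con_c x d
          rwa [h] at this)
        have m4 : con x d ≠ z := fun h => hyd (by rw [← hzc, ← h, con_c])
        have m5 : Perm.sign (con x d) = Perm.sign x := sign_con _ _
        have m6 : ℓ (con x d) = o := lo _ m2 (nb _ _ m5 rfl) (nb _ _ m5 hzs) (by
          rw [con_c]; exact fun _ => Or.inl rfl)
        obtain ⟨e1, e2⟩ := toHub _ m1 m2 m3 m4 m5 m6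
        refine ⟨_, e2, SimpleGraph.Reachable.trans ?_ e1⟩
        exact TG.con (avx _) (Av.of_label ⟨m1, by rw [m2]; exact hjd⟩ m6) fun _ h' =>
          (nSx _ m2 m3 h').elim
    obtain ⟨w0, hw0, hxw0⟩ := hxHub
    have hz_d : ∀ w, w c = d → w ≠ bar z := fun w h1 h2 => hyd (by
      rw [← hzc, ← bar_c z, ← h2, h1])
    rcases sign_or x h with hs | hs
    · by_cases hhx : h = con x (h c)
      · left
        rw [hhx, hhc]
        refine TG.con (avx _) ?_ fun _ _ _ => ⟨rfl, rfl⟩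
        rw [hhc] at hhx
        rw [← hhx]
        exact Av.of_label hh (lo h hhp (nb _ _ hs rfl) (nb _ _ hs hzs) fun _ => Or.inl hhc)
      · right
        refine ⟨rfl, hxw0.trans (lay_minus_two hbc hcard hful hw0 ?_)⟩
        refine hub _ (bar_mem hB hh.1) (by rw [bar_ext _ hp, hhp]) (hsb h hs) ?_ ?_
        · exact fun h' => hhx (by rw [bar_inj h', con_self])
        · exact hz_d _ (by rw [bar_c, hhc])
    · by_cases hhx : h = bar x
      · right
        refine ⟨rfl, ?_⟩
        rw [hhx, bar_bar]
      · left
        exact hxw0.trans (lay_minus_two hbc hcard hful hw0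
          (hub h hh.1 hhp hs hhx (hz_d h hhc)))
  by_cases hjr : j = r
  · subst hjr
    have hby : bar y ∈ K B u := bar_mem hB hy
    have lr : ∀ w, w p = r → w ≠ a' → (w = con y (w c) → w c = d ∨ w c = o) → ℓ w = r := by
      intro w h1 h2 h3
      show (if _ then _ else _) = _
      rw [if_neg (by rw [h1]; exact hxy.symm), if_pos h1, if_neg h2, if_neg (by tauto)]
    have hopp : ∀ w ∈ K B u, w p = r → Perm.sign w = - Perm.sign x →
        w ∈ Off B u p d ∧ w ∉ ({x, y} : Finset (Perm α)) ∧ ℓ w = r := by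
      intro w h1 h2 h3
      refine ⟨⟨h1, by rw [h2]; exact hyd⟩, nSo _ h3, lr w h2 (nc w _ h3).2 ?_⟩
      exact fun h => ((nc w _ h3).2 h).elim
    have hful : Ful T (Lay (B.erase p) (bar y)) := by
      refine TG.ful fun w hw => ?_
      obtain ⟨hw1, hw2⟩ := hw
      obtain ⟨hw4, hw5⟩ := mem_erase.1 hw1
      rw [bar_ext _ hp, ← hr] at hw5
      rw [sign_bar, hsg] at hw2
      exact hopp w (K_trans hby hw4) hw5 hw2
    have eyb : T.Reachable y (bar y) := by
      obtain ⟨h1, h2, h3⟩ := hopp (bar y) hby (by rw [bar_ext _ hp]) (hsb y hsg)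
      exact TG.bar (avy _) (Av.of_label h1 h3) fun _ h => (h2 h).elim
    have hub : ∀ w ∈ K B u, w p = r → Perm.sign w = - Perm.sign x → T.Reachable y w := by
      intro w h1 h2 h3
      refine eyb.trans (lay_linked hbc hful ⟨K_refl _ _, rfl⟩ ⟨mem_erase.2 ⟨K_trans (K_symm hby) h1,
        by rw [bar_ext _ hp, h2]⟩, by rw [sign_bar, hsg, h3]⟩)
    have lb : ∀ w, w p = o → (w = bar x ∨ w = bar z) → ℓ w = r := by
      intro w h1 h2
      show (if _ then _ else _) = _
      rw [if_pos h1, if_pos h2]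
    have avbx : Av (Off B u p d) {x, y} ℓ r (bar x) := Av.of_label
      ⟨bar_mem hB hx, by rw [bar_ext _ hp]; exact hxd⟩ (lb _ (bar_ext _ hp) (Or.inl rfl))
    have avbz : Av (Off B u p d) {x, y} ℓ r (bar z) := Av.of_label
      ⟨bar_mem hB hzK, by rw [bar_ext _ hp, hzp]; exact hxd⟩
      (lb _ (by rw [bar_ext _ hp, hzp]) (Or.inr rfl))
    have e1 : T.Reachable x (bar x) := TG.bar (avx _) avbx fun _ h => (nSo _ (hsb x rfl) h).elim
    have e2 : T.Reachable (bar x) (bar z) := by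
      exact TG.con_to (con_bar x r) avbx avbz fun h => (nSo _ (hsb x rfl) h).elim
    have e3 : T.Reachable (bar z) (bar a') := by
      have hob : out p (bar z) = bar a' := by rw [out_bar hp, hbad]
      obtain ⟨h1, h2, h3⟩ := hopp (bar a') (bar_mem hB haK) (by rw [bar_ext _ hp, hap]) (hsb a' has)
      exact TG.con_to hob avbz (Av.of_label h1 h3) fun h => (nSo _ (hsb z hzs) h).elim
    refine ⟨pw (e1.trans (e2.trans (e3.trans
      (hub _ (bar_mem hB haK) (by rw [bar_ext _ hp, hap]) (hsb a' has)).symm))),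
      fun h hh hhp hhc => ⟨y, (memS y).2 (Or.inr rfl), Or.inl ?_⟩⟩
    rcases sign_or x h with hs | hs
    · have e4 := hub (bar h) (bar_mem hB hh.1) (by rw [bar_ext _ hp, hhp]) (hsb h hs)
      obtain ⟨h1, h2, h3⟩ := hopp (bar h) (bar_mem hB hh.1) (by rw [bar_ext _ hp, hhp]) (hsb h hs)
      refine e4.trans (SimpleGraph.Reachable.symm ?_)
      refine TG.bar (Av.of_label hh (lr h hhp (fun h' => ?_) fun _ => Or.inl hhc))
        (Av.of_label h1 h3) fun _ h => (h2 h).elim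
      exact hxd (by rw [← hac', ← h', hhc])
    · exact hub h hh.1 hhp hs
  · have lj : ∀ w, w p = j → ℓ w = j := by
      intro w h1
      show (if _ then _ else _) = _
      rw [if_neg (by rw [h1]; exact hjo), if_neg (by rw [h1]; exact hjr), h1]
    have copy : ∀ v ∈ K B u, v p = j → ∀ w ∈ K B u, w p = j → T.Reachable v w := by
      intro v hv hvp w hw hwp
      have hful : Ful T (K (B.erase p) v) := by
        refine TG.ful fun w hw => ?_
        obtain ⟨h1, h2⟩ := mem_erase.1 hw
        rw [hvp] at h2
        exact ⟨⟨K_trans hv h1, by rw [h2]; exact hjd⟩,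
          nS w (by rw [h2]; exact hjo) (by rw [h2]; exact hjr), lj w h2⟩
      have hwv : w ∈ K (B.erase p) v := mem_erase.2 ⟨K_trans (K_symm hv) hw, hwp.trans hvp.symm⟩
      by_cases hs : Perm.sign w = Perm.sign v
      · exact lay_linked hbc (u := v) (hful.mono fun _ h => h.1) ⟨K_refl _ _, rfl⟩ ⟨hwv, hs⟩
      · have hb := bar_lay hbc hwv hs
        exact (lay_linked hbc (u := v) (hful.mono fun _ h => h.1) ⟨K_refl _ _, rfl⟩ hb).trans
          (hful.bar hwv hb.1).symm
    have start : ∀ s, s ∈ K B u → Av (Off B u p d) {x, y} ℓ j s → s p ≠ j → s p ≠ d →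
        (Av (Off B u p d) {x, y} ℓ j (con s j)) → (con s j ∈ ({x, y} : Finset (Perm α)) →
        con s j = s) →
        ∃ v ∈ K B u, v p = j ∧ T.Reachable s v := by
      intro s hs hav hsj hsd hav2 hself
      have e1 : T.Reachable s (con s j) := TG.con hav hav2 fun _ h hne => (hne (by
        rw [← hself h, con_c])).elim
      have hop : out p (con s j) p = j := by rw [out_p hp, con_c]
      have hoK : out p (con s j) ∈ K B u :=
        con_mem hB (con_mem hB hs hj) (val_mem' hpB (con_mem hB hs hj))
      refine ⟨_, hoK, hop, e1.trans (TG.con hav2 (Av.of_label ⟨hoK, ?_⟩ (lj _ hop))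
        fun _ h => (nS _ ?_ ?_ h).elim)⟩
      · rw [hop]; exact hjd
      · show out p (con s j) p ≠ o
        rw [hop]; exact hjo
      · show out p (con s j) p ≠ r
        rw [hop]; exact hjr
    have hxj : con x j p = o := con_of_ne _ hp (fun h => hjo (h.symm.trans ho.symm))
    have hyj : con y j p = r := con_of_ne _ hp (fun h => hjr (h.symm.trans hr.symm))
    have lxj : ℓ (con x j) = j := by
      show (if _ then _ else _) = _
      rw [if_pos hxj, if_neg, if_pos, con_c]
      · rw [con_c]; exact ⟨rfl, hjd, hjr⟩
      · rintro (h | h)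
        · exact nb _ _ (sign_con _ _) rfl h
        · exact nb _ _ (sign_con _ _) hzs h
    have lyj : ℓ (con y j) = j := by
      show (if _ then _ else _) = _
      rw [if_neg (by rw [hyj]; exact hxy.symm), if_pos hyj, if_neg, if_pos, con_c]
      · rw [con_c]; exact ⟨rfl, hjd, hjo⟩
      · intro h
        exact hjo (by rw [← hac', ← h, con_c])
    obtain ⟨v, hv, hvj, exv⟩ := start x hx (avx _) (fun h => hjo (h.symm.trans ho.symm)) hxd
      (Av.of_label ⟨con_mem hB hx hj, by rw [hxj]; exact hxd⟩ lxj) (by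
        intro h
        rcases (memS _).1 h with h | h
        · exact h
        · exact (hxy (by rw [← hxj, h])).elim)
    obtain ⟨w, hw, hwj, eyw⟩ := start y hy (avy _) (fun h => hjr (h.symm.trans hr.symm)) hyd
      (Av.of_label ⟨con_mem hB hy hj, by rw [hyj]; exact hyd⟩ lyj) (by
        intro h
        rcases (memS _).1 h with h | h
        · exact (hxy.symm (by rw [← hyj, h])).elim
        · exact h)
    exact ⟨pw (exv.trans ((copy v hv hvj w hw hwj).trans eyw.symm)), fun h hh hhp _ =>
      ⟨x, (memS x).2 (Or.inl rfl), Or.inl (exv.trans (copy v hv hvj h hh.1 hhp))⟩⟩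

theorem TG.copy {D : Set (Perm α)} {S : Finset (Perm α)} {ℓ : Perm α → α}
    {μ : Perm α → Perm α → α} {B : Finset α} (hB : Core B) {p : α} (hp : Ext p) {u : Perm α}
    {j e : α} (hD : ∀ w ∈ K B u, w p = e → w ∈ D ∧ w ∉ S ∧ ℓ w = j) {v w : Perm α}
    (hv : v ∈ K B u) (hvp : v p = e) (hw : w ∈ K B u) (hwp : w p = e) :
    (TG D S ℓ μ j).Reachable v w := by
  have hbc := core_erase hB hp
  have hful : Ful (TG D S ℓ μ j) (K (B.erase p) v) := by
    refine TG.ful fun w hw => ?_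
    obtain ⟨h1, h2⟩ := mem_erase.1 hw
    exact hD w (K_trans hv h1) (h2.trans hvp)
  have hwv : w ∈ K (B.erase p) v := mem_erase.2 ⟨K_trans (K_symm hv) hw, hwp.trans hvp.symm⟩
  by_cases hs : Perm.sign w = Perm.sign v
  · exact lay_linked hbc (u := v) (hful.mono fun _ h => h.1) ⟨K_refl _ _, rfl⟩ ⟨hwv, hs⟩
  · have hb := bar_lay hbc hwv hs
    exact (lay_linked hbc (u := v) (hful.mono fun _ h => h.1) ⟨K_refl _ _, rfl⟩ hb).trans
      (hful.bar hwv hb.1).symm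

theorem sign_eq_of_con {v w : Perm α} {k : α} (h : w = con v k) : Perm.sign w = Perm.sign v := by
  rw [h, sign_con]

theorem joined_same {B : Finset α} (hB : Core B) (h5 : 5 ≤ B.card) {p : α} (hpB : p ∈ B)
    (hp : Ext p) {u x y : Perm α} {o d : α} (hx : x ∈ K B u) (hy : y ∈ K B u) (hxo : x p = o)
    (hyo : y p = o) (hod : o ≠ d) (hd : d ∈ cols B u) (hxy : x ≠ y)
    (hsg : Perm.sign y = Perm.sign x) :
    Joined B u p d (fun _ => False) {x, y} := by
  classical
  have hbc := core_erase hB hp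
  have hcard : 4 ≤ (B.erase p).card := by rw [Finset.card_erase_of_mem hpB]; omega
  let C : Prop := y = con x (y c) ∧ x c ≠ d ∧ y c ≠ d
  let ℓ : Perm α → α := fun w =>
    if w p = o then
      if Perm.sign w = Perm.sign x then (if w c = d then o else w c)
      else if C ∧ (w = bar x ∨ w = bar y) then x c else o
    else w p
  let m : α := if y c = d then x c else y c
  have memS : ∀ w, w ∈ ({x, y} : Finset (Perm α)) ↔ w = x ∨ w = y := fun w => by simp
  have nS : ∀ w, w p ≠ o → w ∉ ({x, y} : Finset (Perm α)) := by
    intro w h1 h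
    rcases (memS w).1 h with rfl | rfl
    · exact h1 hxo
    · exact h1 hyo
  have nSo : ∀ w, Perm.sign w ≠ Perm.sign x → w ∉ ({x, y} : Finset (Perm α)) := by
    intro w h1 h
    rcases (memS w).1 h with rfl | rfl
    · exact h1 rfl
    · exact h1 hsg
  have hmem : ∀ s ∈ ({x, y} : Finset (Perm α)),
      s ∈ K B u ∧ s p = o ∧ Perm.sign s = Perm.sign x := by
    intro s hs
    rcases (memS s).1 hs with rfl | rfl
    · exact ⟨hx, hxo, rfl⟩
    · exact ⟨hy, hyo, hsg⟩
  have hav : ∀ j, ∀ s ∈ ({x, y} : Finset (Perm α)), Av (Off B u p d) {x, y} ℓ j s :=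
    fun j s hs => Av.of_mem ⟨(hmem s hs).1, by rw [(hmem s hs).2.1]; exact hod⟩ hs
  have hsb : ∀ w : Perm α, Perm.sign w = Perm.sign x → Perm.sign (bar w) ≠ Perm.sign x :=
    fun w h => by rw [sign_ne_iff, sign_bar, h]
  have hbs : ∀ w : Perm α, Perm.sign w ≠ Perm.sign x → Perm.sign (bar w) = Perm.sign x :=
    fun w h => by rw [sign_bar, (sign_ne_iff _ _).1 h, neg_neg]
  have ls : ∀ w, w p = o → Perm.sign w = Perm.sign x → w c ≠ d → ℓ w = w c := by
    intro w h1 h2 h3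
    show (if _ then _ else _) = _
    rw [if_pos h1, if_pos h2, if_neg h3]
  have lsd : ∀ w, w p = o → Perm.sign w = Perm.sign x → w c = d → ℓ w = o := by
    intro w h1 h2 h3
    show (if _ then _ else _) = _
    rw [if_pos h1, if_pos h2, if_pos h3]
  have lo : ∀ w, w p = o → Perm.sign w ≠ Perm.sign x → ¬ (C ∧ (w = bar x ∨ w = bar y)) →
      ℓ w = o := by
    intro w h1 h2 h3
    show (if _ then _ else _) = _
    rw [if_pos h1, if_neg h2, if_neg h3]
  have lC : C → ∀ w, w p = o → Perm.sign w ≠ Perm.sign x → (w = bar x ∨ w = bar y) →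
      ℓ w = x c := by
    intro h0 w h1 h2 h3
    show (if _ then _ else _) = _
    rw [if_pos h1, if_neg h2, if_pos ⟨h0, h3⟩]
  refine ⟨ℓ, fun _ _ => m, fun j hj hjd => ?_⟩
  set T := TG (Off B u p d) {x, y} ℓ (fun _ _ => m) j with hT
  by_cases hjo : j = o
  · subst hjo
    set X : Set (Perm α) := {w | w ∈ K B u ∧ w p = j ∧ Perm.sign w ≠ Perm.sign x ∧
      ¬ (C ∧ (w = bar x ∨ w = bar y))} with hX
    have hful : Ful T X := TG.ful fun w hw =>
      ⟨⟨hw.1, by rw [hw.2.1]; exact hjd⟩, nSo w hw.2.2.1, lo w hw.2.1 hw.2.2.1 hw.2.2.2⟩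
    have hlink : ∀ v ∈ X, ∀ w ∈ X, T.Reachable v w := by
      have hKx : ∀ w, w ∈ Lay (B.erase p) (bar x) ↔
          w ∈ K B u ∧ w p = j ∧ Perm.sign w ≠ Perm.sign x := by
        intro w
        have : w ∈ Lay (B.erase p) (bar x) ↔
          w ∈ K (B.erase p) (bar x) ∧ Perm.sign w = Perm.sign (bar x) := Iff.rfl
        rw [this, mem_erase, K_eq (bar_mem hB hx), bar_ext _ hp, hxo, sign_bar, sign_ne_iff,
          and_assoc]
      have hX' : Lay (B.erase p) (bar x) \ {bar x, bar y} ⊆ X := by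
        rintro w ⟨h1, h2⟩
        obtain ⟨h3, h4, h5⟩ := (hKx w).1 h1
        exact ⟨h3, h4, h5, fun h => h2 h.2⟩
      intro v hv w hw
      by_cases hC : C
      · refine lay_minus_two hbc hcard (hful.mono hX') ⟨(hKx v).2 ⟨hv.1, hv.2.1, hv.2.2.1⟩, ?_⟩
          ⟨(hKx w).2 ⟨hw.1, hw.2.1, hw.2.2.1⟩, ?_⟩
        · exact fun h => hv.2.2.2 ⟨hC, h⟩
        · exact fun h => hw.2.2.2 ⟨hC, h⟩
      · refine lay_linked hbc (u := bar x) (hful.mono ?_) ((hKx v).2 ⟨hv.1, hv.2.1, hv.2.2.1⟩)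
          ((hKx w).2 ⟨hw.1, hw.2.1, hw.2.2.1⟩)
        intro t ht
        obtain ⟨h3, h4, h5⟩ := (hKx t).1 ht
        exact ⟨h3, h4, h5, fun h => hC h.1⟩
    have toHub : ∀ w ∈ K B u, w p = j → Perm.sign w = Perm.sign x → Av (Off B u p d) {x, y} ℓ j w →
        (w = x ∨ w = y → ¬ C) → ∃ v ∈ X, T.Reachable w v := by
      intro w h1 h2 h3 h4 h5
      have hb : bar w ∈ X := ⟨bar_mem hB h1, by rw [bar_ext _ hp, h2], hsb w h3, fun h =>
        h5 (h.2.imp bar_inj bar_inj) h.1⟩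
      refine ⟨_, hb, TG.bar h4 (Av.of_label ⟨hb.1, by rw [hb.2.1]; exact hjd⟩
        (lo _ hb.2.1 hb.2.2.1 hb.2.2.2)) fun _ h => (nSo _ hb.2.2.1 h).elim⟩
    have start : ∀ s ∈ ({x, y} : Finset (Perm α)), ∃ v ∈ X, T.Reachable s v := by
      intro s hs
      obtain ⟨s1, s2, s3⟩ := hmem s hs
      by_cases hC : C
      · have m1 : con s d ∈ K B u := con_mem hB s1 hd
        have m2 : con s d p = j := by rw [con_of_ne _ hp (by rw [s2]; exact hjd), s2]
        have m3 : Perm.sign (con s d) = Perm.sign x := by rw [sign_con, s3]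
        have m4 : con s d ∉ ({x, y} : Finset (Perm α)) := by
          intro h
          rcases (memS _).1 h with h | h
          · exact hC.2.1 (by rw [← h, con_c])
          · exact hC.2.2 (by rw [← h, con_c])
        have m5 := Av.of_label (D := Off B u p d) (S := {x, y}) (ℓ := ℓ) ⟨m1, by rw [m2]; exact hjd⟩
          (lsd _ m2 m3 (con_c _ _))
        obtain ⟨v, hv, h⟩ := toHub _ m1 m2 m3 m5 fun h => (m4 ((memS _).2 h)).elim
        exact ⟨v, hv, (TG.con (hav _ s hs) m5 fun _ h => (m4 h).elim).trans h⟩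
      · exact toHub s s1 s2 s3 (hav _ s hs) fun _ => hC
    constructor
    · intro s hs t ht
      obtain ⟨v, hv, h1⟩ := start s hs
      obtain ⟨w, hw, h2⟩ := start t ht
      exact h1.trans ((hlink v hv w hw).trans h2.symm)
    · intro h hh hhp hhc
      by_cases hhS : h ∈ ({x, y} : Finset (Perm α))
      · exact ⟨h, hhS, Or.inl (SimpleGraph.Reachable.refl _)⟩
      obtain ⟨v, hv, h1⟩ := start x ((memS x).2 (Or.inl rfl))
      refine ⟨x, (memS x).2 (Or.inl rfl), Or.inl (h1.trans ?_)⟩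
      by_cases hs : Perm.sign h = Perm.sign x
      · obtain ⟨w, hw, h2⟩ := toHub h hh.1 hhp hs (Av.of_label hh (lsd h hhp hs hhc))
          fun h' => (hhS ((memS h).2 h')).elim
        exact (hlink v hv w hw).trans h2.symm
      · refine hlink v hv h ⟨hh.1, hhp, hs, ?_⟩
        rintro ⟨hC, rfl | rfl⟩
        · exact hC.2.1 (by rw [← bar_c, hhc])
        · exact hC.2.2 (by rw [← bar_c, hhc])
  · have lj : ∀ w, w p = j → ℓ w = j := by
      intro w h1
      show (if _ then _ else _) = _
      rw [if_neg (by rw [h1]; exact hjo), h1]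
    have hcopy : ∀ w ∈ K B u, w p = j →
        w ∈ Off B u p d ∧ w ∉ ({x, y} : Finset (Perm α)) ∧ ℓ w = j := fun w h1 h2 =>
      ⟨⟨h1, by rw [h2]; exact hjd⟩, nS w (by rw [h2]; exact hjo), lj w h2⟩
    have leave : ∀ w ∈ K B u, w c = j → Av (Off B u p d) {x, y} ℓ j w →
        ∃ v ∈ K B u, v p = j ∧ T.Reachable w v := by
      intro w hw hwc h
      have h1 : out p w ∈ K B u := con_mem hB hw (val_mem' hpB hw)
      have h2 : out p w p = j := by rw [out_p hp, hwc]
      obtain ⟨h3, h4, h5⟩ := hcopy _ h1 h2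
      exact ⟨_, h1, h2, TG.con h (Av.of_label h3 h5) fun _ h' => (h4 h').elim⟩
    have start : ∀ s ∈ ({x, y} : Finset (Perm α)), ∃ v ∈ K B u, v p = j ∧ T.Reachable s v := by
      intro s hs
      obtain ⟨s1, s2, s3⟩ := hmem s hs
      by_cases hsc : s c = j
      · exact leave s s1 hsc (hav _ s hs)
      have m1 : con s j ∈ K B u := con_mem hB s1 hj
      have m2 : con s j p = o := by rw [con_of_ne _ hp (by rw [s2]; exact fun h => hjo h.symm), s2]
      have m3 : Perm.sign (con s j) = Perm.sign x := by rw [sign_con, s3]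
      have m4 : Av (Off B u p d) {x, y} ℓ j (con s j) := Av.of_label
        ⟨m1, by rw [m2]; exact hod⟩ (by rw [ls _ m2 m3 (by rw [con_c]; exact hjd), con_c])
      by_cases hm : con s j ∈ ({x, y} : Finset (Perm α)) ∧ m ≠ j
      · obtain ⟨hm, hmj⟩ := hm
        have hxs : con s j = x ∧ s = y := by
          rcases (memS _).1 hs with rfl | rfl <;> rcases (memS _).1 hm with h | h
          · exact (hsc (by rw [← h, con_c])).elim
          · exfalso
            have hyj : y c = j := by rw [← h, con_c]
            exact hmj ((if_neg (by rw [hyj]; exact hjd)).trans hyj)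
          · exact ⟨h, rfl⟩
          · exact (hsc (by rw [← h, con_c])).elim
        obtain ⟨h1, rfl⟩ := hxs
        have hxj : x c = j := by rw [← h1, con_c]
        have hC : C := by
          refine ⟨by rw [← h1, con_con_self], by rw [hxj]; exact hjd, fun h => ?_⟩
          exact hmj ((if_pos h).trans hxj)
        have b1 : ∀ w, (w = bar x ∨ w = bar s) → Av (Off B u p d) {x, s} ℓ j w ∧
            w ∉ ({x, s} : Finset (Perm α)) ∧ w ∈ K B u := by
          intro w hw
          have hw1 : w ∈ K B u ∧ w p = o ∧ Perm.sign w ≠ Perm.sign x := by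
            rcases hw with rfl | rfl
            · exact ⟨bar_mem hB hx, by rw [bar_ext _ hp, hxo], hsb _ rfl⟩
            · exact ⟨bar_mem hB hy, by rw [bar_ext _ hp, hyo], hsb _ hsg⟩
          exact ⟨Av.of_label ⟨hw1.1, by rw [hw1.2.1]; exact hod⟩
            ((lC hC w hw1.2.1 hw1.2.2 hw).trans hxj), nSo _ hw1.2.2, hw1.1⟩
        obtain ⟨x1, x2, x3⟩ := b1 _ (Or.inl rfl)
        obtain ⟨y1, y2, y3⟩ := b1 _ (Or.inr rfl)
        obtain ⟨v, hv, hvj, h⟩ := leave (bar x) x3 (by rw [bar_c, hxj]) x1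
        refine ⟨v, hv, hvj, ((TG.bar (hav _ s hs) y1 fun _ h => (y2 h).elim).trans ?_).trans h⟩
        exact TG.con_to (by rw [con_bar, h1]) y1 x1 fun h => (y2 h).elim
      · obtain ⟨v, hv, hvj, h⟩ := leave _ m1 (con_c _ _) m4
        refine ⟨v, hv, hvj, (TG.con (hav _ s hs) m4 fun _ h _ => ?_).trans h⟩
        have : m = j := by
          by_contra h'
          exact hm ⟨h, h'⟩
        exact ⟨this, this⟩
    constructor
    · intro s hs t ht
      obtain ⟨v, hv, hvj, h1⟩ := start s hs
      obtain ⟨w, hw, hwj, h2⟩ := start t ht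
      exact h1.trans ((TG.copy hB hp hcopy hv hvj hw hwj).trans h2.symm)
    · intro h hh hhp _
      obtain ⟨v, hv, hvj, h1⟩ := start x ((memS x).2 (Or.inl rfl))
      exact ⟨x, (memS x).2 (Or.inl rfl), Or.inl (h1.trans (TG.copy hB hp hcopy hv hvj hh.1 hhp))⟩

theorem square_linked {β : Type*} {x y v u r : β} (h1 : x = r ∨ x = y ∧ x = v)
    (h2 : y = r ∨ y = x ∧ y = u) (h3 : v = r ∨ v = u ∧ v = x) (h4 : u = r ∨ u = v ∧ u = y) :
    y = x ∧ v = x ∧ u = x := by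
  grind

theorem packed_mixed {B : Finset α} (hB : Core B) (h5 : 5 ≤ B.card) {p : α} (hpB : p ∈ B)
    (hp : Ext p) {u₀ x y v u : Perm α} {S : Finset (Perm α)} {d o : α}
    (hS : ∀ s, s ∈ S ↔ s = x ∨ s = y ∨ s = v ∨ s = u) (hK : ∀ s ∈ S, s ∈ K B u₀)
    (hxp : x p = d) (hyp : y p = d) (hvp : v p = o) (hup : u p = o) (hod : o ≠ d)
    (hys : Perm.sign y = - Perm.sign x) (hvs : Perm.sign v = Perm.sign x)
    (hus : Perm.sign u = - Perm.sign x) : Packed B u₀ S := by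
  classical
  have hbc := core_erase hB hp
  have hcard : 4 ≤ (B.erase p).card := by rw [Finset.card_erase_of_mem hpB]; omega
  have hxS : x ∈ S := (hS x).2 (Or.inl rfl)
  have hyS : y ∈ S := (hS y).2 (Or.inr (Or.inl rfl))
  have hvS : v ∈ S := (hS v).2 (Or.inr (Or.inr (Or.inl rfl)))
  have huS : u ∈ S := (hS u).2 (Or.inr (Or.inr (Or.inr rfl)))
  have hdc : d ∈ cols B u₀ := hxp ▸ val_mem' hpB (hK x hxS)
  have hoc : o ∈ cols B u₀ := hvp ▸ val_mem' hpB (hK v hvS)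
  have hx1 : Perm.sign x ≠ - Perm.sign x := fun h => ne_of_opp (v := x) (w := x) h rfl
  have hSp : ∀ s ∈ S, s p = d ∨ s p = o := by
    intro s hs
    rcases (hS s).1 hs with rfl | rfl | rfl | rfl
    · exact Or.inl hxp
    · exact Or.inl hyp
    · exact Or.inr hvp
    · exact Or.inr hup
  have huniq : ∀ s ∈ S, ∀ t ∈ S, s p = t p → Perm.sign s = Perm.sign t → s = t := by
    intro s hs t ht h1 h2
    rcases (hS s).1 hs with h | h | h | h <;> rcases (hS t).1 ht with h' | h' | h' | h' <;>
      rw [h, h'] at h1 h2 ⊢ <;> simp only [hxp, hyp, hvp, hup, hys, hvs, hus] at h1 h2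
    all_goals first
      | exact absurd h1 hod
      | exact absurd h1.symm hod
      | exact absurd h2 hx1
      | exact absurd h2.symm hx1
  let N : Perm α → Prop := fun w => w c ≠ d ∧ w c ≠ o ∧ ∃ s ∈ S, s p = w p ∧ w = con s (w c)
  let ℓ : Perm α → α := fun w =>
    if w p = d ∨ w p = o then (if N w then w c else o) else w p
  have lo : ∀ w, (w p = d ∨ w p = o) → ¬ N w → ℓ w = o := by
    intro w h1 h2
    show (if _ then _ else _) = _
    rw [if_pos h1, if_neg h2]
  refine ⟨d, hdc, ℓ, fun _ _ => o, fun j hj hjd => ?_⟩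
  have hav : ∀ s ∈ S, Av (K B u₀) S ℓ j s := fun s hs => Av.of_mem (hK s hs) hs
  set T := TG (K B u₀) S ℓ (fun _ _ => o) j with hT
  by_cases hjo : j = o
  · subst hjo
    let Y : Perm α → Set (Perm α) := fun s => {w | w ∈ Lay (B.erase p) s ∧ w ≠ con s (w c)}
    have hlay : ∀ s ∈ S, ∀ w, w ∈ Lay (B.erase p) s ↔
        w ∈ K B u₀ ∧ w p = s p ∧ Perm.sign w = Perm.sign s := by
      intro s hs w
      have : w ∈ Lay (B.erase p) s ↔ w ∈ K (B.erase p) s ∧ Perm.sign w = Perm.sign s := Iff.rfl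
      rw [this, mem_erase, K_eq (hK s hs), and_assoc]
    have hY : ∀ s ∈ S, ∀ w ∈ Y s, w ∈ K B u₀ ∧ w ∉ S ∧ ℓ w = j := by
      intro s hs w hw
      obtain ⟨h1, h2, h3⟩ := (hlay s hs w).1 hw.1
      refine ⟨h1, fun h => hw.2 ?_, lo w (h2 ▸ hSp s hs) ?_⟩
      · rw [huniq w h s hs h2 h3, con_self]
      · rintro ⟨-, -, t, ht, h4, h5⟩
        have : t = s := huniq t ht s hs (h4.trans h2) ((sign_eq_of_con h5).symm.trans h3)
        rw [this] at h5
        exact hw.2 h5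
    have hYl : ∀ s ∈ S, ∀ w ∈ Y s, ∀ w' ∈ Y s, T.Reachable w w' := by
      intro s hs w hw w' hw'
      exact lay_minus_nbhd hbc hcard (X := Y s) (TG.ful (hY s hs)) (fun _ h1 h2 => ⟨h1, h2⟩)
        hw.1 hw.2 hw'.1 hw'.2
    have hmate : ∀ s ∈ S, ∀ m ∈ S, m p = s p → Perm.sign m = - Perm.sign s →
        ∃ w ∈ Y s, ∃ w' ∈ Y m, T.Reachable w w' := by
      intro s hs m hm h1 h2
      obtain ⟨w, hw, h3, h4⟩ := exists_avoid_two hbc hcard s (bar m)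
      obtain ⟨k1, k2, k3⟩ := (hlay s hs w).1 hw
      have hb : bar w ∈ Y m := by
        refine ⟨(hlay m hm _).2 ⟨bar_mem hB k1, by rw [bar_ext _ hp, k2, h1], by
          rw [sign_bar, k3, h2]⟩, fun h => h4 ?_⟩
        rw [con_bar, ← bar_c w, ← h, bar_bar]
      obtain ⟨l1, l2, l3⟩ := hY s hs w ⟨hw, h3⟩
      obtain ⟨m1, m2, m3⟩ := hY m hm _ hb
      exact ⟨w, ⟨hw, h3⟩, _, hb, TG.bar (Av.of_label l1 l3) (Av.of_label m1 m3)
        fun h => (l2 h).elim⟩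
    have hcross : ∀ s ∈ S, ∀ k ∈ S, k p ≠ s p → Perm.sign k = Perm.sign s →
        ∃ w ∈ Y s, ∃ w' ∈ Y k, T.Reachable w w' := by
      intro s hs k hk h1 h2
      obtain ⟨q, hqB, hq⟩ := exists_ext hbc hcard
      have hqp : q ≠ p := (Finset.mem_erase.1 hqB).1
      have hkc : k p ∈ cols (B.erase p) s := by
        rw [cols_erase, cols_eq (hK s hs)]
        exact Finset.mem_erase.2 ⟨h1, val_mem' hpB (hK k hk)⟩
      obtain ⟨e, he, heF⟩ := exists_col (B := B.erase p) (u := s)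
        {k p, con s (k p) q, out p (con k (s p)) q} (by
          have := Finset.card_le_three (a := k p) (b := con s (k p) q) (c := out p (con k (s p)) q)
          omega)
      simp only [Finset.mem_insert, Finset.mem_singleton, not_or] at heF
      obtain ⟨w, hw, hwq, hwc⟩ := exists_val_col hbc hqB hq he hkc heF.1
      obtain ⟨k1, k2, k3⟩ := (hlay s hs w).1 hw
      have hwY : w ∈ Y s := ⟨hw, fun h => heF.2.1 (by rw [← hwq, ← hwc, ← h])⟩
      have hoK : out p w ∈ K B u₀ := con_mem hB k1 (val_mem' hpB k1)
      have hoY : out p w ∈ Y k := by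
        refine ⟨(hlay k hk _).2 ⟨hoK, by rw [out_p hp, hwc], by rw [sign_con, k3, h2]⟩, fun h => ?_⟩
        rw [con_c, k2] at h
        exact heF.2.2 (by
          rw [← h]
          exact ((congrArg (fun z => z q) (out_out hp w)).trans hwq).symm)
      obtain ⟨l1, l2, l3⟩ := hY s hs w hwY
      obtain ⟨m1, m2, m3⟩ := hY k hk _ hoY
      exact ⟨w, hwY, _, hoY, TG.con (Av.of_label l1 l3) (Av.of_label m1 m3)
        fun h => (l2 h).elim⟩
    have toY : ∀ t ∈ S, ∀ w ∈ Lay (B.erase p) t, w ≠ t → w c = d ∨ w c = j →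
        ∃ w' ∈ Y t, T.Reachable w w' := by
      intro t ht w hw hwt hwc
      by_cases hwY : w = con t (w c)
      · obtain ⟨l1, l2, l3⟩ := (hlay t ht w).1 hw
        have hne : w c ≠ t c := fun h => hwt (by rw [hwY, h, con_self])
        have hwS : w ∉ S := fun h => hwt (huniq w h t ht l2 l3)
        obtain ⟨k, hk, h1, h2⟩ := exists_second hbc hcard hne
        rw [← hwY] at h1
        have hkc : k ∈ cols B u₀ := by
          rw [cols_erase, cols_eq (hK t ht)] at hk
          exact (Finset.mem_erase.1 hk).2
        have hY' : con w k ∈ Y t := ⟨con_lay hbc hw hk, by rw [con_c]; exact h1⟩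
        obtain ⟨m1, m2, m3⟩ := hY t ht _ hY'
        refine ⟨_, hY', TG.con (Av.of_label l1 (lo w (l2 ▸ hSp t ht) ?_)) (Av.of_label m1 m3)
          fun h => (hwS h).elim⟩
        rintro ⟨h3, h4, -⟩
        exact hwc.elim h3 h4
      · exact ⟨w, ⟨hw, hwY⟩, SimpleGraph.Reachable.refl _⟩
    have hlabel : ∀ w ∈ K B u₀, (w p = d ∨ w p = j) → (w c = d ∨ w c = j) →
        Av (K B u₀) S ℓ j w := by
      intro w h1 h2 h3
      exact Av.of_label h1 (lo w h2 fun h => h3.elim h.1 h.2.1)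
    have attach : ∀ s ∈ S, ∀ m ∈ S, ∀ k ∈ S, ∀ e, (e = d ∨ e = j) → s p ≠ e → m p = s p →
        Perm.sign m = - Perm.sign s → k p = e → Perm.sign k = Perm.sign s →
        (∃ t ∈ S, ∃ w ∈ Y t, T.Reachable s w) ∨ (T.Reachable s m ∧ T.Reachable s k) := by
      intro s hs m hm k hk e he hse hmp hms hkp hks
      have hec : e ∈ cols B u₀ := hkp ▸ val_mem' hpB (hK k hk)
      by_cases hsc : s c = e
      · by_cases hbS : bar s ∈ S
        · have hbm : bar s = m := huniq _ hbS m hm (by rw [bar_ext _ hp, hmp]) (by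
            rw [sign_bar, hms])
          have hsm : T.Reachable s m := by
            rw [← hbm]
            exact TG.bar (hav s hs) (hav _ hbS) fun _ _ => ⟨rfl, rfl⟩
          have hok : out p s ∈ K B u₀ := con_mem hB (hK s hs) (val_mem' hpB (hK s hs))
          have hop : out p s p = e := by rw [out_p hp, hsc]
          have hoc' : out p s c = s p := con_c _ _
          have hos : T.Reachable s (out p s) := by
            refine TG.con (hav s hs) (hlabel _ hok ?_ ?_) fun _ _ _ => ⟨rfl, rfl⟩
            · show out p s p = d ∨ out p s p = j
              rw [hop]; exact he
            · show out p s c = d ∨ out p s c = j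
              rw [hoc']; exact hSp s hs
          by_cases hoS : out p s ∈ S
          · right
            refine ⟨hsm, ?_⟩
            rwa [huniq _ hoS k hk (by rw [hop, hkp]) (by rw [sign_con, hks])] at hos
          · left
            obtain ⟨w, hw, h⟩ := toY k hk (out p s) ((hlay k hk _).2 ⟨hok, by rw [hop, hkp], by
              rw [sign_con, hks]⟩) (fun h => hoS (h ▸ hk)) (by rw [hoc']; exact hSp s hs)
            exact ⟨k, hk, w, hw, hos.trans h⟩
        · left
          have hbk := bar_mem hB (hK s hs)
          obtain ⟨w, hw, h⟩ := toY m hm (bar s) ((hlay m hm _).2 ⟨hbk, by rw [bar_ext _ hp, hmp], by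
            rw [sign_bar, hms]⟩) (fun h => hbS (h ▸ hm)) (by rw [bar_c, hsc]; exact he)
          refine ⟨m, hm, w, hw, (TG.bar (hav s hs) (hlabel _ hbk ?_ ?_) fun _ h =>
            (hbS h).elim).trans h⟩
          · rw [bar_ext _ hp]; exact hSp s hs
          · rw [bar_c, hsc]; exact he
      · left
        have m1 : con s e ∈ K B u₀ := con_mem hB (hK s hs) hec
        have m2 : con s e p = s p := con_of_ne _ hp hse
        obtain ⟨w, hw, h⟩ := toY s hs (con s e) ((hlay s hs _).2 ⟨m1, m2, sign_con _ _⟩)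
          (fun h => hsc (by rw [← h, con_c])) (by rw [con_c]; exact he)
        refine ⟨s, hs, w, hw,
          (TG.con (hav s hs) (hlabel _ m1 ?_ ?_) fun _ _ _ => ⟨rfl, rfl⟩).trans h⟩
        · rw [m2]; exact hSp s hs
        · rw [con_c]; exact he
    have hxd : x p ≠ j := by rw [hxp]; exact hod.symm
    have hyd : y p ≠ j := by rw [hyp]; exact hod.symm
    have hvd : v p ≠ d := by rw [hvp]; exact hod
    have hud : u p ≠ d := by rw [hup]; exact hod
    obtain ⟨r, hr, r1, hr1, e1⟩ := hmate x hxS y hyS (by rw [hyp, hxp]) hys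
    obtain ⟨r2, hr2, r3, hr3, e2⟩ := hcross x hxS v hvS (by rw [hvp, hxp]; exact hod) hvs
    obtain ⟨r4, hr4, r5, hr5, e3⟩ := hmate v hvS u huS (by rw [hup, hvp]) (by rw [hus, hvs])
    have hub : ∀ t ∈ S, ∀ w ∈ Y t, T.Reachable w r := by
      have h1 : ∀ w ∈ Y x, T.Reachable w r := fun w hw => hYl x hxS w hw r hr
      have h2 : ∀ w ∈ Y v, T.Reachable w r := fun w hw =>
        (hYl v hvS w hw r3 hr3).trans (e2.symm.trans (h1 r2 hr2))
      intro t ht w hw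
      rcases (hS t).1 ht with rfl | rfl | rfl | rfl
      · exact h1 w hw
      · exact (hYl t hyS w hw r1 hr1).trans e1.symm
      · exact h2 w hw
      · exact (hYl t huS w hw r5 hr5).trans (e3.symm.trans (h2 r4 hr4))
    have ax := attach x hxS y hyS v hvS j (Or.inr rfl) hxd (by rw [hyp, hxp]) hys hvp hvs
    have ay := attach y hyS x hxS u huS j (Or.inr rfl) hyd (by rw [hyp, hxp]) (by
      rw [hys, neg_neg]) hup (by rw [hus, hys])
    have av := attach v hvS u huS x hxS d (Or.inl rfl) hvd (by rw [hup, hvp]) (by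
      rw [hus, hvs]) hxp hvs.symm
    have au := attach u huS v hvS y hyS d (Or.inl rfl) hud (by rw [hup, hvp]) (by
      rw [hus, hvs, neg_neg]) hyp (by rw [hus, hys])
    have simpl : ∀ s, (∃ t ∈ S, ∃ w ∈ Y t, T.Reachable s w) → T.Reachable s r := by
      rintro s ⟨t, ht, w, hw, h⟩
      exact h.trans (hub t ht w hw)
    replace ax := ax.imp_left (simpl x)
    replace ay := ay.imp_left (simpl y)
    replace av := av.imp_left (simpl v)
    replace au := au.imp_left (simpl u)
    simp only [← SimpleGraph.ConnectedComponent.eq] at ax ay av au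
    have fin : ∀ s ∈ S, T.connectedComponentMk s = T.connectedComponentMk x := by
      obtain ⟨q1, q2, q3⟩ := square_linked ax ay av au
      intro s hs
      rcases (hS s).1 hs with rfl | rfl | rfl | rfl
      · rfl
      · exact q1
      · exact q2
      · exact q3
    intro s hs t ht
    exact SimpleGraph.ConnectedComponent.eq.1 ((fin s hs).trans (fin t ht).symm)
  · have hjn : ∀ w : Perm α, w p = j → ¬ (w p = d ∨ w p = o) := by
      rintro w h (h' | h')
      · exact hjd (h.symm.trans h')
      · exact hjo (h.symm.trans h')
    have hcopy : ∀ w ∈ K B u₀, w p = j → w ∈ K B u₀ ∧ w ∉ S ∧ ℓ w = j := by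
      intro w h1 h2
      refine ⟨h1, fun h => hjn w h2 (hSp w h), ?_⟩
      show (if _ then _ else _) = _
      rw [if_neg (hjn w h2), h2]
    have start : ∀ s ∈ S, ∃ w ∈ K B u₀, w p = j ∧ T.Reachable s w := by
      intro s hs
      have hsj : s p ≠ j := fun h => hjn s h (hSp s hs)
      have m1 : con s j ∈ K B u₀ := con_mem hB (hK s hs) hj
      have m2 : con s j p = s p := con_of_ne _ hp hsj
      have m3 : Av (K B u₀) S ℓ j (con s j) := by
        refine Av.of_label m1 ?_
        show (if _ then (if _ then _ else _) else _) = _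
        rw [if_pos (by rw [m2]; exact hSp s hs), if_pos, con_c]
        exact ⟨by rw [con_c]; exact hjd, by rw [con_c]; exact hjo, s, hs, m2.symm, by rw [con_c]⟩
      have hok : out p (con s j) ∈ K B u₀ := con_mem hB m1 (val_mem' hpB m1)
      have hop : out p (con s j) p = j := by rw [out_p hp, con_c]
      obtain ⟨n1, n2, n3⟩ := hcopy _ hok hop
      refine ⟨_, hok, hop, (TG.con (hav s hs) m3 fun _ h hne => (hne ?_).elim).trans
        (TG.con m3 (Av.of_label n1 n3) fun _ h => (n2 h).elim)⟩
      rw [← huniq _ h s hs m2 (sign_con _ _), con_c]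
    intro s hs t ht
    obtain ⟨w, hw, hwj, h1⟩ := start s hs
    obtain ⟨w', hw', hwj', h2⟩ := start t ht
    exact h1.trans ((TG.copy hB hp hcopy hw hwj hw' hwj').trans h2.symm)

/-- Label assignments for four terminals in four different copies: the labels of the hubs and
the labels of the neighbours leading to the other copies. -/
def templates : List ((Fin 4 → Fin 4) × (Fin 4 → Fin 4 → Fin 4)) := [
  (![2,0,1,1], ![![0,0,1,2],![2,0,0,1],![2,0,0,0],![2,1,0,0]]),
  (![0,2,1,2], ![![0,2,1,0],![0,0,1,2],![0,1,0,2],![0,0,1,0]]),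
  (![0,1,0,2], ![![0,1,2,0],![1,0,0,2],![2,1,0,2],![0,1,2,0]]),
  (![0,0,2,1], ![![0,1,2,0],![1,0,2,1],![0,2,0,1],![0,1,2,0]]),
  (![1,2,2,0], ![![0,2,1,0],![2,0,1,0],![1,1,0,0],![1,2,0,0]]),
  (![2,1,2,1], ![![0,0,0,1],![0,0,2,0],![0,2,0,1],![2,0,1,0]]),
  (![1,0,1,0], ![![0,0,2,2],![0,0,1,2],![2,1,0,0],![2,2,1,0]]),
  (![0,0,2,2], ![![0,1,2,0],![1,0,2,1],![0,2,0,1],![0,1,1,0]]),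
  (![2,0,0,2], ![![0,0,1,1],![0,0,1,2],![1,1,0,2],![1,0,2,0]]),
  (![1,0,1,0], ![![0,0,2,1],![1,0,0,2],![2,0,0,2],![1,2,2,0]]),
  (![1,2,0,0], ![![0,1,0,2],![1,0,2,0],![1,2,0,1],![2,2,1,0]]),
  (![0,2,2,1], ![![0,2,0,1],![0,0,0,1],![0,2,0,1],![0,1,2,0]]),
  (![0,2,1,2], ![![0,0,1,2],![0,0,1,1],![0,2,0,1],![0,2,1,0]]),
  (![0,0,1,0], ![![0,2,1,2],![2,0,1,1],![1,0,0,2],![2,1,2,0]]),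
  (![2,2,2,2], ![![0,1,0,1],![1,0,0,0],![0,0,0,1],![1,0,1,0]])]

/-- A link of label `τ` between two of the four terminals; `b` tells which pairs are bad. -/
def lnk (M : (Fin 4 → Fin 4) × (Fin 4 → Fin 4 → Fin 4)) (b : Fin 4 → Fin 4 → Bool)
    (τ i k : Fin 4) : Bool :=
  i != k && (if b i k then (M.2 i k == τ && M.2 k i == τ) || (M.1 i == τ && M.1 k == τ)
    else (M.1 k == τ && M.2 i k == τ) || (M.1 i == τ && M.2 k i == τ))

/-- The symmetric relation on four points given by six truth values. -/
def sixBits (b01 b02 b03 b12 b13 b23 : Bool) : Fin 4 → Fin 4 → Bool :=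
  ![![false, b01, b02, b03], ![b01, false, b12, b13], ![b02, b12, false, b23],
    ![b03, b13, b23, false]]

theorem exists_template : ∀ b01 b02 b03 b12 b13 b23 : Bool, ∃ M ∈ templates, ∀ τ : Fin 4, τ ≠ 3 →
    ∀ k, ∃ i j, (0 = i ∨ lnk M (sixBits b01 b02 b03 b12 b13 b23) τ 0 i) ∧
      (i = j ∨ lnk M (sixBits b01 b02 b03 b12 b13 b23) τ i j) ∧
      (j = k ∨ lnk M (sixBits b01 b02 b03 b12 b13 b23) τ j k) := by
  decide +kernel

theorem packed_four {B : Finset α} (hB : Core B) {p : α} (hpB : p ∈ B) (hp : Ext p) {u : Perm α}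
    {S : Finset (Perm α)} {f : Fin 4 → Perm α} (hS : ∀ s, s ∈ S ↔ ∃ i, s = f i)
    (hK : ∀ s ∈ S, s ∈ K B u) (hf : Function.Injective fun i => f i p) : Packed B u S := by
  classical
  set g : Fin 4 → α := fun i => f i p with hg
  set idx : α → Fin 4 := Function.invFun g with hidx
  have hgi : ∀ i, idx (g i) = i := Function.leftInverse_invFun hf
  set O : Finset α := Finset.univ.image g with hO
  have hOm : ∀ i, g i ∈ O := fun i => Finset.mem_image_of_mem _ (Finset.mem_univ _)
  set X : α → Perm α := fun e => f (idx e) with hX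
  have hXg : ∀ i, X (g i) = f i := fun i => by simp only [hX, hgi]
  have hfS : ∀ i, f i ∈ S := fun i => (hS _).2 ⟨i, rfl⟩
  have H : Spread B p u Set.univ O X S := by
    refine ⟨hB, hpB, hp, fun _ _ => Set.mem_univ _, ?_, ?_, ?_⟩
    · intro i hi
      exact hK _ (hfS _)
    · intro i hi
      obtain ⟨k, -, rfl⟩ := Finset.mem_image.1 hi
      rw [hXg]
    · intro s
      rw [hS]
      constructor
      · rintro ⟨i, rfl⟩
        exact ⟨hOm i, (hXg i).symm⟩
      · rintro ⟨-, h⟩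
        exact ⟨_, h⟩
  let b : Fin 4 → Fin 4 → Bool := fun i k => decide (Bad p X (g i) (g k))
  have hbs : ∀ i k, b i k = b k i := by
    intro i k
    simp only [b]
    by_cases h : Bad p X (g i) (g k)
    · rw [decide_eq_true h, decide_eq_true (H.bad_symm h)]
    · rw [decide_eq_false h, decide_eq_false fun h' => h (H.bad_symm h')]
  obtain ⟨M, -, hM⟩ := exists_template (b 0 1) (b 0 2) (b 0 3) (b 1 2) (b 1 3) (b 2 3)
  have hsix : ∀ i k, i ≠ k →
      sixBits (b 0 1) (b 0 2) (b 0 3) (b 1 2) (b 1 3) (b 2 3) i k = b i k := by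
    intro i k hik
    fin_cases i <;> fin_cases k <;> first | exact (hik rfl).elim | rfl | exact hbs _ _
  set b' := sixBits (b 0 1) (b 0 2) (b 0 3) (b 1 2) (b 1 3) (b 2 3) with hb'
  let h : α → α := fun e => g (M.1 (idx e))
  let t : α → α → α := fun e k => if k ∈ O then g (M.2 (idx e) (idx k)) else k
  have hh : ∀ i, h (g i) = g (M.1 i) := fun i => by simp only [h, hgi]
  have ht : ∀ i k, t (g i) (g k) = g (M.2 i k) := fun i k => by
    simp only [t, hgi, if_pos (hOm k)]
  refine ⟨g 3, val_mem' hpB (hK _ (hfS 3)), slab p O X h t, smu p t, fun j hj hj3 => ?_⟩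
  have hsec : Sec B u p Set.univ = K B u := by
    ext w
    exact ⟨fun h => h.1, fun h => ⟨h, Set.mem_univ _⟩⟩
  rw [← hsec]
  by_cases hjO : j ∈ O
  · obtain ⟨τ, -, rfl⟩ := Finset.mem_image.1 hjO
    have hτ : τ ≠ 3 := fun h => hj3 (by rw [h])
    set T := TG (Sec B u p Set.univ) S (slab p O X h t) (smu p t) (g τ) with hT
    have hl : ∀ i k, lnk M b' τ i k = true → T.Reachable (f i) (f k) := by
      have l1 : ∀ i k, i ≠ k → b i k = false → M.1 k = τ → M.2 i k = τ →
          T.Reachable (f i) (f k) := by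
        intro i k hik hb h1 h2
        have := H.link (h := h) (t := t) (hOm i) (hOm k) (fun h => hik (hf h))
          (of_decide_eq_false hb) (by rw [hh, ht, h1, h2])
        rwa [ht, h2, hXg, hXg] at this
      intro i k hik
      simp only [lnk, Bool.and_eq_true, bne_iff_ne] at hik
      obtain ⟨hik, h2⟩ := hik
      rw [hsix i k hik] at h2
      cases hb : b i k
      · simp only [hb, Bool.false_eq_true, if_false, Bool.or_eq_true, Bool.and_eq_true,
          beq_iff_eq] at h2
        rcases h2 with ⟨h2, h3⟩ | ⟨h2, h3⟩
        · exact l1 i k hik hb h2 h3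
        · exact (l1 k i hik.symm (by rw [← hbs, hb]) h2 h3).symm
      · have hbad : Bad p X (g i) (g k) := of_decide_eq_true hb
        have hgk : g i ≠ g k := fun h => hik (hf h)
        simp only [hb, if_true, Bool.or_eq_true, Bool.and_eq_true, beq_iff_eq] at h2
        rcases h2 with ⟨h2, h3⟩ | ⟨h2, h3⟩
        · have := H.link_bad (h := h) (t := t) (hOm i) (hOm k) hgk hbad (by rw [ht, ht, h2, h3])
          rwa [ht, h2, hXg, hXg] at this
        · have := H.link_hub (h := h) (t := t) (hOm i) (hOm k) hgk hbad (by rw [hh, hh, h2, h3])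
          rwa [hh, h2, hXg, hXg] at this
    have hl' : ∀ i k, i = k ∨ lnk M b' τ i k = true → T.Reachable (f i) (f k) := by
      rintro i k (rfl | h)
      · exact SimpleGraph.Reachable.refl _
      · exact hl i k h
    have h0 : ∀ k, T.Reachable (f 0) (f k) := by
      intro k
      obtain ⟨i, i', h1, h2, h3⟩ := hM τ hτ k
      exact (hl' _ _ h1).trans ((hl' _ _ h2).trans (hl' _ _ h3))
    intro s hs s' hs'
    obtain ⟨i, rfl⟩ := (hS s).1 hs
    obtain ⟨k, rfl⟩ := (hS s').1 hs'
    exact (h0 i).symm.trans (h0 k)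
  · intro s hs s' hs'
    have htj : ∀ e, t e j = j := fun e => if_neg hjO
    obtain ⟨i, rfl⟩ := (hS s).1 hs
    obtain ⟨k, rfl⟩ := (hS s').1 hs'
    obtain ⟨m1, m2, -⟩ := H.out_mem (hOm i) (k := j) (fun h => hjO (h ▸ hOm i)) hj
    have e1 := H.link_copy (h := h) (t := t) (hOm i) hjO (Set.mem_univ _) hj (htj _) m1 m2
    have e2 := H.link_copy (h := h) (t := t) (hOm k) hjO (Set.mem_univ _) hj (htj _) m1 m2
    simpa only [hXg] using e1.trans e2.symm

theorem joined_single {B : Finset α} (hB : Core B) {p : α} (hpB : p ∈ B) (hp : Ext p)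
    {u v : Perm α} {d : α} (hv : v ∈ K B u) (hvd : v p ≠ d) (W : α → Prop) :
    Joined B u p d W {v} := by
  refine joined_good (O := {v p}) (X := fun _ => v) ⟨hB, hpB, hp, ?_, fun _ _ => hv, ?_, ?_⟩
    (Finset.singleton_nonempty _) ?_ W
  · intro i hi
    rw [Finset.mem_singleton.1 hi]
    exact hvd
  · exact fun i hi => (Finset.mem_singleton.1 hi).symm
  · intro w
    rw [Finset.mem_singleton, Finset.mem_singleton]
    exact ⟨fun h => ⟨by rw [h], h⟩, fun h => h.2⟩
  · intro i hi k hk hik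
    exact (hik ((Finset.mem_singleton.1 hi).trans (Finset.mem_singleton.1 hk).symm)).elim

theorem joined_two {B : Finset α} (hB : Core B) {p : α} (hpB : p ∈ B) (hp : Ext p)
    {u v w : Perm α} {d : α} (hv : v ∈ K B u) (hw : w ∈ K B u) (hvd : v p ≠ d) (hwd : w p ≠ d)
    (hvw : v p ≠ w p) (hbad : out p (con v (w p)) ≠ con w (v p)) (W : α → Prop) :
    Joined B u p d W {v, w} := by
  classical
  let X : α → Perm α := fun i => if i = v p then v else w
  have hXv : X (v p) = v := if_pos rfl
  have hXw : X (w p) = w := if_neg hvw.symm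
  have H : Spread B p u {e | e ≠ d} {v p, w p} X {v, w} := by
    refine ⟨hB, hpB, hp, ?_, ?_, ?_, ?_⟩
    · intro i hi
      simp only [Finset.mem_insert, Finset.mem_singleton] at hi
      rcases hi with rfl | rfl
      · exact hvd
      · exact hwd
    · intro i _
      simp only [X]
      split_ifs
      · exact hv
      · exact hw
    · intro i hi
      simp only [Finset.mem_insert, Finset.mem_singleton] at hi
      rcases hi with rfl | rfl
      · rw [hXv]
      · rw [hXw]
    · intro s
      simp only [Finset.mem_insert, Finset.mem_singleton]
      constructor
      · rintro (rfl | rfl)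
        · exact ⟨Or.inl rfl, hXv.symm⟩
        · exact ⟨Or.inr rfl, hXw.symm⟩
      · rintro ⟨h | h, h'⟩
        · rw [h, hXv] at h'
          exact Or.inl h'
        · rw [h, hXw] at h'
          exact Or.inr h'
  have hnb : ¬ Bad p X (v p) (w p) := by
    intro h
    change out p (con (X _) _) = con (X _) _ at h
    rw [hXv, hXw] at h
    exact hbad h
  refine joined_good H ⟨v p, Finset.mem_insert_self _ _⟩ ?_ W
  intro i hi k hk hik h
  have hb := H.bad_symm h
  simp only [Finset.mem_insert, Finset.mem_singleton] at hi hk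
  rcases hi with rfl | rfl <;> rcases hk with rfl | rfl
  · exact hik rfl
  · exact hnb h
  · exact hnb hb
  · exact hik rfl

theorem packed_two_two {B : Finset α} (hB : Core B) (h5 : 5 ≤ B.card) {p : α} (hpB : p ∈ B)
    (hp : Ext p) {u x y v w : Perm α} {S : Finset (Perm α)}
    (hS : ∀ s, s ∈ S ↔ s ∈ ({x, y} : Finset (Perm α)) ∨ s ∈ ({v, w} : Finset (Perm α)))
    (hK : ∀ s ∈ S, s ∈ K B u) (hxy : x ≠ y) (hvw : v ≠ w) (hyx : y p = x p) (hwv : w p = v p)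
    (hvx : v p ≠ x p) (hs : Perm.sign w = Perm.sign v) : Packed B u S := by
  have hx := hK x ((hS x).2 (Or.inl (by simp)))
  have hy := hK y ((hS y).2 (Or.inl (by simp)))
  have hv := hK v ((hS v).2 (Or.inr (by simp)))
  have hw := hK w ((hS w).2 (Or.inr (by simp)))
  have hxx : x ∈ K (B.erase p) x := K_refl _ _
  have hyx' : y ∈ K (B.erase p) x := mem_erase.2 ⟨K_trans (K_symm hx) hy, hyx⟩
  refine packed_of_joined hB hpB hp hx rfl hS ?_ ?_ ⟨v, by simp⟩
    ((fan_pair (core_erase hB hp) (x p) hxx hyx' hxy).mono fun _ h => h.elim)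
    (joined_same hB h5 hpB hp hv hw rfl hwv hvx (val_mem' hpB hx) hvw hs)
  · intro s hs
    simp only [Finset.mem_insert, Finset.mem_singleton] at hs
    rcases hs with rfl | rfl
    · exact hxx
    · exact hyx'
  · intro s hs
    simp only [Finset.mem_insert, Finset.mem_singleton] at hs
    rcases hs with rfl | rfl
    · exact ⟨hv, hvx⟩
    · exact ⟨hw, by rw [hwv]; exact hvx⟩

theorem packed_two {B : Finset α} (hB : Core B) (h5 : 5 ≤ B.card) {p : α} (hpB : p ∈ B)
    (hp : Ext p) {u x y v w : Perm α} {S : Finset (Perm α)}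
    (hS : ∀ s, s ∈ S ↔ s ∈ ({x, y} : Finset (Perm α)) ∨ s ∈ ({v, w} : Finset (Perm α)))
    (hK : ∀ s ∈ S, s ∈ K B u) (hxy : x ≠ y) (hvw : v ≠ w) (hyx : y p = x p) (hvx : v p ≠ x p)
    (hwx : w p ≠ x p) : Packed B u S := by
  classical
  have hx := hK x ((hS x).2 (Or.inl (by simp)))
  have hy := hK y ((hS y).2 (Or.inl (by simp)))
  have hv := hK v ((hS v).2 (Or.inr (by simp)))
  have hw := hK w ((hS w).2 (Or.inr (by simp)))
  by_cases hwv : w p = v p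
  · by_cases h1 : Perm.sign w = Perm.sign v
    · exact packed_two_two hB h5 hpB hp hS hK hxy hvw hyx hwv hvx h1
    by_cases h2 : Perm.sign y = Perm.sign x
    · exact packed_two_two hB h5 hpB hp (fun s => (hS s).trans Or.comm) hK hvw hxy hwv hyx
        hvx.symm h2
    rw [← ne_eq, sign_ne_iff] at h1 h2
    rcases sign_or x v with h3 | h3
    · refine packed_mixed (x := x) (y := y) (v := v) (u := w) hB h5 hpB hp (fun s => ?_) hK rfl hyx
        rfl hwv hvx h2 h3 (by rw [h1, h3])
      rw [hS]
      simp only [Finset.mem_insert, Finset.mem_singleton, or_assoc]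
    · refine packed_mixed (x := x) (y := y) (v := w) (u := v) hB h5 hpB hp (fun s => ?_) hK rfl hyx
        hwv rfl hvx h2 (by rw [h1, h3, neg_neg]) h3
      rw [hS]
      simp only [Finset.mem_insert, Finset.mem_singleton, or_assoc]
      rw [or_comm (a := s = v)]
  · have hxx : x ∈ K (B.erase p) x := K_refl _ _
    have hyx' : y ∈ K (B.erase p) x := mem_erase.2 ⟨K_trans (K_symm hx) hy, hyx⟩
    refine packed_of_joined hB hpB hp hx rfl hS ?_ ?_ ⟨v, by simp⟩
      (fan_pair (core_erase hB hp) (v p) hxx hyx' hxy) ?_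
    · intro s hs
      simp only [Finset.mem_insert, Finset.mem_singleton] at hs
      rcases hs with rfl | rfl
      · exact hxx
      · exact hyx'
    · intro s hs
      simp only [Finset.mem_insert, Finset.mem_singleton] at hs
      rcases hs with rfl | rfl
      · exact ⟨hv, hvx⟩
      · exact ⟨hw, hwx⟩
    · by_cases hb : out p (con v (w p)) = con w (v p)
      · exact joined_bad hB h5 hpB hp hv hw hvx hwx (Ne.symm hwv) (val_mem' hpB hx) hb
      · exact joined_two hB hpB hp hv hw hvx hwx (Ne.symm hwv) hb _

theorem packed_all (hfan : ∀ (B : Finset α), Core B → B.card = 4 → ∀ u (S : Finset (Perm α)),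
      S.card = 3 → (∀ s ∈ S, s ∈ K B u) → Fan B u (fun _ => False) S)
    (hpack : ∀ (B : Finset α), Core B → B.card = 4 → ∀ u (S : Finset (Perm α)),
      S.card = 4 → (∀ s ∈ S, s ∈ K B u) → Packed B u S) (m : ℕ) :
    ∀ (B : Finset α), B.card = m + 4 → Core B → ∀ u (S : Finset (Perm α)),
      S.card = 4 → (∀ s ∈ S, s ∈ K B u) → Packed B u S := by
  classical
  induction m with
  | zero => exact fun B hc hB => hpack B hB hc
  | succ m ih =>
    intro B hc hB u S hS4 hK
    have h5 : 5 ≤ B.card := by omega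
    obtain ⟨p, hpB, hp⟩ := exists_ext hB (by omega)
    have hbc := core_erase hB hp
    have hcard : (B.erase p).card = m + 4 := by rw [Finset.card_erase_of_mem hpB]; omega
    have hfib : ∀ x ∈ S, ∀ s ∈ S, s p = x p → s ∈ K (B.erase p) x := fun x hx s hs h =>
      mem_erase.2 ⟨K_trans (K_symm (hK x hx)) (hK s hs), h⟩
    have hsplit : ∀ x : Perm α, ∀ s, s ∈ S ↔
        s ∈ S.filter (fun s => s p = x p) ∨ s ∈ S.filter (fun s => ¬ s p = x p) := by
      intro x s
      rw [Finset.mem_filter, Finset.mem_filter, ← and_or_left]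
      exact ⟨fun h => ⟨h, em _⟩, fun h => h.1⟩
    have hsum : ∀ x : Perm α, (S.filter (fun s => s p = x p)).card +
        (S.filter (fun s => ¬ s p = x p)).card = 4 := fun x => by
      rw [Finset.card_filter_add_card_filter_not, hS4]
    by_cases hinj : ∀ x ∈ S, (S.filter (fun s => s p = x p)).card ≤ 1
    · obtain ⟨e⟩ : Nonempty (Fin 4 ≃ S) := ⟨(S.equivFinOfCardEq hS4).symm⟩
      refine packed_four (f := fun i => (e i : Perm α)) hB hpB hp (fun s => ?_) hK ?_
      · exact ⟨fun h => ⟨e.symm ⟨s, h⟩, by simp⟩, by rintro ⟨i, rfl⟩; exact (e i).2⟩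
      · intro i k hik
        have := Finset.card_le_one.1 (hinj _ (e k).2) (e i)
          (Finset.mem_filter.2 ⟨(e i).2, hik⟩) (e k) (Finset.mem_filter.2 ⟨(e k).2, rfl⟩)
        exact e.injective (Subtype.ext this)
    · simp only [not_forall, not_le] at hinj
      obtain ⟨x, hx, h1⟩ := hinj
      have hs := hsum x
      have h24 : (S.filter (fun s => s p = x p)).card = 2 ∨
        (S.filter (fun s => s p = x p)).card = 3 ∨ (S.filter (fun s => s p = x p)).card = 4 := by
        omega
      rcases h24 with h2 | h3 | h4
      · obtain ⟨y, z, hyz, hS0⟩ := Finset.card_eq_two.1 h2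
        obtain ⟨v, w, hvw, hS1⟩ := Finset.card_eq_two.1 (show
          (S.filter (fun s => ¬ s p = x p)).card = 2 by omega)
        have hy : y ∈ S.filter (fun s => s p = x p) := by rw [hS0]; simp
        have hz : z ∈ S.filter (fun s => s p = x p) := by rw [hS0]; simp
        have hv : v ∈ S.filter (fun s => ¬ s p = x p) := by rw [hS1]; simp
        have hw : w ∈ S.filter (fun s => ¬ s p = x p) := by rw [hS1]; simp
        have hS' := hsplit x
        rw [hS0, hS1] at hS'
        rw [Finset.mem_filter] at hy hz hv hw
        exact packed_two hB h5 hpB hp hS' hK hyz hvw (hz.2.trans hy.2.symm)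
          (by rw [hy.2]; exact hv.2) (by rw [hy.2]; exact hw.2)
      · obtain ⟨v, hS1⟩ := Finset.card_eq_one.1 (show
          (S.filter (fun s => ¬ s p = x p)).card = 1 by omega)
        have hv : v ∈ S.filter (fun s => ¬ s p = x p) := by rw [hS1]; simp
        have hS' := hsplit x
        rw [hS1] at hS'
        rw [Finset.mem_filter] at hv
        have h0 : ∀ s ∈ S.filter (fun s => s p = x p), s ∈ K (B.erase p) x := fun s hs =>
          hfib x hx s (Finset.mem_filter.1 hs).1 (Finset.mem_filter.1 hs).2
        refine packed_of_joined hB hpB hp (hK x hx) rfl hS' h0 ?_ ⟨v, by simp⟩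
          (fan_three hfan m _ hcard hbc x _ h3 h0) (joined_single hB hpB hp (hK v hv.1) hv.2 _)
        intro s hs
        rw [Finset.mem_singleton.1 hs]
        exact ⟨hK v hv.1, hv.2⟩
      · have hall : ∀ s ∈ S, s ∈ K (B.erase p) x := by
          intro s hs'
          have := (hsplit x s).1 hs'
          rw [Finset.card_eq_zero.1 (show (S.filter (fun s => ¬ s p = x p)).card = 0 by omega)]
            at this
          refine hfib x hx s hs' (Finset.mem_filter.1 (this.resolve_right (by simp))).2
        exact packed_const hB hpB hp (hK x hx) hall (ih _ hcard hbc x S hS4 hall)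

/-- The label of `v` in the table `L`, whose `v`th and `v + 24`th bits are its digits. -/
def lab (L v : ℕ) : ℕ := (L.testBit v).toNat + 2 * (L.testBit (v + 24)).toNat

/-- The vertices carrying the label `j` in the table `L`. -/
def plane (L : ℕ) : ℕ → ℕ
  | 0 => Nat.xor 16777215 (Nat.lor L (Nat.shiftRight L 24))
  | 1 => Nat.xor L (Nat.land L (Nat.shiftRight L 24))
  | 2 => Nat.xor (Nat.shiftRight L 24) (Nat.land L (Nat.shiftRight L 24))
  | _ + 3 => Nat.land L (Nat.shiftRight L 24)

/-- The masks of the edges inside `A` carrying the label `j`. -/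
noncomputable def sel (L T j A : ℕ) (E : List (ℕ × ℕ × ℕ)) : List ℕ :=
  List.rec [] (fun e _ r => bif Nat.beq (Nat.land A e.2.2) e.2.2 then
    bif Nat.beq (Nat.land T e.2.2) e.2.2 then
      bif Nat.beq (Nat.mod (Nat.add (lab L e.1) (lab L e.2.1)) 4) j then e.2.2 :: r else r
    else e.2.2 :: r else r) E

/-- Add to the vertex set `R` the ends of the edges meeting it. -/
def sweep : List ℕ → ℕ → ℕ
  | [], R => R
  | m :: E, R => bif Nat.beq (Nat.land R m) 0 then sweep E R else
      bif Nat.beq (Nat.land R m) m then sweep E R else sweep E (Nat.lor R m)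

/-- Whether at most `k` sweeps extend the vertex set `R` to one containing `T`. -/
def spans (E : List ℕ) (T : ℕ) : ℕ → ℕ → Bool
  | 0, _ => false
  | k + 1, R => bif Nat.beq (Nat.land R T) T then true else spans E T k (sweep E R)

/-- The vertex set with the elements `0` and those of `l`. -/
def mask : List ℕ → ℕ
  | [] => 1
  | s :: l => Nat.lor (Nat.shiftLeft 1 s) (mask l)

/-- Whether each label starting with the vertex set `R` spans the terminals. -/
noncomputable def spansAll (E : List (ℕ × ℕ × ℕ)) (L T j : ℕ) : List ℕ → Bool
  | [] => true
  | R :: l =>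
    bif spans (sel L T j (Nat.lor T (plane L j)) E) T 12 R then spansAll E L T (Nat.succ j) l
    else false

/-- Whether each terminal set is spanned using the corresponding table. -/
noncomputable def checks (E : List (ℕ × ℕ × ℕ)) (seeds : List ℕ) : List (List ℕ) → List ℕ → Bool
  | [], _ => true
  | _ :: _, [] => false
  | l :: A, L :: C => bif spansAll E L (mask l) 0 seeds then checks E seeds A C else false

theorem mask_testBit (l : List ℕ) (x : ℕ) : (mask l).testBit x = true ↔ x = 0 ∨ x ∈ l := by
  induction l with
  | nil => rw [mask, Nat.testBit_one_eq_true_iff_self_eq_zero]; simp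
  | cons s l ih =>
    change ((1 <<< s) ||| mask l).testBit x = true ↔ _
    rw [Nat.testBit_or, Bool.or_eq_true, ih, Nat.one_shiftLeft, Nat.testBit_two_pow, List.mem_cons,
      decide_eq_true_iff]
    tauto

theorem sweep_sound {P : ℕ → Prop} (E : List ℕ)
    (h : ∀ m ∈ E, ∀ x y, m.testBit x = true → m.testBit y = true → P x → P y) :
    ∀ R : ℕ, (∀ x, R.testBit x = true → P x) → ∀ x, (sweep E R).testBit x = true → P x := by
  induction E with
  | nil => intro R hR; exact hR
  | cons m E ih =>
    intro R hR
    have ih := ih (fun m' hm => h m' (List.mem_cons_of_mem _ hm))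
    rw [sweep, cond_eq_ite, cond_eq_ite]
    split_ifs with h1 h2
    · exact ih R hR
    · exact ih R hR
    · refine ih _ fun x hx => ?_
      change (R ||| m).testBit x = true at hx
      rw [Nat.beq_eq] at h1
      change ¬ R &&& m = 0 at h1
      obtain ⟨y, hy⟩ := Nat.exists_testBit_of_ne_zero h1
      rw [Nat.testBit_and, Bool.and_eq_true] at hy
      rw [Nat.testBit_or, Bool.or_eq_true] at hx
      rcases hx with hx | hx
      · exact hR x hx
      · exact h m List.mem_cons_self y x hy.2 hx (hR y hy.1)

theorem spans_sound {P : ℕ → Prop} (E : List ℕ) (T k : ℕ)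
    (h : ∀ m ∈ E, ∀ x y, m.testBit x = true → m.testBit y = true → P x → P y) :
    ∀ R : ℕ, (∀ x, R.testBit x = true → P x) → spans E T k R = true →
      ∀ x, T.testBit x = true → P x := by
  induction k with
  | zero => intro R _ h'; simp [spans] at h'
  | succ k ih =>
    intro R hR h' x hx
    rw [spans, cond_eq_ite] at h'
    split_ifs at h' with h1
    · rw [Nat.beq_eq] at h1
      change R &&& T = T at h1
      rw [← h1, Nat.testBit_and, Bool.and_eq_true] at hx
      exact hR x hx.1
    · exact ih _ (sweep_sound E h R hR) h' x hx

theorem plane_spec {L v j : ℕ} (hv : v < 24) (hj : j < 4) (h : (plane L j).testBit v = true) :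
    lab L v = j := by
  have e : (Nat.shiftRight L 24).testBit v = L.testBit (v + 24) := by
    change (L >>> 24).testBit v = _
    rw [Nat.testBit_shiftRight, Nat.add_comm]
  have e' : Nat.testBit 16777215 v = true := by
    rw [show 16777215 = 2 ^ 24 - 1 by norm_num, Nat.testBit_two_pow_sub_one]
    simpa using hv
  have hx (x y : ℕ) : (Nat.xor x y).testBit v = ((x.testBit v) ^^ (y.testBit v)) :=
    Nat.testBit_xor x y v
  have ha (x y : ℕ) : (Nat.land x y).testBit v = ((x.testBit v) && (y.testBit v)) :=
    Nat.testBit_and x y v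
  have ho (x y : ℕ) : (Nat.lor x y).testBit v = ((x.testBit v) || (y.testBit v)) :=
    Nat.testBit_or x y v
  rw [lab]
  interval_cases j <;> simp only [plane, hx, ha, ho, e, e'] at h <;>
    cases h1 : L.testBit v <;> cases h2 : L.testBit (v + 24) <;> simp [h1, h2] at h ⊢

theorem mem_sel {L T j A m : ℕ} {E : List (ℕ × ℕ × ℕ)} (h : m ∈ sel L T j A E) :
    ∃ v w, (v, w, m) ∈ E ∧ A &&& m = m ∧ (T &&& m = m → (lab L v + lab L w) % 4 = j) := by
  induction E with
  | nil => simp [sel] at h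
  | cons e E ih =>
    have key : m ∈ sel L T j A E → ∃ v w, (v, w, m) ∈ e :: E ∧ A &&& m = m ∧
        (T &&& m = m → (lab L v + lab L w) % 4 = j) := fun h => by
      obtain ⟨v, w, h1, h2⟩ := ih h
      exact ⟨v, w, List.mem_cons_of_mem _ h1, h2⟩
    obtain ⟨v, w, m'⟩ := e
    change m ∈ (bif Nat.beq (Nat.land A m') m' then bif Nat.beq (Nat.land T m') m' then
      bif Nat.beq (Nat.mod (Nat.add (lab L v) (lab L w)) 4) j then m' :: sel L T j A E
      else sel L T j A E else m' :: sel L T j A E else sel L T j A E) at h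
    rw [cond_eq_ite, cond_eq_ite, cond_eq_ite] at h
    split_ifs at h with h1 h2 h3
    · rcases List.mem_cons.1 h with rfl | h
      · exact ⟨v, w, List.mem_cons_self, Nat.eq_of_beq_eq_true h1,
          fun _ => Nat.eq_of_beq_eq_true h3⟩
      · exact key h
    · exact key h
    · rcases List.mem_cons.1 h with rfl | h
      · exact ⟨v, w, List.mem_cons_self, Nat.eq_of_beq_eq_true h1,
          fun h' => (h2 (by rw [Nat.beq_eq]; exact h')).elim⟩
      · exact key h
    · exact key h

theorem spansAll_spec {E : List (ℕ × ℕ × ℕ)} {L T : ℕ} {seeds : List ℕ} :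
    ∀ {j : ℕ}, spansAll E L T j seeds = true → ∀ i R, seeds[i]? = some R →
      spans (sel L T (j + i) (T ||| plane L (j + i)) E) T 12 R = true := by
  induction seeds with
  | nil => intro j _ i R h; simp at h
  | cons R' l ih =>
    intro j h i R hi
    rw [spansAll, cond_eq_ite] at h
    split_ifs at h with h1
    cases i with
    | zero => simp at hi; subst hi; exact h1
    | succ i =>
      rw [List.getElem?_cons_succ] at hi
      have := ih h i R hi
      rwa [Nat.succ_eq_add_one, Nat.add_right_comm] at this

theorem checks_spec {E : List (ℕ × ℕ × ℕ)} {seeds : List ℕ} {A : List (List ℕ)} :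
    ∀ {C : List ℕ}, checks E seeds A C = true → ∀ l ∈ A, ∃ L,
      spansAll E L (mask l) 0 seeds = true := by
  induction A with
  | nil => intro C _ l h; simp at h
  | cons l' A ih =>
    intro C h l hl
    cases C with
    | nil => simp [checks] at h
    | cons L C =>
      rw [checks, cond_eq_ite] at h
      split_ifs at h with h1
      rcases List.mem_cons.1 hl with rfl | hl
      · exact ⟨L, h1⟩
      · exact ih h l hl

/-- A numbering of the elements of `K B g` by the numbers below `N`, starting with `g`, such that
the entries of `E` are edges. The colour of the vertex `x` is `κ (col x)`. -/
structure Coded (B : Finset α) (g : Perm α) (N : ℕ) (E : List (ℕ × ℕ × ℕ)) (f : ℕ → Perm α)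
    (κ : ℕ → α) (col : ℕ → ℕ) (m : ℕ) : Prop where
  le : N ≤ 24
  m_le : m ≤ 4
  zero : f 0 = g
  pos : 0 < N
  mem : ∀ x < N, f x ∈ K B g
  inj : ∀ x < N, ∀ y < N, f x = f y → x = y
  surj : ∀ w ∈ K B g, ∃ x < N, f x = w
  edge : ∀ v w k, (v, w, k) ∈ E → v < N ∧ w < N ∧ k = 2 ^ v ||| 2 ^ w ∧ (EG α).Adj (f v) (f w)
  col_eq : ∀ x < N, f x c = κ (col x)
  cols : ∀ j, j ∈ Godan.cols B g ↔ ∃ i < m, κ i = j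

namespace Coded

variable {B : Finset α} {g : Perm α} {N : ℕ} {E : List (ℕ × ℕ × ℕ)} {f : ℕ → Perm α}
    {κ : ℕ → α} {col : ℕ → ℕ} {m : ℕ}

/-- The number of a vertex. -/
noncomputable def num (f : ℕ → Perm α) (N : ℕ) (w : Perm α) : ℕ :=
  open Classical in if h : ∃ x < N, f x = w then h.choose else 0

theorem num_eq (hc : Coded B g N E f κ col m) {x : ℕ} (hx : x < N) : num f N (f x) = x := by
  have h : ∃ y < N, f y = f x := ⟨x, hx, rfl⟩
  rw [num, dif_pos h]
  exact hc.inj _ h.choose_spec.1 _ hx h.choose_spec.2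

/-- The list of the numbers of the vertices of `S` other than the first. -/
theorem exists_list (hc : Coded B g N E f κ col m) {S : Finset (Perm α)} (hS : ∀ s ∈ S, s ∈ K B g)
    (hg : g ∈ S) {k : ℕ} (hk : S.card = k + 1) :
    ∃ l ∈ List.sublistsLen k (List.range' 1 (N - 1)),
      (∀ x < N, (mask l).testBit x = true ↔ f x ∈ S) := by
  refine ⟨(List.range' 1 (N - 1)).filter (fun x => decide (f x ∈ S)), ?_, ?_⟩
  · rw [List.mem_sublistsLen]
    refine ⟨List.filter_sublist, ?_⟩
    have hnd : ((List.range' 1 (N - 1)).filter (fun x => decide (f x ∈ S))).Nodup :=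
      List.Nodup.filter _ List.nodup_range'
    rw [← List.toFinset_card_of_nodup hnd]
    have : (S.erase g).card = k := by rw [Finset.card_erase_of_mem hg, hk]; rfl
    rw [← this]
    refine Finset.card_bij (fun x _ => f x) ?_ ?_ ?_
    · intro x hx
      rw [List.mem_toFinset, List.mem_filter, List.mem_range'_1, decide_eq_true_iff] at hx
      refine Finset.mem_erase.2 ⟨fun h => ?_, hx.2⟩
      rw [← hc.zero] at h
      have := hc.inj x (by omega) 0 hc.pos h
      omega
    · intro x hx y hy h
      rw [List.mem_toFinset, List.mem_filter, List.mem_range'_1] at hx hy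
      exact hc.inj x (by omega) y (by omega) h
    · intro w hw
      rw [Finset.mem_erase] at hw
      obtain ⟨x, hx, rfl⟩ := hc.surj w (hS w hw.2)
      refine ⟨x, ?_, rfl⟩
      rw [List.mem_toFinset, List.mem_filter, List.mem_range'_1, decide_eq_true_iff]
      have : x ≠ 0 := fun h => hw.1 (by rw [h, hc.zero])
      exact ⟨by omega, hw.2⟩
  · intro x hx
    rw [mask_testBit, List.mem_filter, List.mem_range'_1, decide_eq_true_iff]
    constructor
    · rintro (rfl | h)
      · rwa [hc.zero]
      · exact h.2
    · intro h
      by_cases h0 : x = 0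
      · exact Or.inl h0
      · exact Or.inr ⟨by omega, h⟩

theorem reach (hc : Coded B g N E f κ col m) {S : Finset (Perm α)} {T L : ℕ}
    (hT : ∀ x < N, T.testBit x = true ↔ f x ∈ S) {j : ℕ} (hj : j < 4) {k R : ℕ}
    (hR : ∀ x, R.testBit x = true → x < N)
    (h : spans (sel L T j (T ||| plane L j) E) T k R = true) {s : Perm α} (hs : s ∈ S)
    (hsK : s ∈ K B g) : ∃ x, R.testBit x = true ∧
      (TG (K B g) S (fun w => κ (lab L (num f N w)))
        (fun v w => κ ((lab L (num f N v) + lab L (num f N w)) % 4)) (κ j)).Reachable s (f x) := by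
  obtain ⟨y, hy, rfl⟩ := hc.surj s hsK
  refine (spans_sound (P := fun y => y < N ∧ ∃ x, R.testBit x = true ∧
      (TG (K B g) S (fun w => κ (lab L (num f N w)))
        (fun v w => κ ((lab L (num f N v) + lab L (num f N w)) % 4)) (κ j)).Reachable (f y) (f x))
      _ T k ?_ R ?_ h y ((hT y hy).2 hs)).2
  · intro mk hmk y z hy hz ⟨_, x, hx, hxy⟩
    obtain ⟨v, w, hE, hA, hL⟩ := mem_sel hmk
    obtain ⟨hv, hw, rfl, hadj⟩ := hc.edge v w mk hE
    have hbit (z : ℕ) : (2 ^ v ||| 2 ^ w).testBit z = true ↔ z = v ∨ z = w := by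
      rw [Nat.testBit_or, Nat.testBit_two_pow, Nat.testBit_two_pow]
      rw [Bool.or_eq_true, decide_eq_true_iff, decide_eq_true_iff, eq_comm, eq_comm (a := w)]
    have hav : ∀ z, z = v ∨ z = w → z < N →
        Av (K B g) S (fun w => κ (lab L (num f N w))) (κ j) (f z) := by
      intro z hz hzN
      refine ⟨hc.mem z hzN, fun hzS => ?_⟩
      have hb := (hbit z).2 hz
      rw [← hA, Nat.testBit_and, Bool.and_eq_true, Nat.testBit_or, Bool.or_eq_true] at hb
      have hp := hb.1.resolve_left fun h => hzS ((hT z hzN).1 h)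
      simp only [hc.num_eq hzN]
      rw [plane_spec (lt_of_lt_of_le hzN hc.le) hj hp]
    have hvw : (TG (K B g) S (fun w => κ (lab L (num f N w)))
        (fun v w => κ ((lab L (num f N v) + lab L (num f N w)) % 4)) (κ j)).Adj (f v) (f w) := by
      refine ⟨hadj, hav v (Or.inl rfl) hv, hav w (Or.inr rfl) hw, fun h1 h2 => ?_⟩
      have : T &&& (2 ^ v ||| 2 ^ w) = 2 ^ v ||| 2 ^ w := by
        refine Nat.eq_of_testBit_eq fun z => ?_
        rw [Nat.testBit_and, Bool.and_eq_right_iff_imp, hbit]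
        rintro (rfl | rfl)
        · exact (hT _ hv).2 h1
        · exact (hT _ hw).2 h2
      simp only [hc.num_eq hv, hc.num_eq hw]
      rw [Nat.add_comm (lab L w), hL this]
      exact ⟨rfl, rfl⟩
    rw [hbit] at hy hz
    rcases hy with rfl | rfl <;> rcases hz with rfl | rfl
    · exact ⟨hv, x, hx, hxy⟩
    · exact ⟨hw, x, hx, hvw.symm.reachable.trans hxy⟩
    · exact ⟨hv, x, hx, hvw.reachable.trans hxy⟩
    · exact ⟨hw, x, hx, hxy⟩
  · intro x hx
    exact ⟨hR x hx, x, hx, SimpleGraph.Reachable.refl _⟩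

theorem packed (hc : Coded B g N E f κ col m) {M : ℕ} (hM : m = M + 1) {C : List ℕ}
    (h : checks E (List.replicate M 1) (List.sublistsLen 3 (List.range' 1 (N - 1))) C = true)
    {S : Finset (Perm α)} (hS : ∀ s ∈ S, s ∈ K B g) (hg : g ∈ S) (h4 : S.card = 4) :
    Packed B g S := by
  obtain ⟨l, hl, hT⟩ := hc.exists_list hS hg (k := 3) h4
  obtain ⟨L, hL⟩ := checks_spec h l hl
  refine ⟨κ M, (hc.cols _).2 ⟨M, by omega, rfl⟩, fun w => κ (lab L (num f N w)),
    fun v w => κ ((lab L (num f N v) + lab L (num f N w)) % 4), fun j hj hjM => ?_⟩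
  obtain ⟨i, hi, rfl⟩ := (hc.cols j).1 hj
  have hiM : i < M := by
    have : i ≠ M := fun h => hjM (by rw [h])
    omega
  have hsp := spansAll_spec hL i 1 (by rw [List.getElem?_replicate, if_pos hiM])
  rw [Nat.zero_add] at hsp
  have key : ∀ s ∈ S, (TG (K B g) S (fun w => κ (lab L (num f N w)))
      (fun v w => κ ((lab L (num f N v) + lab L (num f N w)) % 4)) (κ i)).Reachable s g := by
    intro s hs
    obtain ⟨x, hx, hr⟩ := hc.reach hT (lt_of_lt_of_le hi hc.m_le) (R := 1) (fun x hx => by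
      rw [Nat.testBit_one_eq_true_iff_self_eq_zero] at hx
      rw [hx]; exact hc.pos) hsp hs (hS s hs)
    rw [Nat.testBit_one_eq_true_iff_self_eq_zero] at hx
    rwa [hx, hc.zero] at hr
  exact fun s hs t ht => (key s hs).trans (key t ht).symm

theorem fan (hc : Coded B g N E f κ col m) {seeds : List ℕ} (hlen : seeds.length = m)
    (hseed : ∀ i R, seeds[i]? = some R → ∀ x, R.testBit x = true → x < N ∧ col x = i)
    {C : List ℕ} {k : ℕ}
    (h : checks E seeds (List.sublistsLen k (List.range' 1 (N - 1))) C = true)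
    {S : Finset (Perm α)} (hS : ∀ s ∈ S, s ∈ K B g) (hg : g ∈ S) (hk : S.card = k + 1) :
    Fan B g (fun _ => False) S := by
  obtain ⟨l, hl, hT⟩ := hc.exists_list hS hg hk
  obtain ⟨L, hL⟩ := checks_spec h l hl
  refine ⟨fun w => κ (lab L (num f N w)),
    fun v w => κ ((lab L (num f N v) + lab L (num f N w)) % 4), fun j hj s hs => ?_⟩
  obtain ⟨i, hi, rfl⟩ := (hc.cols j).1 hj
  have hget := List.getElem?_eq_getElem (hlen.symm ▸ hi)
  have hsp := spansAll_spec hL i _ hget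
  rw [Nat.zero_add] at hsp
  obtain ⟨x, hx, hr⟩ := hc.reach hT (lt_of_lt_of_le hi hc.m_le)
    (fun x hx => (hseed i _ hget x hx).1) hsp hs (hS s hs)
  obtain ⟨hxN, hxc⟩ := hseed i _ hget x hx
  exact ⟨f x, hc.mem x hxN, by rw [hc.col_eq x hxN, hxc], hr, False.elim⟩

end Coded

/-- The edges of the godan graph on four symbols, with their masks. -/
def edges4 : List (ℕ × ℕ × ℕ) := [
  (0, 6, 65), (0, 7, 129), (0, 8, 257), (0, 14, 16385), (1, 6, 66), (1, 7, 130), (1, 11, 2050),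
  (1, 23, 8388610), (2, 6, 68), (2, 12, 4100), (2, 14, 16388), (2, 15, 32772), (3, 14, 16392),
  (3, 15, 32776), (3, 16, 65544), (3, 22, 4194312), (4, 15, 32784), (4, 21, 2097168),
  (4, 22, 4194320), (4, 23, 8388624), (5, 7, 160), (5, 19, 524320), (5, 22, 4194336),
  (5, 23, 8388640), (6, 12, 4160), (7, 19, 524416), (8, 12, 4352), (8, 13, 8448), (8, 14, 16640),
  (9, 12, 4608), (9, 13, 8704), (9, 17, 131584), (9, 18, 262656), (10, 13, 9216), (10, 18, 263168),
  (10, 19, 525312), (10, 20, 1049600), (11, 18, 264192), (11, 19, 526336), (11, 23, 8390656),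
  (13, 20, 1056768), (15, 21, 2129920), (16, 20, 1114112), (16, 21, 2162688), (16, 22, 4259840),
  (17, 18, 393216), (17, 20, 1179648), (17, 21, 2228224)]

/-- The edges of the godan graph on three symbols, with their masks. -/
def edges3 : List (ℕ × ℕ × ℕ) := [
  (0, 2, 5), (0, 3, 9), (0, 5, 33), (1, 2, 6), (1, 4, 18), (1, 5, 34), (2, 4, 20), (3, 4, 24),
  (3, 5, 40)]

/-- The vertices of each colour in the godan graph on four symbols. -/
def colours4 : List ℕ := [2693376, 9584676, 4457553, 41610]

/-- Tables for all sets of three vertices containing `0`. -/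
def fanTables : List ℕ := [
  690218128090, 102824438043350, 6204416496560, 121722968531060, 46782195602174, 15002392371634,
  8436760181446, 20533536552564, 23796333843184, 1677667430840, 126601584145030, 18333370480308,
  143663172396416, 221451072847794, 21066042862698, 103031803012206, 171767294354106,
  138419892970678, 164162677360824, 128561328546996, 111706363452626, 103956771030622,
  191978035272828, 273419611067132, 187109625876200, 249179911028378, 214286791653084,
  119455800910984, 71625794418390, 28674711754486, 137647543753412, 140907546960012,
  246344565540516, 237823794354902, 102282708457174, 160720272752876, 47694404166378,
  195811294729462, 102695834984650, 192324514793130, 149321396879802, 177883496159998,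
  128937752105178, 115043520801202, 161982952050892, 42977893880038, 176209835639996,
  216665440277622, 23966669457738, 249093217730994, 220497964457110, 256764599124166,
  226510544961758, 213662145990732, 262604437757174, 94038080087268, 205121676003250,
  227215998042782, 148323623561918, 271470065756914, 150244749380822, 225685844075410,
  226793006098108, 171690550839374, 106127372379796, 178711824548508, 24670732079726,
  58224029516022, 164189529843446, 219146915235002, 25446712079970, 92577463452362, 251541676885730,
  112992439658190, 226793876907718, 270098053587346, 180891648835990, 102695568089834,
  51712853006914, 193688373979314, 225472271014066, 123356339282932, 39757540686434,
  247837847447704, 185416158571234, 219939237314728, 27765131467494, 150532305036184,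
  81854800748714, 178848657498238, 178879857390218, 14897365819604, 23694429907118, 227894061883630,
  181337992650860, 162816171624624, 163073937419506, 273421785352400, 259811844974718,
  101464517672054, 227055938756758, 84440610044086, 13590792315126, 32988414563570, 166301273018542,
  114153559221482, 2934914477150, 234375268461718, 6378478233788, 182992631871718, 98085417215234,
  226202146400390, 227380309319864, 148907893273414, 156248910734507, 222185445806740,
  126919051132642, 237357255709918, 222795331199124, 66062277860420, 33730799519152, 53705018496606,
  216305799124192, 183535098950734, 6436360414814, 149561634095830, 14939280431736, 112462581886348,
  150731081728236, 248941549086360, 153683467162238, 205812967492020, 29923079304150,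
  109621896341804, 143831313017132, 237182363228968, 129933935700358, 167179765858554,
  238759825041650, 221201990213874, 164018796093690, 9107923856598, 23229768530578, 112326050770150,
  147652733007110, 269993430475466, 184223941903084, 262863186438626, 148446327223714,
  177264087363758, 84954889354682, 151902571613078, 1103045072722, 214978550489244, 8957362102428,
  173836923735758, 70595774013644, 254024903685782, 116224131004120, 198087315873920,
  253749028355804, 164138755696000, 101255099932746, 253772917295830, 151071424135374,
  200667617223326, 262303830235230, 271324132053212, 215392988549846, 91081568017022,
  214254855704924, 236552480202950, 231226180151534, 91455572485098, 216856665580708,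
  212517675658446, 144347959061932, 163882543114408, 112247429841642, 74048093662436,
  78376859248040, 142792769721060, 7328324765006, 165478753296554, 88203744371434, 93460783226090,
  90871421387174, 94096904465614, 148093204258478, 165557100346058, 129927393766304, 23494558552804,
  101775970382532, 211368024760468, 213488598574480, 211693407463650, 225449855763124,
  193052615861956, 83686138636706, 226692209147598, 213884876144788, 275628024709364,
  130517920408242, 222692782948756, 117100783362484, 244828748178608, 262961788708272,
  223400073257046, 199228771030210, 172111733139330, 43434638828704, 23374429284136,
  212819522545816, 213205302141154, 253772877425448, 46051752134330, 94477375334754, 58199674364122,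
  216130017223808, 22741497143484, 235057420191458, 231582525074146, 183149124043946,
  72822647959992, 144380842560680, 222890156016056, 181248057431208, 181145987813114,
  235941214163658, 148022874163818, 166655481120994, 165653211309412, 180771021676972,
  94106031669340, 76084281139364, 147644738698572, 70757439788740, 23316305410724, 75213603095884,
  33160113046668, 101935494881568, 269969032237920, 77536039578020, 13430035923564, 250279429104364,
  217431584305380, 203094448367304, 259281175659116, 226870112777966, 34258807846596,
  172221817734860, 233316851164580, 95221572478184]

/-- Tables for all sets of four of the six vertices containing `0`. -/
def packTables3 : List ℕ := [
  3, 10, 12, 36, 301989930, 17, 301989944, 33554486, 369098789, 48]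

/-- Tables for all sets of four of the 24 vertices containing `0`. -/
def packTables4 : List ℕ := [
  26425054943008, 2412163727942, 14424647794770, 11092289996808, 928184008864, 4400631389760,
  145309750744834, 1651354125954, 147928708564104, 71471074789458, 9657435297362, 9657468981840,
  149707830679296, 9366791208990, 153011048460, 80301661491776, 105230090296, 18780023586918,
  913088520992, 35203913421426, 35185749772296, 44807984518738, 44601767627858, 106689672304148,
  770217086112, 79318116207690, 18885044617272, 39618222318600, 18848470286456, 247665934993606,
  106455462840386, 158521605772040, 89080315024148, 182278516908872, 88253927590466, 83634354670154,
  28675957325906, 114403475497036, 26450558337106, 79184803192904, 219922491949064, 18504265116418,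
  41862240944172, 24362166010936, 41885629465228, 79270670155800, 37403536447562, 28745725397016,
  185356566792258, 37420176286980, 105555800943644, 175942093820488, 2750092678832, 33004680532492,
  22026744002312, 237514644280074, 8887664124584, 26389690857602, 13274403982344, 4651720246342,
  13222864377864, 81366821981258, 55132620406826, 275593038032, 158405646304264, 4451041628712,
  56217632785546, 18983898589412, 140790410531460, 70423272964168, 37596072854536, 26407914770532,
  171543980167944, 153951261582088, 180340041273352, 145172311594760, 167180264100618,
  105572980899864, 35238873681930, 83644320400392, 50655952653324, 52795885910540, 158384205091592,
  167180297589512, 4761509798672, 827386823258, 145430547216964, 10222160589122, 15481889106258,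
  152027615527178, 55407498297642, 41894528688544, 88238760954438, 76141893263744, 9916109730576,
  149982978212948, 168245009191680, 44412143047440, 18848875025250, 102563953251202, 36078069753632,
  19259787061402, 4591367230200, 19123610589954, 167304008570484, 33021994488418, 75591761528224,
  169789758673588, 90437516013848, 180631561577728, 167419972686616, 35459385791062, 79305097239298,
  13608739145844, 89219431137976, 41011338289416, 55267781780400, 46558834918568, 186232739993352,
  105848128418374, 43198948868436, 624180201090, 9090709459554, 44274842440308, 37464194958382,
  14038772810002, 55802836550754, 2478937576576, 18711033846342, 199287422059780, 55528290585860,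
  21165769229536, 71522648117844, 203721845769474, 569357060104, 48672750475860, 44309441417826,
  238869035389716, 83857122695772, 54703060685426, 185561981721192, 26957901597254, 44550353607244,
  70427533525000, 79184735453768, 24226031523340, 327660732672, 83619256221704, 9193514205968,
  149587572969992, 59685088531026, 50622636315660, 143250454544544, 195749883168008,
  184737588330760, 257305618956568, 2206010033178, 156493877870856, 230073211159938, 4726713221424,
  22652804727096, 36062726984464, 123437763301958, 152061842030866, 188345326240010, 4718189510740,
  18691451012, 27247482372690, 78349198172576, 6881009476000, 79459956951616, 55270260670562,
  35462009849946, 76007541360668, 42617152800866, 65155056535618, 11582999438610, 2208695363734,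
  114404247028268, 54168609882722, 18286629094978, 40441621774930, 89338079611474, 45905222837128,
  111603584338498, 97877472848666, 72569414246428, 167984964436752, 63953170646028, 119316944126530,
  24233279242382, 19932956346040, 70930850925596, 9211162725450, 22319007801458, 219922559287880,
  46241769914452, 130871956875386, 55259183973764, 44146397102152, 167146001025096, 18143117053328,
  22422489137242, 88565246394632, 38225318519552, 25566132602986, 98278381194626, 93872550053632,
  185028568163072, 203867333854276, 9408129335382, 46474306259546, 85782316499500, 44275186434656,
  36570108659794, 55013472732416, 53601293305096, 80043772871242, 134144310919686, 83608051368058,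
  46182172790866, 141635477906088, 8799045997134, 9365719564570, 13282733899804, 80291226370060,
  168304872703252, 184789156151402, 27763918504628, 35204014231592, 150789862588502, 27645104504914,
  79185104257094, 8816796377864, 40135698294016, 63033342951490, 40407187072800, 96914596986950,
  116274093106560, 248284208694418, 100348026954656, 44531396780960, 165068751241380,
  211108682449512, 107754866394204, 184720370837248, 26408143577866, 96776361107538, 8799049163074,
  8807638040646, 43998819865096, 149553718649608, 8797274117760, 217978586604928, 184857813664842,
  237514174513226, 26941122020674, 9365855797334, 79442803503872, 46748638913360, 143075668465424,
  60198396364208, 26682484630118, 38277932655888, 27919575416934, 11014984024604, 8815958511690,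
  140816173892868, 9365180863036, 2768422125676, 55802535150896, 62399503926528, 178400463983780,
  64890517865066, 29707089248578, 35479089349184, 9370011378242, 9347027920392, 178124407179008,
  39868370059338, 46473760735834, 116276106102362, 79442467890242, 63791614140498, 4428117196964,
  8814655422984, 9142006915360, 79787171390224, 9392666066968, 42676305537280, 50854828749580,
  15670188225292, 54978031180300, 19383735027798, 28598043980084, 187537901758720, 91537161884244,
  21165769233312, 2959304297200, 14570815009588, 56971072381696, 40203914324736, 6357795218196,
  132012539414630, 96794069811284, 27762838735232, 111325998483684, 79236243546384, 26468317169748,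
  219973494949964, 228701371654920, 41816989631152, 220007318732936, 237497466512128, 8832872219206,
  149536033358344, 8048845785170, 50580265380692, 182521888327754, 188019442468938, 62743613032472,
  167128724564234, 9107881202246, 54151124781652, 80541543211108, 26665342214920, 11822201841920,
  151771060118274, 53601595110146, 220256829188400, 194890886287940, 56900062546690, 40519066067112,
  79348213305352, 256463806179584, 44188784886048, 126996277889618, 26390433155334, 26390431193612,
  205611631659594, 62674985835094, 63224167008848, 63224141842546, 19001141756576, 187752957413442,
  65422124911232, 205061804525634, 17875727911144, 79200850591772, 63774904306200, 116825594858056,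
  56350986240578, 10173436564042, 27762813702304, 27490005684306, 26940790882378, 265326571070352,
  46216005145148, 26665311076458, 24464272659104, 255089651572810, 62674444747074, 30511588192850,
  195724109488384, 47004458754370, 2202116386048, 27281841988946, 73944709507332, 47004331811154,
  3023800379666, 22094387822738, 37660832043106, 72913722280050, 38210927400018, 21168421612610,
  143246221645024, 72570721889290, 118766591633534, 37455680054528, 91603735684434, 36077968828720,
  23365308394640, 17734199708838, 179292672632064, 40407296714032, 31181666123858, 27095606773834,
  224320506875980, 187194174381172, 54994946527348, 213342300955674, 230934754649354,
  22368391012690, 154088696207624, 171818826602564, 49497921055000, 108854605252678, 48689972383826,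
  46540405088688, 169344424501512, 46732335391042, 178980246266272, 154501587738890, 9228009937194,
  194222716438674, 13505625335088, 143609044148512, 249317215710464, 206040587047176,
  126996479225938, 48467137306964, 140979455460480, 13763497517068, 196264742627464,
  135517559859282, 14313019467788, 230933446288536, 187057373989962, 126446924736770,
  126996345000026, 17970355929170, 19172809637970, 48466327775488, 41543147720826, 11290208737346,
  36079945844834, 20134951684166, 70714559171666, 188020682664192, 13522786394426, 134418325086472,
  13196832445716, 82466056758536, 46749121335316, 4967209460024, 195716156763392, 194476459688320,
  116635743560066, 46336801001752, 47435900780866, 79255109279920, 47624879341634, 54978534543426,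
  13231187017740, 89404786641042, 246965682232, 56901949986906, 200680501421376, 124107509467222,
  112185662513456, 55250598037574, 65423194476608, 21166580864192, 56350986242114, 126446689853696,
  11288415869204, 6781889201172, 9620937582690, 2415147879816, 9503154510162, 81538645573704,
  55547990659128, 20618200488018, 20618200488018, 246434486426192, 126587752204312, 178980346925792,
  73393181825232, 115473350006850, 141950012368170, 105828464727712, 35476908806880, 36026429215472,
  18283982233280, 106378496847122, 40957249073732, 40138184867864, 28862385787106, 202451877904560,
  74945645264922, 18300858157068, 9107617621264, 167149662659082, 35191118043720, 22265246847238,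
  168249176377384, 149678306184204, 55063733092392, 37453256214696, 61596344803848, 46249932759312,
  53396442793090, 2853275959307, 101321264941320, 13350943670313, 123300869095553, 44058916618520,
  159433885749860, 141025656609862, 8900584023041, 9365210020628, 149690884968986, 19380046154810,
  8815493900584, 35190890435186, 195891612881472, 184875558916608, 9640529363202, 133202001813508,
  152577104941636, 48649631666370, 59042915962012, 90412015194436, 149691159714626, 142622982279362,
  55800320498320, 39686610469948, 88517934336014, 163868475670564, 154227985982136, 159843285478144,
  63362381660234, 23381938413986, 28744613904466, 79188467966004, 106659313640496, 178397142099076,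
  158473663366184, 42412869698696, 273920666255498, 176542286741890, 11156448367106,
  116825467654226, 9488127049752, 145790889238880, 19516503894448, 273299876038728, 126586309886080,
  9936713297988, 26665344604244, 41923185262606, 203450721918986, 27770084416325, 134302125875224,
  54735579787392, 79441864991000, 89473432031314, 18850880690338, 619630578864, 177163206824008,
  35260146657362, 67381632307284, 89132955781148, 42057003997266, 83737636454410, 14180111372615,
  13695304834, 183343669390560, 135534412304450, 118204480382994, 14761936814166, 12013091946578,
  9779784583254, 11657952634242, 9638588581970, 9573557995610, 18177413239448, 43982119717000,
  19935091002438, 107477941101906, 63033346892610, 178673659439178, 98148735265362, 44553843382354,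
  28193276204, 53603813562434, 14177831749718, 35947345611346, 83616582455352, 23233633983050,
  111875913165138, 88653226068104, 190112769120074, 169518068404346, 71129834604618, 64411968760394,
  26407686138152, 17769389884544, 61613722043974, 54037140346966, 70371773598282, 49497354823980,
  55237620531828, 134299600818758, 176027898299400, 26822142202024, 53331548717122, 70111121643610,
  211450771342720, 108577646193024, 193997503104808, 70542333494276, 49362064443576, 61731573629518,
  77037355156038, 1929382464644, 829669903504, 6644616959172, 88551566213714, 10800311175234,
  196269536447042, 13765375508622, 41825776227464, 93566670094984, 274603968696704, 35741109268032,
  185577283717000, 28746358718546, 140881374889528, 62833496850530, 196406975398466,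
  145994899006792, 27096953012876, 167166838113350, 67912094326906, 177028082958914,
  206164872659026, 39858875213056, 28744068923718, 9008763502674, 49190600394826, 9365257208120,
  75867544368912, 68861210677850, 50584246816838, 49772229701718, 54703019394308, 115725813416010,
  42342237612288, 185029474066720, 155067919425832, 63565587293010, 181082268975672, 47038965551264,
  123970607723412, 158473560539192, 194757444391480, 117099162776464, 19517581830272,
  11551317952594, 133315919347778, 30979599110234, 30962964534354, 31787124457640, 13286559055954,
  176615766365250, 247001421975618, 2927026065452, 30805661356126, 62831110262996, 108890986385494,
  265979338690882, 117923368669266, 9779911266370, 126450825168978, 31443791134794, 67784323125274,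
  28755015766098, 44136472627240, 38642631590020, 44139714463818, 88105083062312, 37570499350626,
  62750646747272, 63697187787223, 10739907564106, 107478000606290, 193529616076874, 1802074853442,
  35809559913542, 4953508232832, 18280756944640, 485735925922, 41129080918786, 485743266978,
  149712128868452, 54855662436458, 23317379729516, 5257150149888, 160661166596, 21853268084130,
  159657087731878, 19967479710960, 38826709879954, 250278011995274, 23472667895426, 176061750035724,
  89064211229962, 37280384026034, 5107790910098, 159657091943074, 61783377480928, 189206501525728,
  20139248455314, 96967476923978, 211334404784796, 79323215317004, 18009415256210, 8934911265796,
  17940221134002, 93875176212634, 36567427459346, 55203349153798, 79185006717000, 114624162964882,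
  44053560295570, 27367970249472, 168435734823090, 1924213646144, 176141176834214, 158918961807490,
  44690019731586, 176490743081346, 28616429725732, 38556068495506, 8801495588512, 38246894273714,
  23162771754072, 18214963383442, 5063782252598, 196337182182018, 89133590776978, 17632727041154,
  56110597820712, 159982100681984, 95774551630900, 47872780281266, 23575625600658, 4540854830738,
  3300998034784, 70474544702492, 36026526999136, 24959130812460, 154143457036300, 180940903551296,
  140741858117736, 233925865701442, 158605024637696, 28333978943642, 9024276152408, 46180605183036,
  80285423550468, 96984656773258, 26615914823890, 59380108654120, 113525280739712, 196538576409864,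
  179083834557640, 10721118134666, 19451917633626, 9623345115936, 105763646734482, 179092420040970,
  39725231018676, 194343046809706, 17802644209724, 162763490095368, 54462001591056, 194619195529858,
  54152159830308, 46872065557020, 23676043535696, 18485883962538, 163037462040832, 1859798565010,
  176631872489602, 118477277106256, 88185610996130, 26595524086938, 35394901771442, 37969193865488,
  195301898588464, 180638104205064, 135532189323410, 126718916694162, 55117688619112,
  62913754956706, 71539694117696, 46841991348268, 35937066422418, 56763705985418, 54564682992010,
  20500952924684, 35536694414692, 101322214899781, 40352027911362, 77638279970828, 42409853460866,
  55057458995392, 17682387411020, 13514184929584, 143559587866304, 158331054900268, 156226484707714,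
  32989188769818, 109685747745984, 10131832326202, 42412845573312, 76978430429198, 108853438758656,
  18968935144224, 70747450643026, 198131811681346, 230760875819074, 267044894018626, 73427777824514,
  70438847923340, 70661205072768, 140850602370056, 143982991936, 141907166768000, 142482423701784,
  266378569384066, 159585183648012, 15552076632220, 115191157105026, 149692498479238,
  149552140362112, 89219364063314, 149552009299972, 89421361718162, 229939666257050,
  175923304099080, 153993206616072, 107477498077584, 123304484849804, 116359322149784,
  28747468429828, 193515422630024, 88137292370056, 182554733854856, 178237154549832,
  178672087095304, 180974118781068, 69531263320600, 164996843569800, 163829654767626,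
  50613006188568, 149809871063170, 17847808508936, 189271999856648, 167144126175256, 27131576979654,
  7424190266624, 33694056271880, 44689407688714, 136893660479616, 100880336563458, 89335756793088,
  70643766010240, 65038731989012, 70648330623556, 9398702395648, 33020824257936, 184736509238144,
  194103564371088, 196299366925648, 123184226272388, 77279482348676, 118803359940744,
  93497554113094, 71193716075074, 142937890832524, 140927843828608, 41375575968338, 44139655875138,
  47437923240018, 154090542762704, 194073772829952, 46628387946578, 109955869884482, 11016601881234,
  149727930781846, 34244923510808, 29155353698448, 43998756946560, 105863605031568, 26406902080384,
  26406572851584, 79715710947352, 117875386106392, 26665577120846, 135514942608002, 44145020273026,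
  89335724515718, 176682405871752, 141498038436480, 61575109450304, 44672094371984, 48453749058130,
  123974365753940, 176614764335624, 186952717525000, 125069884535040, 126718857972370,
  116823321512018, 194888843534596, 168109321424976, 18835591665738, 18835655366738, 44689445488768,
  109404024763648, 44689274376336, 28746526787712, 141652725465216, 30821866225672, 109126664860994,
  125688393344128, 124386824835204, 117922824491218, 126718958637264, 167834571522178,
  195241798156424, 159589208070784, 189821482046356, 115607904207492, 8963806468178, 44147974180948,
  180390006417928, 11219604881944, 164447119764482, 164652273768004, 109126772594896,
  176199289054468, 92084310911250, 50871949856850, 229523533400736, 211740612641832, 34041986285658,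
  49297710129498, 145251566100656, 10055064881330, 8914819391570, 181145917996812, 8799927685146,
  63275144343714, 265257348235668, 72431337080384, 113533912088914, 113533844988242,
  109144455784530, 11704332458724, 111875653107906, 176231337427152, 33101317218506, 38210252834394,
  189813160546688, 8894878329050, 149766717835410, 175932901602560, 17877871572240, 181970584887938,
  194692209705346, 179023267238084, 179299047187586, 186999923550338, 621967845634, 62744112147218,
  27491825619714, 70405789099086, 148747738195526, 18145769772042, 186953622429984, 112463895332000,
  760287723682, 41941471385612, 93617410542178, 59550799578664, 42026267639910, 197087597700514,
  56216868931724, 100489349861996, 178143604836512, 37817326539366, 89080315308044, 18593060229730,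
  135669603502240, 202346147955720, 89203786702348, 98150782380140, 63914524335628, 96967487520996,
  64923837489312, 38012147223690, 211177638873608, 37796966828160, 167145636129544, 193519453356072,
  65030104058054, 24882463227928, 36494383663112, 35538779316520, 55392235784352, 53193212790944,
  44272594356384, 64033671626856, 104595380525216, 9346997170434, 46321264512672, 54112842680390,
  19595331635336, 18284393810048, 92535106601540, 142460882264232, 70648588440134, 153951564531970,
  166080486064394, 41821279884448, 195715255059496, 38006241627234, 35807218633314, 52781931695266,
  53945972984992, 126718857971106, 50915226714182, 142938155837708, 29278836099296, 37559565289122,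
  56234015228128, 37542992808002, 52918829498884, 63922011113570, 54017808434340, 55667076123296,
  59133185229122, 200287348854944, 65439304523936, 28060139126944, 41860408090884, 59391927738408,
  38003591873664, 54169374040224, 50737527657122, 62694753476768, 47438594326658, 62964359238306,
  87964867306752, 194957294567584, 769011499168, 80406620850312, 966440524456, 150568740913312,
  63774371629064, 19654448255872, 88102673072778, 54019956033580, 211248641298560, 56351724407426,
  691562807976, 65150497587362, 159124315440288, 760421154976, 18215034290336, 36734860264608,
  38092073341026, 55598427408458, 123287045473440, 55117420956832, 62813901034604, 46321903093890,
  54564410249482, 55048734844128, 65167677464738, 55046054936706, 141365732335656, 215696009641994,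
  172348584108802, 46257913744556, 54584810684578, 108104865391752, 53468052932772, 107831059859720,
  72096504628392, 124382429711265, 54159680864672, 116767285318890, 195851620794504, 54151157655810,
  189410747427082, 68302869135520, 9640269320258, 68334045403428, 47014997995808, 55075049310274,
  38561395041576, 71344309408904, 215505923264648, 202483045798276, 123420860025218, 62964367491488,
  197913339372832, 62964430282818, 54161827965186, 135532130871586, 51969252139936, 141839185132804,
  56156735144160, 55186043207810, 41863050502310, 60151021240544, 64596383701568, 35263434992002,
  46330899862690, 46261633812556, 60963445277058, 154056318435908, 60826006331778, 52042258194594,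
  89885279402592, 88854352766312, 124503728849826, 55203386950368, 211117506855022, 54088671218216,
  169480521289988, 11657724043648, 51904752124098, 108164592211780, 44061068173570, 35530255925318,
  63928449173574, 65096814691138, 46859209146752, 65172010172608, 41783628738880, 72434761470592,
  65165399959618, 93321192080768, 81656063991874, 65236401128066, 79581987408002, 15861587972256,
  18834506156208, 36627754133792, 5673656534048, 11854189437362, 43065705268370, 21187076070036,
  20359290028210, 75059385381252, 27647243616852, 21199971165602, 27849113241670, 105607374536788,
  105845754110336, 75214005798530, 54017808682016, 23365172080402, 27831390216982, 4985465086768,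
  114659253625216, 96899294513794, 235396963346524, 165412082287282, 183279139504644,
  42371002738320, 21165601502486, 159640751703216, 56321018462368, 143668572390528, 74786969037056,
  38243475915954, 54168165290160, 28158927700144, 35846876111152, 83599165665540, 60116796195000,
  57880397552032, 22681928353978, 253100812222480, 183112911906072, 35893314865322, 32333065355666,
  202895433803184, 141631951938816, 54464753829024, 27524841506048, 22579788649650, 125351305236996,
  70648499472512, 37938633120928, 54427281267872, 158919499191458, 628745454848, 62998584492450,
  27647241652870, 3442961301508, 92383438522372, 37702338945296, 123304753318404, 47004193393074,
  109986908284288, 37994895786004, 194752373080068, 38633545662696, 46733611565728, 54427273138336,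
  217785447310464, 18160301052064, 1375499358992, 55681143013536, 97325636932352, 53396489109664,
  62281669022368, 36560419946640, 60478546518184, 194905889444512, 688370943648, 79167523861264,
  167677471955586, 768912787632, 44397082247332, 62947577738116, 109988508885760, 53362121576608,
  18077528165010, 54185307583238, 54017842090664, 56349983771298, 79307378821766, 4814661128770,
  98084705290370, 105628816850944, 7184981185556, 46730691228064, 74943422481412, 90779603199264,
  53469126592672, 34104458399748, 203821972328880, 188018002502048, 56079392206854, 163313749610628,
  65167543247010, 56625994664098, 46807899979938, 53398858973184, 213383907428386, 38208600085696,
  105560407492608, 55663951103104, 124386548664496, 215511293026304, 38633773482116, 23236182672803,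
  108930101436450, 39858953290004, 60748021633954, 257561170354576, 15722280460546, 344713013504,
  47717159276704, 70644437032832, 46799150918432, 185585809625190, 107834550797440, 36010394396836,
  218051733169280, 141359256119040, 164020542280404, 9124658057814, 51703895318816, 141288423448608,
  64873337746224, 29706413959456, 87985097839190, 40134695215200, 123156610714708, 24949544714418,
  39999638803008, 37660500691058, 211141968708740, 19043899670768, 46535975897266, 47419236817680,
  13480599040256, 89063436863748, 38835375571362, 43155903742178, 64873379945008, 108096006988128,
  168411311149218, 70937358655618, 143212500819712, 167676901269380, 166061794136208,
  187468142108290, 143728201433218, 109070972389446, 176472996978432, 185380558348544,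
  70375465720386, 181008515339138, 83854952139334, 176335555070720, 114900105975426,
  194614938845184, 116621516562560, 11974380690004, 27166016340546, 29979949672578, 28091238060134,
  67213017142292, 20491293757604, 1659000746242, 143521772499746, 211210422264608, 35812516373792,
  35746580811776, 142456921419008, 56428501411976, 38561303495810, 107763423584578, 20350734434464,
  56154026147970, 38553317542018, 43155906925250, 63110262292546, 38913490290818, 65266327233154,
  9024264685706, 5158524240040, 15621064542728, 8005958010288, 9088824213824, 9556336001544,
  22767892318344, 21050750687752, 77700254483496, 146528043807104, 28057544955970, 26487642146840,
  19181328827808, 38345648965840, 115980025912, 93734071447232, 36365489693738, 27762845068688,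
  53635555799850, 6268510028840, 98149305694992, 90303298821640, 29016937765280, 24897928054952,
  178430525055296, 42490112526472, 178156489708720, 17819820148888, 1374798252098, 23399124992082,
  169569610466530, 191607248828672, 59618441085584, 38092066539688, 54053242160168, 158742128133184,
  9484536661152, 2237209851154, 33195840079944, 147723896496404, 55203219179626, 82144028802,
  83857635358978, 37654286041316, 73392404635424, 54444113269152, 44033650032912, 18970875430058,
  46734617166874, 143299846439200, 37954900281512, 54430427532328, 40207337540104, 127011846635786,
  108104638891176, 96895569776808, 149586497130504, 27904407149736, 70786162237056, 94654645256504,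
  55667884836938, 185564067345056, 38006167457320, 133183748198408, 54567631343716, 105661028728904,
  29276514567298, 149828327125256, 98835795809200, 36974342050576, 24344988815752, 60065122436256,
  265674329445000, 26548803883528, 54036632195592, 52778203006092, 54429357576960, 52777934213760,
  11589169528872, 7182429470896, 20207825949344, 145828099475466, 184937304129640, 55801067084416,
  44605388177448, 5192754545312, 54151082185504, 181046595813572, 54430930440770, 35394827124968,
  54426937737784, 15428631925160, 22713165627400, 19383192277152, 210634558624, 109195828693144,
  72641054008480, 19383597156514, 37456414787746, 38075427998856, 193655852076202, 17665873848400,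
  26813491746480, 249199103656072, 126994810161330, 54565282005122, 141369656100874, 22647366828074,
  46868570654856, 197987259301936, 126032602482850, 53468597602434, 194205570453016,
  270652766962312, 54567728208801, 54700708200794, 309273825516, 211933554086680, 63496800838008,
  47004266014834, 64341030224168, 170525234055208, 169334756644224, 178672016045320,
  158924800344104, 27586984067200, 106378431050624, 169417136955432, 204728512563240,
  202537777332908, 233414964413522, 121681256382538, 112427614077026, 125104613102472,
  108064331900168, 45235716526384, 55252913520744, 552585683030, 826460078230, 42133901814112,
  178673094246700, 196272858941572, 74879601763588, 121497645499546, 246980250289260,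
  188506119113914, 211179451632244, 75902350951058, 17869251846248, 45091792105728, 52246168478048,
  17666348197034, 211932813787278, 99780948656322, 105829204180736, 33020820099848, 44009632708864,
  184856634069376, 8892735105346, 26408686531338, 30907696308744, 193515422588288, 110775997833088,
  8818683712144, 109135254790338, 47984495575048, 149534694391816, 83855076757696, 194756638982152,
  41919993365672, 35461705335368, 60508749730560, 169326437316352, 2061730840642, 38561294606602,
  55737946802754, 142696133428448, 35536568068162, 46292772339720, 46263781574664, 98066997052486,
  53881443340840, 38212467696706, 19242567746216, 89472895453280, 38843693402178, 47554021566786,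
  20344224179240, 54104386964102, 65163386429634, 18145434082050, 22541331150496, 18177913078016,
  179299080495360, 54104814665760, 64465311650336, 106241394283280, 70372538759936, 203600140091400,
  203411098582432, 37944997515552, 54219671994592, 38071975626240, 196824699519008, 29774864998704,
  110363748108642, 35461399127122, 101230768582148, 38768527027266, 188183493230592, 43983158009932,
  238736831339524, 6790620205216, 149726922358952, 178396164827552, 11056860709000, 90199816208544,
  148194024564544, 77159088640132, 112464188474496, 18335289442480, 141394955157576, 9424840312960,
  44004087597160, 107755226618372, 5532992709536, 19259909228704, 202469594712200, 13937712119960,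
  176554227599424, 168384796822144, 18335690129568, 723372229760, 33161981477004, 46232639914120,
  22252297011848, 37420440511560, 175923270545160, 50681696305172, 167370916512328, 158340148062216,
  107822008779952, 55108733837432, 126620467728980, 140819434062952, 35479183304968,
  198462989680824, 159571190667424, 9622950839384, 51128699986816, 36840087504936, 140816212437280,
  114626637606176, 175991990569992, 168385000380484, 48709292359864, 6604052843528, 89063135530240,
  52782069978272, 19830942270592, 196572537685376, 246913710688872, 17632458572928, 59412295713936,
  143491441904768, 32030268096584, 23233634517036, 22683941816872, 140881772806720, 105746399395944,
  36444950906924, 264574549361256, 63915556096556, 97034789325568, 203964641591360, 194068433275520,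
  5064248420514, 8832141116440, 27818641990320, 70547053352544, 176206939455616, 35221417895240,
  26548272957600, 63931674525856, 67089536804968, 268499881148584, 89714697044768, 140739106021760,
  195649119716000, 19380168048800, 761900646424, 9796825710776, 257287600225028, 55870356988704,
  97859219511360, 26940719515720, 62674314872936, 239419061838176, 44120056795488, 46186074785844,
  195889633432160, 249933206692256, 194755628290120, 159571188520036, 13213479557400,
  37527546271808, 178263558248512, 230489825350756, 193656116006984, 4467918569648, 18285830555704,
  624193267752, 188859174619520, 22060099881000, 197088399069248, 194142257168552, 46807904174248,
  158408330789024, 38071731248680, 247008401440896, 126032795420816, 54569711978540, 90334436542024,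
  112229107657732, 178740236140673, 265301136552000, 254262533689536, 53989362679828,
  169050590294080, 116825727701088, 159095636313128, 35941737580072, 89894881857718, 83616604446798,
  782872428856, 47022590735136, 89697416127280, 46773348349216, 85874728575280, 21991419597368,
  133367500636578, 88135984678658, 211416175355030, 8797283409976, 121805617566816, 35254178137258,
  9655424127904, 35736914837248, 212482133998368, 108382158070080, 71540376125492, 55800416438994,
  80704252194, 175925922544384, 71470507507488, 211668236516608, 269698377847074, 177297258054018,
  194485183910304, 113560723685524, 257698507591938, 179496280134528, 18966655444202,
  211382858715296, 34974063398996, 33981856749144, 13384263308160, 49513460924544, 194416325756992,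
  27609195094912, 26440974635776, 54020023409160, 117484669632896, 8848712925572, 109445440349440,
  63686123323456, 125070731524864, 197637551434816, 269269015861312, 115904156402882, 414479253582,
  163689863453512, 211201862975624, 55208592589060, 36903642867968, 6571374544000, 37419974971976,
  70996960224544, 22635623377192, 194832606431400, 38698871702656, 54703060816448, 141288323179692,
  135319932371016, 54152231397632, 230210384300096, 71745820569152, 215788455278978,
  140741284905998, 123164638253128, 17902575981328, 18151947391104, 18993956952324, 177641257068800,
  23142625988740, 248764775867296, 628488692000, 1376073956096, 203744658763844, 199286755825568,
  195165797110336, 34269827204192, 42482596912292, 54426966845712, 362393446660, 62865704796288,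
  203428173201536, 72587642175830, 105692979560772, 203480522714368, 1377088311368, 18143286926112,
  167814304766720, 46257880214800, 165752187454144, 56626325252224, 78531552544, 37461782995120,
  203419587592360, 73256172591904, 178684334709824, 195234588401728, 47006539066440,
  267191929290880, 89273579867200, 204251737497928, 249882137593920, 35477574942900, 17869216392272,
  47555091144864, 2630669598784]

theorem checks_fan :
    checks edges4 colours4 (List.sublistsLen 2 (List.range' 1 23)) fanTables = true := by
  decide +kernel

theorem checks_pack3 :
    checks edges3 [1, 1] (List.sublistsLen 3 (List.range' 1 5)) packTables3 = true := by
  decide +kernel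

theorem checks_pack4 :
    checks edges4 [1, 1, 1] (List.sublistsLen 3 (List.range' 1 23)) packTables4 = true := by
  decide +kernel

instance finTri (k : ℕ) : Tri (Fin (k + 3)) where
  a := ⟨0, by omega⟩
  b := ⟨1, by omega⟩
  c := ⟨2, by omega⟩
  hab := by simp
  hac := by simp
  hbc := by simp

instance (β : Type*) [DecidableEq β] [Fintype β] [Tri β] : DecidableRel (EG β).Adj :=
  fun u v => inferInstanceAs (Decidable (v = bar u ∨ (u ≠ v ∧ v = con u (v c))))

section Transfer

variable {β : Type*} [Fintype β] [DecidableEq β] [Tri β] {e : β ↪ α}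

theorem viaEmbedding_swap (x y : β) : (swap x y).viaEmbedding e = swap (e x) (e y) := by
  ext q
  by_cases hq : q ∈ Set.range e
  · obtain ⟨z, rfl⟩ := hq
    rw [Perm.viaEmbedding_apply]
    exact (e.injective.swap_apply x y z).symm
  · rw [Perm.viaEmbedding_apply_of_notMem _ _ _ hq, swap_apply_of_ne_of_ne]
    · rintro rfl; exact hq ⟨x, rfl⟩
    · rintro rfl; exact hq ⟨y, rfl⟩

theorem viaEmbedding_mul (σ τ : Perm β) :
    (σ * τ).viaEmbedding e = σ.viaEmbedding e * τ.viaEmbedding e :=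
  map_mul (Perm.viaEmbeddingHom e) σ τ

theorem viaEmbedding_one : (1 : Perm β).viaEmbedding e = 1 :=
  map_one (Perm.viaEmbeddingHom e)

theorem viaEmbedding_tau (ha : e a = a) (hb : e b = b) (hc : e c = c) (r : β) :
    (tau r).viaEmbedding e = tau (e r) := by
  rcases pos_cases r with rfl | rfl | rfl | hr
  · rw [ha, tau_a, tau_a, viaEmbedding_mul, viaEmbedding_swap, viaEmbedding_swap, ha, hb, hc]
  · rw [hb, tau_b, tau_b, viaEmbedding_mul, viaEmbedding_swap, viaEmbedding_swap, ha, hb, hc]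
  · rw [hc, tau_cc, tau_cc, viaEmbedding_one]
  · have hr' : Ext (e r) :=
      ⟨fun h => hr.1 (e.injective (h.trans ha.symm)),
        fun h => hr.2.1 (e.injective (h.trans hb.symm)),
        fun h => hr.2.2 (e.injective (h.trans hc.symm))⟩
    rw [tau_ext hr, tau_ext hr', viaEmbedding_mul, viaEmbedding_swap, viaEmbedding_swap, ha, hb, hc]

theorem viaEmbedding_inj {σ τ : Perm β} (h : σ.viaEmbedding e = τ.viaEmbedding e) : σ = τ :=
  Perm.viaEmbeddingHom_injective e h

theorem adj_transfer (ha : e a = a) (hb : e b = b) (hc : e c = c) (g : Perm α) {σ τ : Perm β}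
    (h : (EG β).Adj σ τ) : (EG α).Adj (g * σ.viaEmbedding e) (g * τ.viaEmbedding e) := by
  rcases h with rfl | ⟨h1, h2⟩
  · left
    rw [bar, bar, viaEmbedding_mul, viaEmbedding_swap, ha, hb, mul_assoc]
  · right
    refine ⟨fun h => h1 (viaEmbedding_inj (mul_left_cancel h)), ?_⟩
    rw [con, Perm.mul_apply, ← hc, Perm.viaEmbedding_apply]
    have : (g * σ.viaEmbedding e).symm (g (e (τ c))) = e (σ.symm (τ c)) := by
      rw [Equiv.symm_apply_eq, Perm.mul_apply, Perm.viaEmbedding_apply, Equiv.apply_symm_apply]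
    rw [this, ← viaEmbedding_tau ha hb hc, mul_assoc, ← viaEmbedding_mul]
    conv_lhs => rw [h2, con]

theorem transfer_mem {B : Finset α} (hB : ∀ q, q ∈ B ↔ q ∈ Set.range e) (g : Perm α) (σ : Perm β) :
    g * σ.viaEmbedding e ∈ K B g := by
  intro q hq
  rw [hB] at hq
  rw [Perm.mul_apply, Perm.viaEmbedding_apply_of_notMem _ _ _ hq]

theorem transfer_surj {B : Finset α} (hB : ∀ q, q ∈ B ↔ q ∈ Set.range e) {g w : Perm α}
    (hw : w ∈ K B g) : ∃ σ : Perm β, g * σ.viaEmbedding e = w := by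
  have hx (x : β) : ∃ y, g (e y) = w (e x) := by
    have := val_mem' ((hB (e x)).2 ⟨x, rfl⟩) hw
    rw [cols, Finset.mem_image] at this
    obtain ⟨q, hq, h⟩ := this
    obtain ⟨y, rfl⟩ := (hB q).1 hq
    exact ⟨y, h⟩
  choose f hf using hx
  have hinj : Function.Injective f := fun x y h =>
    e.injective (w.injective (by rw [← hf, ← hf, h]))
  refine ⟨Equiv.ofBijective f (Finite.injective_iff_bijective.1 hinj), ?_⟩
  ext q
  by_cases hq : q ∈ Set.range e
  · obtain ⟨z, rfl⟩ := hq
    rw [Perm.mul_apply, Perm.viaEmbedding_apply]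
    exact hf z
  · rw [Perm.mul_apply, Perm.viaEmbedding_apply_of_notMem _ _ _ hq]
    exact (hw q (by rwa [hB])).symm

end Transfer

/-- The colours of `K B g`, numbered. -/
def colourAt {k : ℕ} (e : Fin (k + 3) ↪ α) (g : Perm α) (i : ℕ) : α :=
  if h : i < k + 3 then g (e ⟨i, h⟩) else g a

theorem coded_transfer {k : ℕ} (hk : k ≤ 1) {e : Fin (k + 3) ↪ α} (ha : e a = a) (hb : e b = b)
    (hc : e c = c) {B : Finset α} (hB : ∀ q, q ∈ B ↔ q ∈ Set.range e)
    {σ : ℕ → Perm (Fin (k + 3))} (h0 : σ 0 = 1)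
    (hinj : ∀ x < (k + 3).factorial, ∀ y < (k + 3).factorial, σ x = σ y → x = y)
    {E : List (ℕ × ℕ × ℕ)} (hE : ∀ t ∈ E, t.1 < (k + 3).factorial ∧ t.2.1 < (k + 3).factorial ∧
      t.2.2 = 2 ^ t.1 ||| 2 ^ t.2.1 ∧ (EG (Fin (k + 3))).Adj (σ t.1) (σ t.2.1)) (g : Perm α) :
    Coded B g (k + 3).factorial E (fun x => g * (σ x).viaEmbedding e) (colourAt e g)
      (fun x => (σ x c : Fin (k + 3))) (k + 3) where
  le := (Nat.factorial_le (show k + 3 ≤ 4 by omega)).trans (by decide)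
  m_le := by omega
  zero := by rw [h0, viaEmbedding_one, mul_one]
  pos := Nat.factorial_pos _
  mem x _ := transfer_mem hB g _
  inj x hx y hy h := hinj x hx y hy (viaEmbedding_inj (mul_left_cancel h))
  surj w hw := by
    obtain ⟨τ, hτ⟩ := transfer_surj hB hw
    have : (Finset.range (k + 3).factorial).image σ = Finset.univ := by
      rw [← Finset.card_eq_iff_eq_univ, Finset.card_image_of_injOn, Finset.card_range,
        Fintype.card_perm, Fintype.card_fin]
      intro x hx y hy h
      exact hinj x (by simpa using hx) y (by simpa using hy) h
    obtain ⟨x, hx, rfl⟩ := Finset.mem_image.1 (this ▸ Finset.mem_univ τ)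
    exact ⟨x, by simpa using hx, hτ⟩
  edge v w m hm := by
    obtain ⟨h1, h2, h3, h4⟩ := hE _ hm
    exact ⟨h1, h2, h3, adj_transfer ha hb hc g h4⟩
  col_eq x _ := by
    rw [colourAt, dif_pos (σ x c).isLt, Perm.mul_apply, ← hc, Perm.viaEmbedding_apply]
  cols j := by
    rw [cols, Finset.mem_image]
    constructor
    · rintro ⟨q, hq, rfl⟩
      obtain ⟨i, rfl⟩ := (hB q).1 hq
      exact ⟨i, i.isLt, by rw [colourAt, dif_pos i.isLt]⟩
    · rintro ⟨i, hi, rfl⟩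
      exact ⟨e ⟨i, hi⟩, (hB _).2 ⟨_, rfl⟩, by rw [colourAt, dif_pos hi]⟩

/-- A numbering of the permutations of four symbols. -/
def perm4 (i : ℕ) : Perm (Fin 4) :=
  swap 0 (Fin.ofNat 4 (i / 6)) * swap 1 (Fin.ofNat 4 (1 + i / 2 % 3)) *
    swap 2 (Fin.ofNat 4 (2 + i % 2))

/-- A numbering of the permutations of three symbols. -/
def perm3 (i : ℕ) : Perm (Fin 3) :=
  swap 0 (Fin.ofNat 3 (i / 2)) * swap 1 (Fin.ofNat 3 (1 + i % 2))

theorem perm4_inj : ∀ x < 24, ∀ y < 24, perm4 x = perm4 y → x = y := by decide +kernel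

theorem perm3_inj : ∀ x < 6, ∀ y < 6, perm3 x = perm3 y → x = y := by decide +kernel

theorem edges4_spec : ∀ t ∈ edges4, t.1 < 24 ∧ t.2.1 < 24 ∧
    t.2.2 = 2 ^ t.1 ||| 2 ^ t.2.1 ∧ (EG (Fin 4)).Adj (perm4 t.1) (perm4 t.2.1) := by
  decide +kernel

theorem edges3_spec : ∀ t ∈ edges3, t.1 < 6 ∧ t.2.1 < 6 ∧
    t.2.2 = 2 ^ t.1 ||| 2 ^ t.2.1 ∧ (EG (Fin 3)).Adj (perm3 t.1) (perm3 t.2.1) := by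
  decide +kernel

theorem colours4_spec : ∀ i < 4, colours4.getD i 0 < 2 ^ 24 ∧ ∀ x < 24,
    (colours4.getD i 0).testBit x = true → (perm4 x 2 : ℕ) = i := by
  decide +kernel

theorem coded4 {B : Finset α} (hB : Core B) (h4 : B.card = 4) (g : Perm α) :
    ∃ f κ, Coded B g 24 edges4 f κ (fun x => (perm4 x 2 : ℕ)) 4 := by
  obtain ⟨p, hp, hpe⟩ := exists_ext hB h4.ge
  have hsub : ({a, b, c, p} : Finset α) ⊆ B := by
    intro q hq
    simp only [Finset.mem_insert, Finset.mem_singleton] at hq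
    rcases hq with rfl | rfl | rfl | rfl
    exacts [hB.1, hB.2.1, hB.2.2, hp]
  have hab := hab (α := α); have hac := hac (α := α); have hbc := hbc (α := α)
  obtain ⟨hpa, hpb, hpc⟩ := hpe
  have hcard : ({a, b, c, p} : Finset α).card = 4 := by
    rw [Finset.card_insert_of_notMem, Finset.card_insert_of_notMem, Finset.card_pair hpc.symm]
    · simp [hbc, hpb.symm]
    · simp [hab, hac, hpa.symm]
  have hBe := Finset.eq_of_subset_of_card_le hsub (by rw [hcard, h4])
  have hinj : Function.Injective (![a, b, c, p] : Fin 4 → α) := by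
    intro x y h
    fin_cases x <;> fin_cases y <;> simp_all [eq_comm]
  refine ⟨_, _, coded_transfer (k := 1) le_rfl (e := ⟨![a, b, c, p], hinj⟩) rfl rfl rfl ?_
    (σ := perm4) (by decide +kernel) perm4_inj edges4_spec g⟩
  intro q
  rw [← hBe, Set.mem_range]
  simp [Fin.exists_fin_succ, eq_comm]

theorem coded3 {B : Finset α} (hB : Core B) (h3 : B.card = 3) (g : Perm α) :
    ∃ f κ, Coded B g 6 edges3 f κ (fun x => (perm3 x 2 : ℕ)) 3 := by
  have hsub : ({a, b, c} : Finset α) ⊆ B := by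
    intro q hq
    simp only [Finset.mem_insert, Finset.mem_singleton] at hq
    rcases hq with rfl | rfl | rfl
    exacts [hB.1, hB.2.1, hB.2.2]
  have hab := hab (α := α); have hac := hac (α := α); have hbc := hbc (α := α)
  have hBe := Finset.eq_of_subset_of_card_le hsub (by rw [card_core, h3])
  have hinj : Function.Injective (![a, b, c] : Fin 3 → α) := by
    intro x y h
    fin_cases x <;> fin_cases y <;> simp_all [eq_comm]
  refine ⟨_, _, coded_transfer (k := 0) zero_le_one (e := ⟨![a, b, c], hinj⟩) rfl rfl rfl ?_
    (σ := perm3) (by decide +kernel) perm3_inj edges3_spec g⟩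
  intro q
  rw [← hBe, Set.mem_range]
  simp [Fin.exists_fin_succ, eq_comm]

theorem Packed.congr {B : Finset α} {u v : Perm α} {S : Finset (Perm α)} (h : v ∈ K B u)
    (hp : Packed B v S) : Packed B u S := by
  rwa [Packed, K_eq h, cols_eq h] at hp

theorem packed_base4 (B : Finset α) (hB : Core B) (h4 : B.card = 4) (u : Perm α)
    (S : Finset (Perm α)) (hS4 : S.card = 4) (hS : ∀ s ∈ S, s ∈ K B u) : Packed B u S := by
  obtain ⟨g, hg⟩ := Finset.card_pos.1 (show 0 < S.card by omega)
  obtain ⟨f, κ, hc⟩ := coded4 hB h4 g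
  exact (hc.packed (M := 3) rfl checks_pack4 (by rwa [K_eq (hS g hg)]) hg hS4).congr (hS g hg)

theorem packed_base3 (B : Finset α) (hB : Core B) (h3 : B.card = 3) (u : Perm α)
    (S : Finset (Perm α)) (hS4 : S.card = 4) (hS : ∀ s ∈ S, s ∈ K B u) : Packed B u S := by
  obtain ⟨g, hg⟩ := Finset.card_pos.1 (show 0 < S.card by omega)
  obtain ⟨f, κ, hc⟩ := coded3 hB h3 g
  exact (hc.packed (M := 2) rfl checks_pack3 (by rwa [K_eq (hS g hg)]) hg hS4).congr (hS g hg)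

theorem fan_base4 (B : Finset α) (hB : Core B) (h4 : B.card = 4) (u : Perm α)
    (S : Finset (Perm α)) (hS3 : S.card = 3) (hS : ∀ s ∈ S, s ∈ K B u) :
    Fan B u (fun _ => False) S := by
  obtain ⟨g, hg⟩ := Finset.card_pos.1 (show 0 < S.card by omega)
  obtain ⟨f, κ, hc⟩ := coded4 hB h4 g
  have := hc.fan (seeds := colours4) rfl (fun i R hi x hx => by
    have hi4 : i < 4 := (List.getElem?_eq_some_iff.1 hi).1
    have hR : colours4.getD i 0 = R := by rw [List.getD_eq_getElem?_getD, hi]; rfl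
    obtain ⟨h1, h2⟩ := colours4_spec i hi4
    rw [hR] at h1 h2
    have hx24 : x < 24 := (Nat.pow_lt_pow_iff_right (by norm_num)).1
      ((Nat.ge_two_pow_of_testBit hx).trans_lt h1)
    exact ⟨hx24, h2 x hx24 hx⟩) checks_fan (by rwa [K_eq (hS g hg)]) hg hS3
  rwa [Fan, K_eq (hS g hg), cols_eq (hS g hg)] at this

theorem packed_univ (h3 : 3 ≤ Fintype.card α) (S : Finset (Perm α)) (hS : S.card = 4) :
    Packed Finset.univ (1 : Perm α) S := by
  have hB : Core (Finset.univ : Finset α) := ⟨by simp, by simp, by simp⟩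
  have hK : ∀ s ∈ S, s ∈ K Finset.univ (1 : Perm α) := fun s _ q hq => (hq (by simp)).elim
  rcases h3.eq_or_lt with h | h
  · exact packed_base3 _ hB (by rw [Finset.card_univ, ← h]) _ S hS hK
  · exact packed_all fan_base4 packed_base4 (Fintype.card α - 4) _
      (by rw [Finset.card_univ]; omega) hB _ S hS hK

theorem exists_subtree {V : Type*} [Finite V] {G H : SimpleGraph V} (hle : H ≤ G) (s : V) :
    ∃ T : G.Subgraph, T.coe.IsTree ∧ (∀ v, v ∈ T.verts ↔ H.Reachable s v) ∧
      ∀ u v, T.Adj u v → H.Adj u v := by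
  obtain ⟨F, hF, htree⟩ :=
    (H.connectedComponentMk s).connected_toSimpleGraph.exists_isTree_le
  have hv (v : V) : v ∈ H.connectedComponentMk s ↔ H.Reachable s v := by
    rw [SimpleGraph.reachable_comm]
    exact SimpleGraph.ConnectedComponent.eq
  let T : G.Subgraph :=
    { verts := {v | v ∈ H.connectedComponentMk s}
      Adj := fun u v => ∃ hu hv, F.Adj ⟨u, hu⟩ ⟨v, hv⟩
      adj_sub := fun ⟨_, _, h⟩ => hle (hF h)
      edge_vert := fun ⟨hu, _, _⟩ => hu
      symm := ⟨fun _ _ ⟨hu, hv, h⟩ => ⟨hv, hu, h.symm⟩⟩ }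
  have hT : T.coe = F := by
    ext u v
    exact ⟨fun ⟨_, _, h⟩ => h, fun h => ⟨u.2, v.2, h⟩⟩
  exact ⟨T, by rw [hT]; exact htree, hv, fun u v ⟨_, _, h⟩ => hF h⟩

theorem Packed.exists_family {S : Finset (Perm α)} (h : Packed Finset.univ (1 : Perm α) S)
    (hS : S.Nonempty) :
    ∃ T : Fin (Fintype.card α - 1) → (EG α).Subgraph, IsIDSTFamily (EG α) (S : Set (Perm α)) T := by
  obtain ⟨c0, -, ℓ, μ, h⟩ := h
  obtain ⟨s, hs⟩ := hS
  have hK (w : Perm α) : w ∈ K Finset.univ (1 : Perm α) := fun q hq => (hq (by simp)).elim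
  have hle (j : α) : TG (K Finset.univ (1 : Perm α)) S ℓ μ j ≤ EG α := fun u v h => h.1
  choose T hT hv hadj using fun j => exists_subtree (hle j) s
  have hcard : (Finset.univ.erase c0).card = Fintype.card α - 1 := by
    rw [Finset.card_erase_of_mem (Finset.mem_univ _), Finset.card_univ]
  let e := (Finset.univ.erase c0).equivFinOfCardEq hcard
  have hlab (j : α) {v : Perm α} (h' : v ∈ (T j).verts) (hvS : v ∉ S) : ℓ v = j :=
    (TG.av ((hv j v).1 h') (Av.of_mem (hK s) hs)).2 hvS
  have hSv (i) : (S : Set (Perm α)) ⊆ (T (e.symm i)).verts := fun t ht =>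
    (hv _ t).2 (h _ (mem_cols.2 (Finset.mem_univ _)) (Finset.mem_erase.1 (e.symm i).2).1 s hs t ht)
  refine ⟨fun i => T (e.symm i), fun i => ⟨hSv i, hT _⟩, fun i i' hii => ?_⟩
  have hne : (e.symm i : α) ≠ e.symm i' := fun h' => hii (e.symm.injective (Subtype.ext h'))
  constructor
  · refine Set.Subset.antisymm (fun v hv' => ?_) (Set.subset_inter (hSv i) (hSv i'))
    by_contra hvS
    exact hne ((hlab _ hv'.1 hvS).symm.trans (hlab _ hv'.2 hvS))
  · rw [Set.eq_empty_iff_forall_notMem]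
    rintro ⟨u, v⟩ ⟨h1, h2⟩
    have h1 := hadj _ u v h1
    have h2 := hadj _ u v h2
    by_cases hu : u ∈ S
    · by_cases hv : v ∈ S
      · exact hne ((h1.2.2.2 hu hv).1.symm.trans (h2.2.2.2 hu hv).1)
      · exact hne ((h1.2.2.1.2 hv).symm.trans (h2.2.2.1.2 hv))
    · exact hne ((h1.2.1.2 hu).symm.trans (h2.2.1.2 hu))

section Upper

variable {V : Type*} [Finite V] {G : SimpleGraph V} {S : Set V} {r : ℕ} {T : Fin r → G.Subgraph}

theorem exists_tree_adj (hT : IsIDSTFamily G S T) {x y : V} (hx : x ∈ S) (hy : y ∈ S) (hxy : x ≠ y)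
    (i : Fin r) : ∃ w, (T i).Adj x w := by
  have hx' := (hT.1 i).1 hx
  have hy' := (hT.1 i).1 hy
  have hr := (hT.1 i).2.connected.preconnected ⟨x, hx'⟩ ⟨y, hy'⟩
  obtain ⟨p⟩ := hr
  cases p with
  | nil => exact (hxy rfl).elim
  | cons h p => exact ⟨_, h⟩

theorem tree_eq (hT : IsIDSTFamily G S T) {x w : V} {i k : Fin r} (hi : (T i).Adj x w)
    (hk : (T k).Adj x w) : i = k := by
  by_contra h
  have : s(x, w) ∈ (T i).edgeSet ∩ (T k).edgeSet := ⟨hi, hk⟩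
  rw [(hT.2 i k h).2] at this
  exact this

theorem family_le (hT : IsIDSTFamily G S T) {x y : V} (hx : x ∈ S) (hy : y ∈ S) (hxy : x ≠ y) :
    r ≤ (G.neighborSet x).ncard := by
  choose f hf using exists_tree_adj hT hx hy hxy
  have hinj : Function.Injective f := fun i k h => tree_eq hT (hf i) (h ▸ hf k)
  have : (Set.range f).ncard = r := by
    rw [← Nat.card_coe_set_eq, Nat.card_range_of_injective hinj, Nat.card_fin]
  rw [← this]
  exact Set.ncard_le_ncard (by rintro _ ⟨i, rfl⟩; exact (hf i).adj_sub) (Set.toFinite _)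

theorem family_exact (hT : IsIDSTFamily G S T) {x y : V} (hx : x ∈ S) (hy : y ∈ S) (hxy : x ≠ y)
    (hr : (G.neighborSet x).ncard ≤ r) :
    (∀ w, G.Adj x w → ∃ i, (T i).Adj x w) ∧
      ∀ i w w', (T i).Adj x w → (T i).Adj x w' → w = w' := by
  choose f hf using exists_tree_adj hT hx hy hxy
  have hinj : Function.Injective f := fun i k h => tree_eq hT (hf i) (h ▸ hf k)
  have : (Set.range f).ncard = r := by
    rw [← Nat.card_coe_set_eq, Nat.card_range_of_injective hinj, Nat.card_fin]
  have heq : Set.range f = G.neighborSet x :=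
    Set.eq_of_subset_of_ncard_le (by rintro _ ⟨i, rfl⟩; exact (hf i).adj_sub) (by rwa [this])
      (Set.toFinite _)
  have hsurj (w) (h : G.Adj x w) : ∃ i, f i = w := by
    have : w ∈ G.neighborSet x := h
    rwa [← heq] at this
  refine ⟨fun w h => ?_, fun i w w' h h' => ?_⟩
  · obtain ⟨i, rfl⟩ := hsurj w h
    exact ⟨i, hf i⟩
  · obtain ⟨k, rfl⟩ := hsurj w h.adj_sub
    obtain ⟨k', rfl⟩ := hsurj w' h'.adj_sub
    rw [tree_eq hT (hf k) h, tree_eq hT (hf k') h']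

theorem family_ne (hT : IsIDSTFamily G S T) {x y z : V} (hx : x ∈ S) (hy : y ∈ S) (hz : z ∈ S)
    (hadj : G.Adj x y) (hzx : z ≠ x) (hzy : z ≠ y) (hrx : (G.neighborSet x).ncard ≤ r)
    (hry : (G.neighborSet y).ncard ≤ r) : False := by
  obtain ⟨h1, h2⟩ := family_exact hT hx hy hadj.ne hrx
  obtain ⟨-, h3⟩ := family_exact hT hy hx hadj.ne.symm hry
  obtain ⟨i, hi⟩ := h1 y hadj
  have hr := (hT.1 i).2.connected.preconnected ⟨x, (hT.1 i).1 hx⟩ ⟨z, (hT.1 i).1 hz⟩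
  have key : ∀ v, (T i).coe.Reachable ⟨x, (hT.1 i).1 hx⟩ v → (v : V) = x ∨ (v : V) = y := by
    rintro v hv
    rw [SimpleGraph.reachable_iff_reflTransGen] at hv
    induction hv with
    | refl => exact Or.inl rfl
    | tail _ hbc ih =>
      rename_i b c _
      have hbc : (T i).Adj b c := hbc
      rcases ih with ih | ih
      · rw [ih] at hbc; exact Or.inr (h2 i _ _ hbc hi)
      · rw [ih] at hbc; exact Or.inl (h3 i _ _ hbc hi.symm)
  rcases key _ hr with h | h
  exacts [hzx h, hzy h]

end Upper

theorem neighborSet_ncard_le (u : Perm α) : ((EG α).neighborSet u).ncard ≤ Fintype.card α := by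
  have hsub : (EG α).neighborSet u ⊆
      (insert (bar u) ((Finset.univ.erase (u c)).image (con u)) : Finset (Perm α)) := by
    rintro v (rfl | ⟨h1, h2⟩)
    · simp
    · rw [Finset.mem_coe, Finset.mem_insert, Finset.mem_image]
      refine Or.inr ⟨v c, Finset.mem_erase.2 ⟨fun h => h1 ?_, Finset.mem_univ _⟩, h2.symm⟩
      rw [h2, h, con_self]
  refine (Set.ncard_le_ncard hsub (Set.toFinite _)).trans ?_
  rw [Set.ncard_coe_finset]
  refine (Finset.card_insert_le _ _).trans ?_
  have h1 := Finset.card_image_le (s := Finset.univ.erase (u c)) (f := con u)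
  rw [Finset.card_erase_of_mem (Finset.mem_univ _), Finset.card_univ] at h1
  have := Fintype.card_pos_iff.2 ⟨u c⟩
  omega

theorem genConn_EG (h3 : 3 ≤ Fintype.card α) : genConn (EG α) 4 = Fintype.card α - 1 := by
  have hbdd {S : Finset (Perm α)} (hS : S.card = 4) {r : ℕ} {T : Fin r → (EG α).Subgraph}
      (hT : IsIDSTFamily (EG α) (S : Set (Perm α)) T) : r ≤ Fintype.card α := by
    obtain ⟨x, hx, y, hy, hxy⟩ := Finset.one_lt_card.1 (show 1 < S.card by omega)
    exact (family_le hT hx hy hxy).trans (neighborSet_ncard_le x)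
  have hlow {S : Finset (Perm α)} (hS : S.card = 4) :
      Fintype.card α - 1 ≤ maxIDST (EG α) (S : Set (Perm α)) :=
    le_csSup ⟨Fintype.card α, fun r ⟨T, hT⟩ => hbdd hS hT⟩
      ((packed_univ h3 S hS).exists_family (Finset.card_pos.1 (by omega)))
  have hne : (1 : Perm α) ≠ bar 1 := (adj_bar 1).ne
  obtain ⟨S, hsub, -, hS⟩ := Finset.exists_subsuperset_card_eq
    (Finset.subset_univ ({1, bar 1} : Finset (Perm α))) (n := 4)
    (by rw [Finset.card_pair hne]; norm_num) (by
      rw [Finset.card_univ, Fintype.card_perm]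
      exact (show 4 ≤ Nat.factorial 3 by decide).trans (Nat.factorial_le h3))
  have hup : maxIDST (EG α) (S : Set (Perm α)) ≤ Fintype.card α - 1 := by
    refine csSup_le ⟨_, (packed_univ h3 S hS).exists_family (Finset.card_pos.1 (by omega))⟩ ?_
    rintro r ⟨T, hT⟩
    have hle := hbdd hS hT
    by_contra hlt
    have hr : r = Fintype.card α := by omega
    have hx : (1 : Perm α) ∈ S := hsub (by simp)
    have hy : bar (1 : Perm α) ∈ S := hsub (by simp)
    obtain ⟨z, hz⟩ := Finset.card_pos.1 (show 0 < ((S.erase 1).erase (bar 1)).card by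
      rw [Finset.card_erase_of_mem (Finset.mem_erase.2 ⟨hne.symm, hy⟩),
        Finset.card_erase_of_mem hx, hS]
      norm_num)
    simp only [Finset.mem_erase] at hz
    exact family_ne hT hx hy hz.2.2 (adj_bar 1) hz.2.1 hz.1
      (hr ▸ neighborSet_ncard_le _) (hr ▸ neighborSet_ncard_le _)
  refine le_antisymm (Nat.sInf_le ⟨S, hS, le_antisymm hup (hlow hS)⟩) ?_
  refine le_csInf ⟨_, S, hS, rfl⟩ ?_
  rintro m ⟨S', hS', rfl⟩
  exact hlow hS'

theorem godanGraph_eq (k : ℕ) (hn : 3 ≤ k + 3) : godanGraph (k + 3) hn = EG (Fin (k + 3)) := by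
  have hadj (v : Perm (Fin (k + 3))) (r : Fin (k + 3)) (hr : r ≠ c) :
      (EG (Fin (k + 3))).Adj v (v * tau r) := by
    have : con v (v r) = v * tau r := by rw [con, Equiv.symm_apply_apply]
    rw [← this]
    exact adj_con fun h => hr (v.injective h).symm
  have hΩ : ∀ v, ∀ s ∈ OmegaStar (k + 3) hn, (EG (Fin (k + 3))).Adj v (v * s) := by
    rintro v s ((rfl | rfl | rfl) | ⟨q, hq, rfl⟩)
    · exact adj_bar v
    · have := hadj v a hac
      rwa [tau_a] at this
    · have := hadj v b hbc
      rwa [tau_b] at this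
    · have hq' : Ext q := by
        refine ⟨?_, ?_, ?_⟩ <;> rintro rfl
        exacts [absurd (show 3 ≤ 0 from hq) (by decide), absurd (show 3 ≤ 1 from hq) (by decide),
          absurd (show 3 ≤ 2 from hq) (by decide)]
      have := hadj v q hq'.2.2
      rwa [tau_ext hq'] at this
  ext u v
  rw [godanGraph, SimpleGraph.fromRel_adj]
  constructor
  · rintro ⟨-, ⟨s, hs, rfl⟩ | ⟨s, hs, rfl⟩⟩
    · exact (hΩ v s hs).symm
    · exact hΩ u s hs
  · intro h
    refine ⟨h.ne, Or.inr ?_⟩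
    rcases h with h | ⟨h1, h2⟩
    · exact ⟨_, Or.inl (Or.inl rfl), h⟩
    · refine ⟨_, ?_, h2⟩
      rcases pos_cases (u.symm (v c)) with h | h | h | h
      · rw [h, tau_a]; exact Or.inl (Or.inr (Or.inl rfl))
      · rw [h, tau_b]; exact Or.inl (Or.inr (Or.inr rfl))
      · refine (h1 ?_).elim
        rw [h2, con, h, tau_cc, mul_one]
      · rw [tau_ext h]
        refine Or.inr ⟨_, ?_, rfl⟩
        obtain ⟨h1, h2, h3⟩ := h
        have ha : ((a : Fin (k + 3)) : ℕ) = 0 := rfl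
        have hb : ((b : Fin (k + 3)) : ℕ) = 1 := rfl
        have hc : ((c : Fin (k + 3)) : ℕ) = 2 := rfl
        have h1 := fun h => h1 (Fin.ext h)
        have h2 := fun h => h2 (Fin.ext h)
        have h3 := fun h => h3 (Fin.ext h)
        omega

end General

/-- For every integer n ≥ 3, the generalized 4-connectivity of the godan graph
EA_n equals n − 1. -/
theorem kappa4_godan (n : ℕ) (hn : 3 ≤ n) :
    genConn (godanGraph n hn) 4 = n - 1 := by
  obtain ⟨k, rfl⟩ := Nat.exists_eq_add_of_le' hn
  rw [godanGraph_eq, genConn_EG (by rw [Fintype.card_fin]; omega), Fintype.card_fin]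

end Godan
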